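/- Let λ be a positive continuous function on ∂D, let u ∈ C(D̄) be harmonic on D with u|_{∂D} = −(1/2)log λ, and set ψ = G_D(·,z₀). Then the kernel K̂_λ(z₀) := K_{λ,ψ}(z₀) (the weighted Szegő kernel with boundary weight λ·(∂G_D(·,z₀)/∂v_z)^{-1}, evaluated at (z₀,z̄₀)) satisfies K̂_λ(z₀) ≥ π B_{e^{-2u}}(z₀), and equality holds if and only if χ_{z₀} = χ_{−u}. -/

import Mathlib

open MeasureTheory Metric Complex Set Filter

noncomputable section

/-- `u` is harmonic on `s`: locally the real part of a holomorphic function. -/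
def HarmonicOnD (u : ℂ → ℝ) (s : Set ℂ) : Prop :=
  ∀ z ∈ s, ∃ r > 0, Metric.ball z r ⊆ s ∧ ∃ f : ℂ → ℂ,
    DifferentiableOn ℂ f (Metric.ball z r) ∧ ∀ w ∈ Metric.ball z r, u w = (f w).re

/-- Upper circle average of an `EReal`-valued function (via decreasing truncations). -/
noncomputable def circleAvgE (u : ℂ → EReal) (z : ℂ) (r : ℝ) : EReal :=
  ⨅ n : ℕ, ((((2 * Real.pi)⁻¹ *
      ∫ θ in (0:ℝ)..(2 * Real.pi),
        (max (u (circleMap z r θ)) ((-(n : ℝ) : ℝ) : EReal)).toReal) : ℝ) : EReal)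

/-- `u` is subharmonic on the open set `s`. -/
def SubharmonicOnE (u : ℂ → EReal) (s : Set ℂ) : Prop :=
  UpperSemicontinuousOn u s ∧ (∀ z ∈ s, u z ≠ ⊤) ∧ (∃ z ∈ s, u z ≠ ⊥) ∧
  ∀ z ∈ s, ∀ r : ℝ, 0 < r → Metric.closedBall z r ⊆ s → u z ≤ circleAvgE u z r

/-- The Lelong number `v(dd^c u, z₀)` of a subharmonic function. -/
noncomputable def lelongNumber (u : ℂ → EReal) (z₀ : ℂ) : ℝ :=
  sSup {a : ℝ | 0 ≤ a ∧ ∃ C : ℝ, ∃ r > 0, ∀ z : ℂ, z ≠ z₀ → dist z z₀ < r →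
    u z ≤ ((a * Real.log (dist z z₀) + C : ℝ) : EReal)}

/-- `G` is the (negative) Green function of `D` with pole at `z₀`. -/
structure IsGreenFunction (D : Set ℂ) (z₀ : ℂ) (G : ℂ → EReal) : Prop where
  neg : ∀ z ∈ D, G z < 0
  pole : G z₀ = ⊥
  logharm : ∃ h : ℂ → ℝ, HarmonicOnD h D ∧
    ∀ z ∈ D \ {z₀}, G z = ((Real.log (dist z z₀) + h z : ℝ) : EReal)
  bdry : ∀ w ∈ frontier D, Filter.Tendsto (fun z => (G z).toReal) (nhdsWithin w D) (nhds 0)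

/-- `Γ` is an analytic Jordan curve. -/
def IsAnalyticJordanCurve (Γ : Set ℂ) : Prop :=
  ∃ γ : ℝ → ℂ, AnalyticOnNhd ℝ γ Set.univ ∧ Function.Periodic γ (2 * Real.pi) ∧
    (∀ t, deriv γ t ≠ 0) ∧ Set.InjOn γ (Set.Ico 0 (2 * Real.pi)) ∧ Γ = Set.range γ

/-- `D` is a bounded planar regular region whose boundary consists of `n`
analytic Jordan curves. -/
def IsRegularRegion (n : ℕ) (D : Set ℂ) : Prop :=
  IsOpen D ∧ IsConnected D ∧ Bornology.IsBounded D ∧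
  ∃ Γ : Fin n → Set ℂ, (∀ i, IsAnalyticJordanCurve (Γ i)) ∧
    (Pairwise fun i j => Disjoint (Γ i) (Γ j)) ∧ frontier D = ⋃ i, Γ i

/-- `ν` is the outward unit normal vector field on `∂D`. -/
def IsOutwardUnitNormal (D : Set ℂ) (ν : ℂ → ℂ) : Prop :=
  ∀ z ∈ frontier D, ‖ν z‖ = 1 ∧
    (∀ᶠ t in nhdsWithin (0:ℝ) (Set.Ioi (0:ℝ)),
      z + t • ν z ∉ closure D ∧ z - t • ν z ∈ D) ∧
    (∀ γ : ℝ → ℂ, γ 0 = z → (∀ᶠ t in nhds (0:ℝ), γ t ∈ frontier D) →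
      DifferentiableAt ℝ γ 0 → ((starRingEnd ℂ) (ν z) * deriv γ 0).re = 0)

/-- Arclength (1-dimensional Hausdorff) measure on the boundary of `D`. -/
noncomputable def bdryArc (D : Set ℂ) : Measure ℂ :=
  (MeasureTheory.Measure.hausdorffMeasure 1).restrict (frontier D)

/-- The analytic Hardy class `H₂^(c)(D)`. -/
def HardyH2c (D : Set ℂ) (f : ℂ → ℂ) : Prop :=
  DifferentiableOn ℂ f D ∧ ∃ U : ℂ → ℝ, HarmonicOnD U D ∧ ∀ z ∈ D, ‖f z‖ ^ 2 ≤ U z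

/-- Nontangential convergence of `f` to `L` at the boundary point `w`. -/
def NTTendsto (D : Set ℂ) (f : ℂ → ℂ) (w L : ℂ) : Prop :=
  ∀ α : ℝ, 1 < α →
    Filter.Tendsto f
      (nhdsWithin w {z | z ∈ D ∧ dist z w ≤ α * Metric.infDist z (frontier D)}) (nhds L)

/-- `g` is the nontangential boundary value function of `f` (a.e. on `∂D`). -/
def IsNTBoundaryValue (D : Set ℂ) (f g : ℂ → ℂ) : Prop :=
  ∀ᵐ w ∂(bdryArc D), NTTendsto D f w (g w)

/-- `K` is the weighted Szegő kernel of `D` with boundary weight `lam`. -/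
structure IsSzegoKernel (D : Set ℂ) (lam : ℂ → ℝ) (K : ℂ → ℂ → ℂ) : Prop where
  holo : ∀ w ∈ D, DifferentiableOn ℂ (fun z => K z w) D
  cont : ∀ w ∈ D, ContinuousOn (fun z => K z w) (closure D)
  hardy : ∀ w ∈ D, HardyH2c D (fun z => K z w)
  hermitian : ∀ z ∈ D, ∀ w ∈ D, K z w = (starRingEnd ℂ) (K w z)
  sqfin : ∀ w ∈ D, (∫⁻ z, ENNReal.ofReal (‖K z w‖ ^ 2 * lam z) ∂(bdryArc D)) ≠ ⊤
  reproduce : ∀ f fb : ℂ → ℂ, HardyH2c D f → IsNTBoundaryValue D f fb → ∀ w ∈ D,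
    f w = ((2 * Real.pi)⁻¹ : ℂ) * ∫ z, fb z * (starRingEnd ℂ) (K z w) * (lam z : ℂ) ∂(bdryArc D)

/-- `B` is the weighted Bergman kernel of `D` with weight `ρ`. -/
structure IsBergmanKernel (D : Set ℂ) (ρ : ℂ → ℝ) (B : ℂ → ℂ → ℂ) : Prop where
  holo : ∀ w ∈ D, DifferentiableOn ℂ (fun z => B z w) D
  hermitian : ∀ z ∈ D, ∀ w ∈ D, B z w = (starRingEnd ℂ) (B w z)
  sqfin : ∀ w ∈ D, (∫⁻ z in D, ENNReal.ofReal (‖B z w‖ ^ 2 * ρ z)) ≠ ⊤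
  reproduce : ∀ f : ℂ → ℂ, DifferentiableOn ℂ f D →
    IntegrableOn (fun z => ‖f z‖ ^ 2) D volume → ∀ w ∈ D,
      f w = ∫ z in D, f z * (starRingEnd ℂ) (B z w) * (ρ z : ℂ)

/-- Extended-real logarithm (with `elog 0 = ⊥`). -/
noncomputable def elog (x : ℝ) : EReal := if x = 0 then ⊥ else ((Real.log x : ℝ) : EReal)

/-- `χ_{z₀}^m = χ_{-u}`: there is a holomorphic `F` on `D` with `log |F| = m·G + u`. -/
def charEqGreenPow (D : Set ℂ) (z₀ : ℂ) (G : ℂ → EReal) (u : ℂ → ℝ) (m : ℕ) : Prop :=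
  ∃ F : ℂ → ℂ, DifferentiableOn ℂ F D ∧ ∀ z ∈ D \ {z₀},
    F z ≠ 0 ∧ Real.log ‖F z‖ = m * (G z).toReal + u z

/-- `χ_{z₀} = χ_{-u}`. -/
def charEqGreen (D : Set ℂ) (z₀ : ℂ) (G : ℂ → EReal) (u : ℂ → ℝ) : Prop :=
  charEqGreenPow D z₀ G u 1

/-- The weight `ρ = e^{-φ} c(-2ψ)` (realized through `EReal.toReal`). -/
noncomputable def wgt2 (φ ψ : ℂ → EReal) (c : ℝ → ℝ) (z : ℂ) : ℝ :=
  Real.exp (-(φ z).toReal) * c ((-((2 : EReal) * ψ z)).toReal)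

/-- The weight `e^{-φ} c(-ψ)` (realized through `EReal.toReal`). -/
noncomputable def wgt1 (φ ψ : ℂ → EReal) (c : ℝ → ℝ) (z : ℂ) : ℝ :=
  Real.exp (-(φ z).toReal) * c ((-(ψ z)).toReal)

/-- Admissible gain function `c` on `[0,∞)`. -/
structure AdmissibleC (c : ℝ → ℝ) : Prop where
  meas : Measurable c
  pos : ∀ t : ℝ, 0 ≤ t → 0 < c t
  mono : ∀ s t : ℝ, 0 ≤ s → s ≤ t → c t * Real.exp (-t) ≤ c s * Real.exp (-s)
  limz : Filter.Tendsto c (nhdsWithin 0 (Set.Ioi 0)) (nhds 1)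
  czero : c 0 = 1
  fin : (∫⁻ t in Set.Ioi (0:ℝ), ENNReal.ofReal (c t * Real.exp (-t))) ≠ ⊤

/-- Admissible gain function `c` on `(0,∞)` (no normalization at `0`). -/
structure AdmissibleC' (c : ℝ → ℝ) : Prop where
  meas : Measurable c
  pos : ∀ t : ℝ, 0 < t → 0 < c t
  mono : ∀ s t : ℝ, 0 < s → s ≤ t → c t * Real.exp (-t) ≤ c s * Real.exp (-s)
  fin : (∫⁻ t in Set.Ioi (0:ℝ), ENNReal.ofReal (c t * Real.exp (-t))) ≠ ⊤

/-- `Z` is a discrete subset of `D`. -/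
def DiscreteIn (Z D : Set ℂ) : Prop :=
  Z ⊆ D ∧ ∀ z ∈ D, ∃ r > 0, Metric.ball z r ∩ Z ⊆ {z}

/-- `w` has a positive lower bound on every compact subset of `D ∖ Z`. -/
def PosLowerBoundOnCompacts (D Z : Set ℂ) (w : ℂ → ℝ) : Prop :=
  ∀ Kc : Set ℂ, Kc ⊆ D \ Z → IsCompact Kc → ∃ m : ℝ, 0 < m ∧ ∀ z ∈ Kc, m ≤ w z

/-- `∫₀^∞ c(t) e^{-t} dt`. -/
noncomputable def cInt (c : ℝ → ℝ) : ℝ := ∫ t in Set.Ioi (0:ℝ), c t * Real.exp (-t)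

/-- `h(t) = ∫_t^∞ c(s) e^{-s} ds`. -/
noncomputable def hFun (c : ℝ → ℝ) (t : ℝ) : ℝ := ∫ s in Set.Ioi t, c s * Real.exp (-s)

end

namespace WS
open Topology

/-- `φ` has Wirtinger derivatives `a = ∂φ`, `b = ∂̄φ` at `z`. -/
def HasD (φ : ℂ → ℂ) (a b : ℂ) (z : ℂ) : Prop :=
  HasFDerivAt φ (a • (ContinuousLinearMap.id ℝ ℂ) + b • (conjCLE : ℂ →L[ℝ] ℂ)) z

theorem HasD.of_deriv {f : ℂ → ℂ} {f' z : ℂ} (h : HasDerivAt f f' z) : HasD f f' 0 z := by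
  have := h.hasFDerivAt.restrictScalars ℝ
  refine this.congr_fderiv ?_
  ext v
  simp [mul_comm]

theorem HasD.conj {f : ℂ → ℂ} {a b z : ℂ} (h : HasD f a b z) :
    HasD (fun z => (starRingEnd ℂ) (f z)) ((starRingEnd ℂ) b) ((starRingEnd ℂ) a) z := by
  have := (conjCLE : ℂ →L[ℝ] ℂ).hasFDerivAt.comp z h
  refine this.congr_fderiv ?_
  ext v
  simp
  ring

theorem HasD.mul {f g : ℂ → ℂ} {a b c d z : ℂ} (h : HasD f a b z) (h' : HasD g c d z) :
    HasD (fun z => f z * g z) (a * g z + f z * c) (b * g z + f z * d) z := by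
  have := HasFDerivAt.mul h h'
  refine this.congr_fderiv ?_
  ext v
  simp
  ring

theorem HasD.real_comp {E : ℂ → ℝ} {a b z : ℂ} {χ : ℝ → ℝ} {c : ℝ}
    (h : HasD (fun z => (E z : ℂ)) a b z) (h' : HasDerivAt χ c (E z)) :
    HasD (fun z => ((χ (E z) : ℝ) : ℂ)) (c * a) (c * b) z := by
  have hE : HasFDerivAt E (reCLM.comp (a • (ContinuousLinearMap.id ℝ ℂ) +
      b • (conjCLE : ℂ →L[ℝ] ℂ))) z := by
    have := reCLM.hasFDerivAt.comp z h
    simpa [Function.comp_def] using this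
  have h3 : ∀ v, (a * v + b * (starRingEnd ℂ) v).im = 0 := by
    intro v
    have := imCLM.hasFDerivAt.comp z h
    have h4 : HasFDerivAt (fun z => (0:ℝ)) (imCLM.comp (a • (ContinuousLinearMap.id ℝ ℂ) +
      b • (conjCLE : ℂ →L[ℝ] ℂ))) z := by
      simpa [Function.comp_def] using this
    have := h4.unique (hasFDerivAt_const 0 z)
    have := congrArg (fun l => l v) this
    simpa using this
  have := ofRealCLM.hasFDerivAt.comp z (h'.hasFDerivAt.comp z hE)
  refine this.congr_fderiv ?_
  ext1 v
  have h3 := h3 v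
  apply Complex.ext
  · simp
    ring
  · simp at h3 ⊢
    linear_combination (-c) * h3

theorem HasD.congr {f g : ℂ → ℂ} {a b z : ℂ} (h : HasD f a b z) (h' : g =ᶠ[𝓝 z] f) :
    HasD g a b z := HasFDerivAt.congr_of_eventuallyEq h h'

theorem HasD.unique {f : ℂ → ℂ} {a b c d z : ℂ} (h : HasD f a b z) (h' : HasD f c d z) :
    a = c ∧ b = d := by
  have := HasFDerivAt.unique h h'
  have h1 := congrArg (fun l => l 1) this
  have h2 := congrArg (fun l => l I) this
  simp at h1 h2
  have h2' : a - b = c - d := by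
    have : I * (a - b) = I * (c - d) := by linear_combination h2
    exact mul_left_cancel₀ I_ne_zero this
  constructor
  · linear_combination (h1 + h2') / 2
  · linear_combination (h1 - h2') / 2

theorem integral_HasD_zero {D : Set ℂ} (hD : IsOpen D) {φ a b : ℂ → ℂ}
    (h : ∀ z ∈ D, HasD φ (a z) (b z) z) (ha : ContinuousOn a D) (hb : ContinuousOn b D)
    {Kc : Set ℂ} (hK : IsCompact Kc) (hKD : Kc ⊆ D) (h0 : ∀ z ∈ D, z ∉ Kc → φ z = 0) :
    (∫ z in D, a z = 0) ∧ (∫ z in D, b z = 0) ∧ IntegrableOn a D ∧ IntegrableOn b D := by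
  -- derivatives vanish off Kc
  have hab : ∀ z ∈ D, z ∉ Kc → a z = 0 ∧ b z = 0 := by
    intro z hz hzK
    have hev : (fun _ => (0:ℂ)) =ᶠ[𝓝 z] φ := by
      have : D ∩ Kcᶜ ∈ 𝓝 z := (hD.inter hK.isClosed.isOpen_compl).mem_nhds ⟨hz, hzK⟩
      filter_upwards [this] with y hy using (h0 y hy.1 hy.2).symm
    have h1 := (h z hz).congr hev
    have h2 : HasD (fun _ => (0:ℂ)) 0 0 z := HasD.of_deriv (hasDerivAt_const z 0)
    exact h1.unique h2
  have key : ∀ c : ℂ → ℂ, ContinuousOn c D → (∀ z ∈ D, z ∉ Kc → c z = 0) →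
      Continuous (D.indicator c) ∧ HasCompactSupport (D.indicator c) := by
    intro c hc hc0
    have hsupp : ∀ z, z ∉ Kc → D.indicator c z = 0 := by
      intro z hz
      by_cases hzD : z ∈ D
      · rw [indicator_of_mem hzD]; exact hc0 z hzD hz
      · rw [indicator_of_notMem hzD]
    refine ⟨?_, HasCompactSupport.intro hK hsupp⟩
    rw [continuous_iff_continuousAt]
    intro z
    by_cases hz : z ∈ Kc
    · have hzD := hKD hz
      refine (hc.continuousAt (hD.mem_nhds hzD)).congr ?_
      filter_upwards [hD.mem_nhds hzD] with y hy using (indicator_of_mem hy c).symm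
    · have : (fun _ => (0:ℂ)) =ᶠ[𝓝 z] D.indicator c := by
        filter_upwards [hK.isClosed.isOpen_compl.mem_nhds hz] with y hy using (hsupp y hy).symm
      exact continuousAt_const.congr this
  obtain ⟨ac, as⟩ := key a ha (fun z h1 h2 => (hab z h1 h2).1)
  obtain ⟨bc, bs⟩ := key b hb (fun z h1 h2 => (hab z h1 h2).2)
  have hφc : ContinuousOn φ D := fun z hz => (HasFDerivAt.continuousAt (h z hz)).continuousWithinAt
  obtain ⟨pc, ps⟩ := key φ hφc h0
  have hd : ∀ z, HasD (D.indicator φ) (D.indicator a z) (D.indicator b z) z := by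
    intro z
    by_cases hz : z ∈ D
    · rw [indicator_of_mem hz, indicator_of_mem hz]
      refine (h z hz).congr ?_
      filter_upwards [hD.mem_nhds hz] with y hy using (indicator_of_mem hy φ)
    · rw [indicator_of_notMem hz, indicator_of_notMem hz]
      have h2 : HasD (fun _ => (0:ℂ)) 0 0 z := HasD.of_deriv (hasDerivAt_const z 0)
      refine h2.congr ?_
      filter_upwards [hK.isClosed.isOpen_compl.mem_nhds (fun hh => hz (hKD hh))] with y hy
      by_cases hyD : y ∈ D
      · rw [indicator_of_mem hyD]; exact h0 y hyD hy
      · rw [indicator_of_notMem hyD]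
  have ai := ac.integrable_of_hasCompactSupport (μ := volume) as
  have bi := bc.integrable_of_hasCompactSupport (μ := volume) bs
  have pi := pc.integrable_of_hasCompactSupport (μ := volume) ps
  have hfd : ∀ z, HasFDerivAt (D.indicator φ) ((D.indicator a z) • (ContinuousLinearMap.id ℝ ℂ) +
      (D.indicator b z) • (conjCLE : ℂ →L[ℝ] ℂ)) z := hd
  have I0 : ∀ v : ℂ, ∫ z, ((D.indicator a z) * v + (D.indicator b z) * (starRingEnd ℂ) v) = 0 := by
    intro v
    have e : ∀ z, (D.indicator a z) * v + (D.indicator b z) * (starRingEnd ℂ) v =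
        fderiv ℝ (D.indicator φ) z v := by
      intro z; rw [(hfd z).fderiv]; simp
    have hi : Integrable (fun z => fderiv ℝ (D.indicator φ) z v) := by
      simp_rw [← e]
      exact (ai.mul_const v).add (bi.mul_const _)
    have := integral_mul_fderiv_eq_neg_fderiv_mul_of_integrable (μ := (volume : Measure ℂ))
      (f := fun _ => (1:ℂ)) (g := D.indicator φ) (v := v) (by simp) (by simpa using hi)
      (by simpa using pi) (fun x _ => differentiableAt_const _)
      (fun x _ => (hfd x).differentiableAt)
    simp_rw [e]
    simpa using this
  have h1 := I0 1
  have h2 := I0 I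
  simp only [map_one, mul_one, conj_I] at h1 h2
  rw [integral_add ai bi] at h1
  have e2 : ∀ z, (D.indicator a z) * I + (D.indicator b z) * (-I) =
      I * (D.indicator a z) - I * (D.indicator b z) := fun z => by ring
  simp_rw [e2] at h2
  rw [integral_sub (ai.const_mul _) (bi.const_mul _), integral_const_mul, integral_const_mul,
    ← mul_sub] at h2
  have h2' := (mul_eq_zero.mp h2).resolve_left I_ne_zero
  rw [integral_indicator hD.measurableSet, integral_indicator hD.measurableSet] at h1 h2'
  refine ⟨by linear_combination (h1 + h2') / 2, by linear_combination (h1 - h2') / 2, ?_, ?_⟩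
  · exact (integrable_indicator_iff hD.measurableSet).mp ai
  · exact (integrable_indicator_iff hD.measurableSet).mp bi

/-- The basic radial computation. -/
theorem radial_pompeiu {θ θ' : ℝ → ℝ} (hθ : ∀ x, HasDerivAt θ (θ' x) x) (hc : Continuous θ')
    (h0 : θ 0 = 1) {R : ℝ} (hR : ∀ x, R ≤ x → θ x = 0 ∧ θ' x = 0) :
    ∫ z : ℂ, ((θ' (‖z‖ ^ 2) : ℝ) : ℂ) = -Real.pi := by
  rw [← Complex.integral_comp_polarCoord_symm]
  have h1 : ∀ p ∈ polarCoord.target, p.1 • ((θ' (‖Complex.polarCoord.symm p‖ ^ 2) : ℝ) : ℂ) =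
      (((p.1 * θ' (p.1 ^ 2) : ℝ) : ℂ)) * (1:ℂ) := by
    intro p hp
    simp
  rw [setIntegral_congr_fun polarCoord.open_target.measurableSet h1, polarCoord_target,
    Measure.volume_eq_prod]
  rw [setIntegral_prod_mul (μ := volume) (ν := volume)
    (fun r : ℝ => ((r * θ' (r ^ 2) : ℝ) : ℂ)) (fun _ : ℝ => (1:ℂ))]
  have hbig : ∀ r, 1 + |R| ≤ r → R ≤ r ^ 2 := by
    intro r hr
    have := abs_nonneg R
    have := le_abs_self R
    nlinarith
  have h2 : ∫ r in Ioi (0:ℝ), r * θ' (r ^ 2) = 0 - θ (0 ^ 2) / 2 := by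
    have hfd : ∀ x ∈ Ici (0:ℝ), HasDerivAt (fun r => θ (r ^ 2) / 2) (x * θ' (x ^ 2)) x := by
      intro x _
      have := ((hθ (x ^ 2)).comp x (hasDerivAt_pow 2 x)).div_const 2
      refine this.congr_deriv ?_
      simp
      ring
    refine integral_Ioi_of_hasDerivAt_of_tendsto' hfd ?_ ?_
    · refine Integrable.integrableOn ?_ |>.congr_fun (f := fun r => |r| * θ' (r ^ 2)) ?_
        measurableSet_Ioi
      · refine Continuous.integrable_of_hasCompactSupport (by fun_prop) ?_
        refine HasCompactSupport.intro (isCompact_Icc (a := -(1 + |R|)) (b := 1 + |R|)) ?_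
        intro x hx
        have : 1 + |R| ≤ |x| := by
          by_contra hcon
          push Not at hcon
          exact hx ⟨by linarith [(abs_lt.mp hcon).1], by linarith [(abs_lt.mp hcon).2]⟩
        have := hbig _ this
        rw [sq_abs] at this
        rw [(hR _ this).2, mul_zero]
      · intro x hx
        simp only [mem_Ioi] at hx
        simp [abs_of_pos hx]
    · refine tendsto_const_nhds.congr' ?_
      filter_upwards [eventually_ge_atTop (1 + |R|)] with r hr
      rw [(hR _ (hbig r hr)).1]; simp
  have h3 : ∫ x in Ioi (0:ℝ), ((x * θ' (x ^ 2) : ℝ) : ℂ) =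
      ((∫ x in Ioi (0:ℝ), x * θ' (x ^ 2) : ℝ) : ℂ) := integral_ofReal
  have h4 : ∫ y in Ioo (-Real.pi) Real.pi, (1:ℂ) = 2 * Real.pi := by
    rw [setIntegral_const]
    rw [Measure.real, Real.volume_Ioo, ENNReal.toReal_ofReal (by linarith [Real.pi_pos])]
    simp
    ring
  rw [h3, h2, h4]
  simp [h0]

theorem pompeiu_plateau {D : Set ℂ} (hD : IsOpen D) {φ a b : ℂ → ℂ}
    (h : ∀ z ∈ D, HasD φ (a z) (b z) z) (ha : ContinuousOn a D) (hb : ContinuousOn b D)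
    {Kc : Set ℂ} (hK : IsCompact Kc) (hKD : Kc ⊆ D) (h0 : ∀ z ∈ D, z ∉ Kc → φ z = 0)
    {m : ℂ → ℂ} (hm : DifferentiableOn ℂ m D) {ζ c : ℂ} (hζ : ζ ∈ D) (hpl : ∀ᶠ z in 𝓝 ζ, φ z = c) :
    ∫ z in D, m z / (z - ζ) * b z = -Real.pi * (c * m ζ) ∧
      IntegrableOn (fun z => m z / (z - ζ) * b z) D := by
  obtain ⟨r, hr, hball⟩ := Metric.eventually_nhds_iff_ball.mp
    (hpl.and (hD.mem_nhds hζ : ∀ᶠ z in 𝓝 ζ, z ∈ D))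
  set δ := r ^ 2 / 8 with hδ
  have hδ0 : 0 < δ := by positivity
  -- the radial cutoff
  let θ : ℝ → ℝ := fun x => 1 - Real.smoothTransition ((x - δ) / δ)
  have hθs : ContDiff ℝ 1 θ := by
    have : ContDiff ℝ 1 (fun x : ℝ => (x - δ) / δ) := by fun_prop
    exact contDiff_const.sub (Real.smoothTransition.contDiff.comp this)
  have hθd : ∀ x, HasDerivAt θ (deriv θ x) x :=
    fun x => (hθs.differentiable one_ne_zero x).hasDerivAt
  have hθ'c : Continuous (deriv θ) := hθs.continuous_deriv le_rfl
  have hθ1 : ∀ x, x < δ → θ x = 1 := by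
    intro x hx
    simp only [θ]
    rw [Real.smoothTransition.zero_of_nonpos]
    · simp
    · exact div_nonpos_of_nonpos_of_nonneg (by linarith) hδ0.le
  have hθ0 : ∀ x, 2 * δ ≤ x → θ x = 0 := by
    intro x hx
    simp only [θ]
    rw [Real.smoothTransition.one_of_one_le]
    · simp
    · rw [le_div_iff₀ hδ0]; linarith
  have hθ'0 : ∀ x, 3 * δ ≤ x → deriv θ x = 0 := by
    intro x hx
    have : θ =ᶠ[𝓝 x] fun _ => 0 := by
      filter_upwards [lt_mem_nhds (show 2 * δ < x by linarith)] with y hy using hθ0 y hy.le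
    rw [this.deriv_eq]; simp
  have hθ'1 : ∀ x, x < δ → deriv θ x = 0 := by
    intro x hx
    have : θ =ᶠ[𝓝 x] fun _ => 1 := by
      filter_upwards [gt_mem_nhds hx] with y hy using hθ1 y hy
    rw [this.deriv_eq]; simp
  have hrad := radial_pompeiu hθd hθ'c (hθ1 0 hδ0) (R := 3 * δ)
    (fun x hx => ⟨hθ0 x (by linarith), hθ'0 x hx⟩)
  -- Wirtinger derivative of the radial cutoff
  let S : ℂ → ℝ := fun z => ‖z - ζ‖ ^ 2
  have hS : ∀ z, HasD (fun z => (S z : ℂ)) ((starRingEnd ℂ) (z - ζ)) (z - ζ) z := by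
    intro z
    have h1 : HasD (fun z => z - ζ) 1 0 z := HasD.of_deriv ((hasDerivAt_id z).sub_const ζ)
    have h2 := h1.mul h1.conj
    have e : (fun z => (S z : ℂ)) = fun z => (z - ζ) * (starRingEnd ℂ) (z - ζ) := by
      ext z; rw [Complex.mul_conj, Complex.normSq_eq_norm_sq]
    rw [e]
    convert h2 using 1 <;> simp
  have hθS : ∀ z, HasD (fun z => ((θ (S z) : ℝ) : ℂ)) (deriv θ (S z) * (starRingEnd ℂ) (z - ζ))
      (deriv θ (S z) * (z - ζ)) z := fun z => (hS z).real_comp (hθd _)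
  have hsmall : ∀ z, S z < 3 * δ + δ → z ∈ ball ζ r := by
    intro z hz
    rw [mem_ball, dist_eq_norm]
    have : ‖z - ζ‖ ^ 2 < r ^ 2 := by simp only [S] at hz; nlinarith
    exact lt_of_pow_lt_pow_left₀ 2 hr.le this
  have hScont : Continuous S := by fun_prop
  -- vanishing of b near ζ
  have hbz : ∀ z ∈ ball ζ r, a z = 0 ∧ b z = 0 := by
    intro z hz
    have hev : (fun _ => c) =ᶠ[𝓝 z] φ := by
      filter_upwards [isOpen_ball.mem_nhds hz] with y hy using (hball y hy).1.symm
    have h1 := (h z (hball z hz).2).congr hev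
    have h2 : HasD (fun _ => c) 0 0 z := HasD.of_deriv (hasDerivAt_const z c)
    exact h1.unique h2
  -- part 1: dslope
  have hds : DifferentiableOn ℂ (dslope m ζ) D :=
    (Complex.differentiableOn_dslope (hD.mem_nhds hζ)).mpr hm
  have P1 := integral_HasD_zero hD (φ := fun z => dslope m ζ z * φ z)
    (a := fun z => deriv (dslope m ζ) z * φ z + dslope m ζ z * a z)
    (b := fun z => 0 * φ z + dslope m ζ z * b z)
    (fun z hz => (HasD.of_deriv (hds.differentiableAt (hD.mem_nhds hz)).hasDerivAt).mul (h z hz))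
    (by
      have hφc : ContinuousOn φ D :=
        fun z hz => (HasFDerivAt.continuousAt (h z hz)).continuousWithinAt
      exact ((hds.deriv hD).continuousOn.mul hφc).add (hds.continuousOn.mul ha))
    (by
      simp only [zero_mul, zero_add]
      exact hds.continuousOn.mul hb)
    hK hKD (fun z hz hzK => by simp [h0 z hz hzK])
  -- part 2
  have hz2 : ∀ z, S z < δ → φ z - c * (θ (S z) : ℝ) = 0 ∧ a z - c * (deriv θ (S z) *
      (starRingEnd ℂ) (z - ζ)) = 0 ∧ b z - c * (deriv θ (S z) * (z - ζ)) = 0 := by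
    intro z hz
    have hzb := hsmall z (by linarith)
    rw [hθ1 _ hz, hθ'1 _ hz, (hball z hzb).1, (hbz z hzb).1, (hbz z hzb).2]
    simp
  have hSnear : ∀ᶠ z in 𝓝 ζ, S z < δ := by
    have : S ζ < δ := by simpa [S] using hδ0
    exact hScont.continuousAt.eventually_lt continuousAt_const this
  have P2 := integral_HasD_zero hD
    (φ := fun z => (z - ζ)⁻¹ * (φ z - c * (θ (S z) : ℝ)))
    (a := fun z => -((z - ζ) ^ 2)⁻¹ * (φ z - c * (θ (S z) : ℝ)) + (z - ζ)⁻¹ *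
      (a z - c * (deriv θ (S z) * (starRingEnd ℂ) (z - ζ))))
    (b := fun z => 0 * (φ z - c * (θ (S z) : ℝ)) + (z - ζ)⁻¹ *
      (b z - c * (deriv θ (S z) * (z - ζ))))
    (by
      intro z hz
      by_cases hzz : z = ζ
      · have hz0 := hz2 z (by simpa [hzz, S] using hδ0)
        rw [hz0.1, hz0.2.1, hz0.2.2]
        have : HasD (fun _ => (0:ℂ)) 0 0 z := HasD.of_deriv (hasDerivAt_const z 0)
        simp only [mul_zero, add_zero]
        refine this.congr ?_
        rw [hzz]
        filter_upwards [hSnear] with y hy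
        rw [(hz2 y hy).1, mul_zero]
      · have h1 : HasD (fun z => (z - ζ)⁻¹) (-((z - ζ) ^ 2)⁻¹) 0 z := by
          refine HasD.of_deriv ?_
          have := ((hasDerivAt_id z).sub_const ζ).inv (sub_ne_zero.mpr hzz)
          refine this.congr_deriv ?_
          simp [neg_div]
        refine h1.mul ?_
        have := HasFDerivAt.sub (h z hz) (HasFDerivAt.const_mul (hθS z) c)
        refine HasFDerivAt.congr_fderiv this ?_
        ext v
        simp
        ring)
    (by
      intro z hz
      by_cases hzz : z = ζ
      · refine ContinuousAt.continuousWithinAt ?_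
        have : (fun _ => (0:ℂ)) =ᶠ[𝓝 z] fun z => -((z - ζ) ^ 2)⁻¹ * (φ z - c * (θ (S z) : ℝ)) +
            (z - ζ)⁻¹ * (a z - c * (deriv θ (S z) * (starRingEnd ℂ) (z - ζ))) := by
          rw [hzz]
          filter_upwards [hSnear] with y hy
          rw [(hz2 y hy).1, (hz2 y hy).2.1]; simp
        exact continuousAt_const.congr this
      · have hne := sub_ne_zero.mpr hzz
        have hφc : ContinuousWithinAt φ D z := (HasFDerivAt.continuousAt (h z hz)).continuousWithinAt
        have hac := ha z hz
        have h1 : ContinuousWithinAt (fun z => (z - ζ)⁻¹) D z :=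
          ContinuousWithinAt.inv₀ (by fun_prop) hne
        have h2 : ContinuousWithinAt (fun z => ((z - ζ) ^ 2)⁻¹) D z :=
          ContinuousWithinAt.inv₀ (by fun_prop) (pow_ne_zero 2 hne)
        have h3 : Continuous (fun z => c * ((θ (S z) : ℝ) : ℂ)) :=
          continuous_const.mul (continuous_ofReal.comp (hθs.continuous.comp hScont))
        have h4 : Continuous (fun z => c * (((deriv θ (S z) : ℝ) : ℂ) * (starRingEnd ℂ) (z - ζ))) :=
          continuous_const.mul ((continuous_ofReal.comp (hθ'c.comp hScont)).mul
            (continuous_conj.comp (by fun_prop)))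
        exact (h2.neg.mul (hφc.sub h3.continuousWithinAt)).add
          (h1.mul (hac.sub h4.continuousWithinAt)))
    (by
      simp only [zero_mul, zero_add]
      intro z hz
      by_cases hzz : z = ζ
      · refine ContinuousAt.continuousWithinAt ?_
        have : (fun _ => (0:ℂ)) =ᶠ[𝓝 z] fun z => 
            (z - ζ)⁻¹ * (b z - c * (deriv θ (S z) * (z - ζ))) := by
          rw [hzz]
          filter_upwards [hSnear] with y hy
          rw [(hz2 y hy).2.2]; simp
        exact continuousAt_const.congr this
      · have hne := sub_ne_zero.mpr hzz
        have h1 : ContinuousWithinAt (fun z => (z - ζ)⁻¹) D z :=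
          ContinuousWithinAt.inv₀ (by fun_prop) hne
        have h4 : Continuous (fun z => c * (((deriv θ (S z) : ℝ) : ℂ) * (z - ζ))) :=
          continuous_const.mul ((continuous_ofReal.comp (hθ'c.comp hScont)).mul
            (by fun_prop))
        exact (h1.mul ((hb z hz).sub h4.continuousWithinAt)))
    (Kc := Kc ∪ S ⁻¹' (Iic (3 * δ)))
    (by
      refine hK.union ?_
      refine (isCompact_closedBall ζ r).of_isClosed_subset (isClosed_Iic.preimage hScont) ?_
      intro z hz
      exact ball_subset_closedBall (hsmall z (by simp only [mem_preimage, mem_Iic] at hz; linarith)))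
    (by
      refine union_subset hKD ?_
      intro z hz
      exact (hball z (hsmall z (by simp only [mem_preimage, mem_Iic] at hz; linarith))).2)
    (by
      intro z hz hzK
      simp only [mem_union, mem_preimage, mem_Iic, not_or, not_le] at hzK
      rw [h0 z hz hzK.1, hθ0 _ (by linarith)]; simp)
  -- combine
  have hθint : Integrable (fun z : ℂ => ((deriv θ (S z) : ℝ) : ℂ)) := by
    refine Continuous.integrable_of_hasCompactSupport
      (continuous_ofReal.comp (hθ'c.comp hScont)) ?_
    refine HasCompactSupport.intro (isCompact_closedBall ζ r) ?_
    intro z hz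
    have : 3 * δ ≤ S z := by
      by_contra hcon
      push Not at hcon
      exact hz (ball_subset_closedBall (hsmall z (by linarith)))
    simp [hθ'0 _ this]
  have hrad2 : ∫ z in D, ((deriv θ (S z) : ℝ) : ℂ) = -Real.pi := by
    rw [setIntegral_eq_integral_of_forall_compl_eq_zero]
    · have := integral_sub_right_eq_self (μ := (volume : Measure ℂ))
        (fun z : ℂ => ((deriv θ (‖z‖ ^ 2) : ℝ) : ℂ)) ζ
      rw [← hrad, ← this]
    · intro z hz
      have : 3 * δ ≤ S z := by
        by_contra hcon
        push Not at hcon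
        exact hz (hball z (hsmall z (by linarith))).2
      simp [hθ'0 _ this]
  have hne : ∀ z ∈ D, m z / (z - ζ) * b z = (0 * φ z + dslope m ζ z * b z) + m ζ *
      (0 * (φ z - c * (θ (S z) : ℝ)) + (z - ζ)⁻¹ * (b z - c * (deriv θ (S z) * (z - ζ)))) +
      m ζ * c * (deriv θ (S z) : ℝ) := by
    intro z hz
    by_cases hzz : z = ζ
    · subst hzz
      have h1 : b z = 0 := (hbz z (mem_ball_self hr)).2
      have h2 : deriv θ (S z) = 0 := hθ'1 _ (by simpa [S] using hδ0)
      rw [h1, h2]; simp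
    · have hne := sub_ne_zero.mpr hzz
      rw [dslope_of_ne _ hzz, slope_def_field]
      field_simp
      ring
  have hI := ((P1.2.2.2.add (P2.2.2.2.const_mul (m ζ))).add (hθint.integrableOn.const_mul (m ζ * c)))
  constructor
  · rw [setIntegral_congr_fun hD.measurableSet hne, integral_add, integral_add, integral_const_mul,
      integral_const_mul, P1.2.1, P2.2.1, hrad2]
    · ring
    · exact P1.2.2.2
    · exact P2.2.2.2.const_mul (m ζ)
    · exact P1.2.2.2.add (P2.2.2.2.const_mul (m ζ))
    · exact hθint.integrableOn.const_mul (m ζ * c)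
  · exact (hI.congr_fun (fun z hz => (hne z hz).symm) hD.measurableSet)

end WS


namespace WS
open Topology

theorem hausdorff_piece {S : Set ℝ} (hS : Convex ℝ S) {γ γ' : ℝ → ℂ}
    (hd : ∀ y ∈ S, HasDerivAt γ (γ' y) y) {x : ℝ} {ε : ℝ} (hε : 0 < ε)
    (hx : ∀ y ∈ S, ‖γ' y - γ' x‖ ≤ ε) {E : Set ℝ} (hE : E ⊆ S) (hinj : InjOn γ E)
     :
    μH[1] (γ '' E) ≤ ENNReal.ofReal (‖γ' x‖ + ε) * volume E ∧
    ENNReal.ofReal (‖γ' x‖ - ε) * volume E ≤ μH[1] (γ '' E) := by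
  have h1 : ∀ y ∈ S, ∀ y' ∈ S, ‖(γ y - γ y') - (y - y') • γ' x‖ ≤ ε * |y - y'| := by
    intro y hy y' hy'
    have := hS.norm_image_sub_le_of_norm_hasDerivWithin_le (f := fun y => γ y - y • γ' x)
      (f' := fun y => γ' y - γ' x) (C := ε) (x := y') (y := y)
      (fun t ht => by
        have := ((hd t ht).sub ((hasDerivAt_id t).smul_const (γ' x))).hasDerivWithinAt (s := S)
        exact this.congr_deriv (by simp)) hx hy' hy
    rw [Real.norm_eq_abs] at this
    have e : (γ y - γ y') - (y - y') • γ' x = γ y - y • γ' x - (γ y' - y' • γ' x) := by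
      rw [sub_smul]; ring
    rw [e]; exact this
  have hup : ∀ y ∈ S, ∀ y' ∈ S, ‖γ y - γ y'‖ ≤ (‖γ' x‖ + ε) * |y - y'| := by
    intro y hy y' hy'
    have h2 := norm_sub_norm_le (γ y - γ y') ((y - y') • γ' x)
    rw [norm_smul, Real.norm_eq_abs] at h2
    nlinarith [h1 y hy y' hy']
  have hlo : ∀ y ∈ S, ∀ y' ∈ S, (‖γ' x‖ - ε) * |y - y'| ≤ ‖γ y - γ y'‖ := by
    intro y hy y' hy'
    have h2 := norm_sub_norm_le ((y - y') • γ' x) (γ y - γ y')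
    rw [norm_smul, Real.norm_eq_abs, norm_sub_rev ((y - y') • γ' x)] at h2
    nlinarith [h1 y hy y' hy']
  constructor
  · have hL : LipschitzOnWith (‖γ' x‖ + ε).toNNReal γ E := by
      refine LipschitzOnWith.of_dist_le_mul ?_
      intro y hy y' hy'
      rw [dist_eq_norm, Real.dist_eq, Real.coe_toNNReal _ (by positivity)]
      exact hup y (hE hy) y' (hE hy')
    have := hL.hausdorffMeasure_image_le (d := 1) zero_le_one
    rw [ENNReal.rpow_one, hausdorffMeasure_real] at this
    exact this
  · rcases le_or_gt (‖γ' x‖ - ε) 0 with hc | hc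
    · rw [ENNReal.ofReal_of_nonpos hc]; simp
    · have hL : LipschitzOnWith ((‖γ' x‖ - ε)⁻¹).toNNReal (Function.invFunOn γ E) (γ '' E) := by
        refine LipschitzOnWith.of_dist_le_mul ?_
        rintro _ ⟨y, hy, rfl⟩ _ ⟨y', hy', rfl⟩
        rw [hinj.leftInvOn_invFunOn hy, hinj.leftInvOn_invFunOn hy', dist_eq_norm, dist_eq_norm, Real.norm_eq_abs,
          Real.coe_toNNReal _ (by positivity)]
        rw [inv_mul_eq_div, le_div_iff₀ hc, mul_comm]
        exact hlo y (hE hy) y' (hE hy')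
      have := hL.hausdorffMeasure_image_le (d := 1) zero_le_one
      rw [ENNReal.rpow_one, hausdorffMeasure_real, hinj.leftInvOn_invFunOn.image_image] at this
      calc _ ≤ ENNReal.ofReal (‖γ' x‖ - ε) * (((‖γ' x‖ - ε)⁻¹).toNNReal * μH[1] (γ '' E)) := by
            gcongr
        _ = μH[1] (γ '' E) := by
            rw [← mul_assoc]
            change (ENNReal.ofReal _ * ENNReal.ofReal _) * _ = _
            rw [← ENNReal.ofReal_mul hc.le, mul_inv_cancel₀ hc.ne']
            simp

theorem hausdorff_curve {a b : ℝ} {γ γ' : ℝ → ℂ}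
    (hd : ∀ y ∈ Icc a b, HasDerivAt γ (γ' y) y) (hc : ContinuousOn γ' (Icc a b))
    (hinj : InjOn γ (Icc a b)) {E : Set ℝ} (hE : E ⊆ Icc a b) (hEm : MeasurableSet E) :
    μH[1] (γ '' E) = ∫⁻ y in E, ‖γ' y‖ₑ := by
  have hfin : volume E ≠ ⊤ := ne_top_of_le_ne_top (by simp) (measure_mono hE)
  have hγc : ContinuousOn γ (Icc a b) := fun y hy => (hd y hy).continuousAt.continuousWithinAt
  have key : ∀ ε : ℝ, 0 < ε → μH[1] (γ '' E) ≤ (∫⁻ y in E, ‖γ' y‖ₑ) + ENNReal.ofReal (2 * ε) * volume E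
      ∧ (∫⁻ y in E, ‖γ' y‖ₑ) ≤ μH[1] (γ '' E) + ENNReal.ofReal (2 * ε) * volume E := by
    intro ε hε
    obtain ⟨η, hη, hu⟩ := Metric.uniformContinuousOn_iff.mp
      (isCompact_Icc.uniformContinuousOn_of_continuous hc) ε hε
    let I : ℤ → Set ℝ := fun k => Ico (0 + k • η) (0 + (k + 1) • η)
    have hIU : ⋃ k, I k = univ := iUnion_Ico_add_zsmul hη 0
    have hId : Pairwise (Function.onFun Disjoint I) := by
      simpa [I] using pairwise_disjoint_Ico_add_zsmul (0:ℝ) η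
    let P : ℤ → Set ℝ := fun k => E ∩ I k
    have hPm : ∀ k, MeasurableSet (P k) := fun k => hEm.inter measurableSet_Ico
    have hPE : E = ⋃ k, P k := by rw [← inter_iUnion, hIU, inter_univ]
    have hPd : Pairwise (Function.onFun Disjoint P) := fun i j hij =>
      (hId hij).mono inter_subset_right inter_subset_right
    have hPI : ∀ k, P k ⊆ Icc a b := fun k => inter_subset_left.trans hE
    have e1 : volume E = ∑' k, volume (P k) := by
      conv_lhs => rw [hPE]
      exact measure_iUnion hPd hPm
    have e2 : (∫⁻ y in E, ‖γ' y‖ₑ) = ∑' k, ∫⁻ y in P k, ‖γ' y‖ₑ := by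
      conv_lhs => rw [hPE]
      exact lintegral_iUnion hPm hPd _
    have e3 : μH[1] (γ '' E) = ∑' k, μH[1] (γ '' (P k)) := by
      conv_lhs => rw [hPE, image_iUnion]
      refine measure_iUnion ?_ ?_
      · intro i j hij
        exact (hPd hij).image hinj (hPI i) (hPI j)
      · intro k
        exact (hPm k).image_of_continuousOn_injOn (hγc.mono (hPI k)) (hinj.mono (hPI k))
    have hp : ∀ k, μH[1] (γ '' (P k)) ≤ (∫⁻ y in P k, ‖γ' y‖ₑ) + ENNReal.ofReal (2 * ε) * volume (P k)
      ∧ (∫⁻ y in P k, ‖γ' y‖ₑ) ≤ μH[1] (γ '' (P k)) + ENNReal.ofReal (2 * ε) * volume (P k) := by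
      intro k
      rcases (P k).eq_empty_or_nonempty with h0 | ⟨x, hx⟩
      · rw [h0]; simp
      have hcl : ∀ y ∈ Icc a b ∩ I k, ‖γ' y - γ' x‖ ≤ ε := by
        intro y hy
        rw [← dist_eq_norm]
        refine (hu y hy.1 x (hPI k hx) ?_).le
        have h1 := hy.2
        have h2 := hx.2
        simp only [I, mem_Ico, zero_add, add_smul, one_smul] at h1 h2
        rw [Real.dist_eq, abs_lt]
        constructor <;> linarith
      have hsub : P k ⊆ Icc a b ∩ I k := fun y hy => ⟨hPI k hy, hy.2⟩
      obtain ⟨h1, h2⟩ := hausdorff_piece ((convex_Icc a b).inter (convex_Ico _ _))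
        (fun y hy => hd y hy.1) hε hcl hsub (hinj.mono (hPI k))
      have hvfin : volume (P k) ≠ ⊤ := ne_top_of_le_ne_top (by simp) (measure_mono (hPI k))
      constructor
      · refine h1.trans ?_
        have : ENNReal.ofReal (‖γ' x‖ + ε) * volume (P k) ≤
            ∫⁻ y in P k, (‖γ' y‖ₑ + ENNReal.ofReal (2 * ε)) := by
          rw [← setLIntegral_const]
          refine setLIntegral_mono' (hPm k) ?_
          intro y hy
          rw [← ofReal_norm, ← ENNReal.ofReal_add (norm_nonneg _) (by positivity)]
          refine ENNReal.ofReal_le_ofReal ?_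
          have := hcl y (hsub hy)
          have := norm_sub_norm_le (γ' x) (γ' y)
          rw [norm_sub_rev] at this
          linarith
        refine this.trans ?_
        rw [lintegral_add_right _ measurable_const, setLIntegral_const]
      · have : (∫⁻ y in P k, ‖γ' y‖ₑ) ≤ ENNReal.ofReal (‖γ' x‖ - ε + 2 * ε) * volume (P k) := by
          rw [← setLIntegral_const]
          refine setLIntegral_mono' (hPm k) ?_
          intro y hy
          rw [← ofReal_norm]
          refine ENNReal.ofReal_le_ofReal ?_
          have := hcl y (hsub hy)
          have := norm_sub_norm_le (γ' y) (γ' x)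
          linarith
        refine this.trans ?_
        calc _ ≤ (ENNReal.ofReal (‖γ' x‖ - ε) + ENNReal.ofReal (2 * ε)) * volume (P k) := by
              gcongr
              exact ENNReal.ofReal_add_le
          _ ≤ _ := by
              rw [add_mul]
              gcongr
    rw [e1, e2, e3, ← ENNReal.tsum_mul_left, ← ENNReal.tsum_add, ← ENNReal.tsum_add]
    exact ⟨ENNReal.tsum_le_tsum fun k => (hp k).1, ENNReal.tsum_le_tsum fun k => (hp k).2⟩
  have hlim : ∀ c : ENNReal, Tendsto (fun ε : ℝ => c + ENNReal.ofReal (2 * ε) * volume E) (𝓝[>] 0) (𝓝 c) := by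
    intro c
    have h1 : Tendsto (fun ε : ℝ => ENNReal.ofReal (2 * ε)) (𝓝[>] 0) (𝓝 0) := by
      have : Tendsto (fun ε : ℝ => 2 * ε) (𝓝[>] 0) (𝓝 (2 * 0)) :=
        ((continuous_const.mul continuous_id).tendsto 0).mono_left nhdsWithin_le_nhds
      simpa using ENNReal.tendsto_ofReal this
    have h2 := ENNReal.Tendsto.mul_const h1 (b := volume E) (Or.inr hfin)
    simpa using (tendsto_const_nhds (x := c)).add h2
  apply le_antisymm
  · refine ge_of_tendsto (hlim _) ?_
    filter_upwards [self_mem_nhdsWithin] with ε hε using (key ε hε).1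
  · refine ge_of_tendsto (hlim _) ?_
    filter_upwards [self_mem_nhdsWithin] with ε hε using (key ε hε).2

theorem hausdorff_restrict {a b : ℝ} {γ γ' : ℝ → ℂ}
    (hd : ∀ y ∈ Icc a b, HasDerivAt γ (γ' y) y) (hc : ContinuousOn γ' (Icc a b))
    (hinj : InjOn γ (Icc a b)) {E : Set ℝ} (hE : E ⊆ Icc a b) (hEm : MeasurableSet E) :
    (μH[1]).restrict (γ '' E) = Measure.map γ ((volume.restrict E).withDensity (fun y => ‖γ' y‖ₑ)) := by
  have hγc : ContinuousOn γ E := fun y hy => (hd y (hE hy)).continuousAt.continuousWithinAt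
  have hm : AEMeasurable γ (volume.restrict E) := hγc.aemeasurable hEm
  have hm2 : AEMeasurable γ ((volume.restrict E).withDensity (fun y => ‖γ' y‖ₑ)) :=
    hm.mono_ac (withDensity_absolutelyContinuous _ _)
  ext s hs
  classical
  have hpre : MeasurableSet (E ∩ γ ⁻¹' s) := by
    have := hγc.measurable_piecewise (g := fun _ => (0:ℂ)) continuous_const.continuousOn hEm
    have h2 := hEm.inter (this hs)
    convert h2 using 1
    ext y
    simp only [mem_inter_iff, mem_preimage]
    constructor
    · rintro ⟨h1, h2⟩; exact ⟨h1, by rwa [piecewise_eq_of_mem _ _ _ h1]⟩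
    · rintro ⟨h1, h2⟩; exact ⟨h1, by rwa [piecewise_eq_of_mem _ _ _ h1] at h2⟩
  rw [Measure.restrict_apply hs, Measure.map_apply_of_aemeasurable hm2 hs, inter_comm,
    ← image_inter_preimage, hausdorff_curve hd hc hinj (inter_subset_left.trans hE) hpre]
  rw [withDensity_apply' , Measure.restrict_restrict' hEm, inter_comm]

end WS


namespace WS
open Topology

theorem halfplane_collar {κ : ℝ → ℝ} (hκ : Continuous κ) (hκ0 : ∀ x, x ∉ Icc (1:ℝ) 2 → κ x = 0)
    {F : ℂ → ℂ} (hF : ContinuousOn F {w | w.re ≤ 0}) {M : ℝ} (hM : ∀ w, M < |w.im| → F w = 0) :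
    Tendsto (fun ε : ℝ => ∫ w in {w : ℂ | w.re < 0}, ((ε⁻¹ * κ (-w.re / ε) : ℝ) : ℂ) * F w)
      (𝓝[>] 0) (𝓝 (((∫ t, κ t : ℝ) : ℂ) * ∫ y : ℝ, F (y * I))) := by
  let T : ℝ → ℝ → ℂ := fun x y => F (((min x 0 : ℝ) : ℂ) + y * I)
  have hTc : Continuous (Function.uncurry T) := by
    refine hF.comp_continuous (f := fun p : ℝ × ℝ => (((min p.1 0 : ℝ) : ℂ) + p.2 * I)) ?_ ?_
    · have : Continuous (fun p : ℝ × ℝ => min p.1 0) := continuous_fst.min continuous_const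
      exact (continuous_ofReal.comp this).add
        ((continuous_ofReal.comp continuous_snd).mul continuous_const)
    · intro p; simp
  have hT0 : ∀ x y, y ∉ Icc (-M) M → T x y = 0 := by
    intro x y hy
    apply hM
    simp
    by_contra hcon
    push Not at hcon
    exact hy (abs_le.mp hcon)
  let Φ : ℝ → ℂ := fun x => ∫ y, T x y
  have hΦ : Continuous Φ := by
    have : Φ = fun x => ∫ y in Icc (-M) M, T x y := by
      ext x
      rw [setIntegral_eq_integral_of_forall_compl_eq_zero]
      intro y hy; exact hT0 x y hy
    rw [this]
    exact continuous_parametric_integral_of_continuous hTc isCompact_Icc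
  have hΦ0 : Φ 0 = ∫ y : ℝ, F (y * I) := by simp [Φ, T]
  have step : ∀ ε : ℝ, 0 < ε → ∫ w in {w : ℂ | w.re < 0}, ((ε⁻¹ * κ (-w.re / ε) : ℝ) : ℂ) * F w =
      ∫ t, ((κ t : ℝ) : ℂ) * Φ (-(ε * t)) := by
    intro ε hε
    have hms : MeasurableSet {w : ℂ | w.re < 0} := measurableSet_lt measurable_re measurable_const
    rw [← integral_indicator hms]
    rw [← Complex.volume_preserving_equiv_real_prod.symm.integral_comp
      Complex.measurableEquivRealProd.symm.measurableEmbedding]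
    have e1 : ∀ p : ℝ × ℝ, {w : ℂ | w.re < 0}.indicator
        (fun w => ((ε⁻¹ * κ (-w.re / ε) : ℝ) : ℂ) * F w) (measurableEquivRealProd.symm p) =
        ((ε⁻¹ * κ (-p.1 / ε) : ℝ) : ℂ) * T p.1 p.2 := by
      intro p
      have h1 : measurableEquivRealProd.symm p = (p.1 : ℂ) + p.2 * I := by
        apply Complex.ext <;> simp [measurableEquivRealProd, equivRealProd]
      rw [h1]
      by_cases hp : p.1 < 0
      · rw [indicator_of_mem (by simpa using hp)]
        simp [T, min_eq_left hp.le]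
      · rw [indicator_of_notMem (by simpa using hp)]
        rw [hκ0 (-p.1 / ε)]
        · simp
        · intro hcon
          have := hcon.1
          rw [le_div_iff₀ hε] at this
          push Not at hp
          linarith
    simp_rw [e1]
    rw [Measure.volume_eq_prod, integral_prod]
    · simp only [integral_const_mul]
      change ∫ x, ((ε⁻¹ * κ (-x / ε) : ℝ) : ℂ) * Φ x = _
      have := Measure.integral_comp_mul_left (fun x : ℝ => ((ε⁻¹ * κ (-x / ε) : ℝ) : ℂ) * Φ x) (-ε)
      have e2 : ∫ x, ((ε⁻¹ * κ (-x / ε) : ℝ) : ℂ) * Φ x = ε • (|(-ε)⁻¹| •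
        ∫ x, ((ε⁻¹ * κ (-x / ε) : ℝ) : ℂ) * Φ x) := by
        rw [smul_smul, abs_inv, abs_neg, abs_of_pos hε, mul_inv_cancel₀ hε.ne', one_smul]
      rw [e2, ← this, ← integral_smul]
      congr 1
      ext t
      have h3 : -(-ε * t) / ε = t := by field_simp
      rw [h3, neg_mul]
      have : (ε:ℂ) ≠ 0 := by exact_mod_cast hε.ne'
      simp
      field_simp
    · refine Continuous.integrable_of_hasCompactSupport ?_ ?_
      · refine (continuous_ofReal.comp ?_).mul hTc
        exact continuous_const.mul (hκ.comp (by fun_prop))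
      · refine HasCompactSupport.intro ((isCompact_Icc (a := -(2 * ε)) (b := 0)).prod
          (isCompact_Icc (a := -M) (b := M))) ?_
        intro p hp
        by_cases h2 : p.2 ∈ Icc (-M) M
        · have h1 : p.1 ∉ Icc (-(2 * ε)) 0 := fun h => hp ⟨h, h2⟩
          rw [hκ0]
          · simp
          · intro hcon
            apply h1
            have h4 := hcon.1
            have h5 := hcon.2
            rw [le_div_iff₀ hε] at h4
            rw [div_le_iff₀ hε] at h5
            exact ⟨by linarith, by linarith⟩
        · rw [hT0 _ _ h2, mul_zero]
  rw [← hΦ0]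
  have e3 : ((∫ t, κ t : ℝ) : ℂ) * Φ 0 = ∫ t, ((κ t : ℝ) : ℂ) * Φ 0 := by
    rw [integral_mul_const]; congr 1; exact integral_ofReal.symm
  rw [e3]
  have hcont : Continuous (fun ε : ℝ => ∫ t, ((κ t : ℝ) : ℂ) * Φ (-(ε * t))) := by
    have : (fun ε : ℝ => ∫ t, ((κ t : ℝ) : ℂ) * Φ (-(ε * t))) =
        fun ε : ℝ => ∫ t in Icc (1:ℝ) 2, ((κ t : ℝ) : ℂ) * Φ (-(ε * t)) := by
      ext ε
      rw [setIntegral_eq_integral_of_forall_compl_eq_zero]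
      intro t ht; simp [hκ0 t ht]
    rw [this]
    refine continuous_parametric_integral_of_continuous
      (f := fun ε t => ((κ t : ℝ) : ℂ) * Φ (-(ε * t))) ?_ isCompact_Icc
    refine (continuous_ofReal.comp (hκ.comp continuous_snd)).mul (hΦ.comp ?_)
    fun_prop
  have hl := (hcont.tendsto 0).mono_left (nhdsWithin_le_nhds (s := Ioi 0))
  simp only [zero_mul, neg_zero] at hl
  refine hl.congr' ?_
  filter_upwards [self_mem_nhdsWithin] with ε hε using (step ε hε).symm

end WS


namespace WS
open Topology

/-- Collar data. -/
structure Coll (D U : Set ℂ) (r : ℂ → ℝ) (ν : ℂ → ℂ) : Prop where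
  hD : IsOpen D
  hb : Bornology.IsBounded D
  hU : IsOpen U
  hfU : frontier D ⊆ U
  hr : ContDiffOn ℝ 1 r U
  h0 : ∀ z ∈ frontier D, r z = 0
  hneg : ∀ z ∈ U ∩ D, r z < 0
  hν : IsOutwardUnitNormal D ν
  hpos : ∀ z ∈ frontier D, 0 < fderiv ℝ r z (ν z)

/-- derivative of the chart -/
noncomputable def chartD (l : ℂ →L[ℝ] ℝ) (n : ℂ) : ℂ →L[ℝ] ℂ :=
  ofRealCLM.comp l + I • (ofRealCLM.comp (imCLM.comp
    (ContinuousLinearMap.mul ℝ ℂ ((starRingEnd ℂ) n))))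

theorem chartD_apply (l : ℂ →L[ℝ] ℝ) (n v : ℂ) :
    chartD l n v = (l v : ℂ) + I * (((starRingEnd ℂ) n * v).im : ℝ) := by
  simp [chartD]

theorem real_lin_apply (l : ℂ →L[ℝ] ℝ) (v : ℂ) : l v = v.re * l 1 + v.im * l I := by
  conv_lhs => rw [← re_add_im v]
  have h1 : (v.re : ℂ) = v.re • (1:ℂ) := by simp
  have h2 : (v.im : ℂ) * I = v.im • I := by simp
  rw [h1, h2, map_add, map_smul, map_smul]; simp

theorem chartD_det (l : ℂ →L[ℝ] ℝ) (n : ℂ) : (chartD l n).det = l n := by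
  rw [ContinuousLinearMap.det, ← LinearMap.det_toMatrix Complex.basisOneI, Matrix.det_fin_two]
  simp only [LinearMap.toMatrix_apply, coe_basisOneI, ContinuousLinearMap.coe_coe, chartD_apply,
    coe_basisOneI_repr]
  rw [real_lin_apply l n]
  simp
  ring

theorem chart_exists {D U : Set ℂ} {r : ℂ → ℝ} {ν : ℂ → ℂ} (h : Coll D U r ν) {p : ℂ}
    (hp : p ∈ frontier D) : ∃ (Ψ : OpenPartialHomeomorph ℂ ℂ) (n : ℂ) (a y0 : ℝ),
      0 < a ∧ ‖n‖ = 1 ∧ p ∈ Ψ.source ∧ Ψ.source ⊆ U ∧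
      (∀ z, Ψ z = (r z : ℂ) + I * (((starRingEnd ℂ) n * z).im : ℝ)) ∧
      (∀ z ∈ Ψ.source, 0 < fderiv ℝ r z n) ∧
      {w : ℂ | |w.re| ≤ a ∧ |w.im - y0| ≤ a} ⊆ Ψ.target ∧
      (|(Ψ p).re| < a ∧ |(Ψ p).im - y0| < a) ∧
      (∀ z ∈ Ψ.source, |(Ψ z).re| < a → |(Ψ z).im - y0| < a →
        ((r z < 0 ↔ z ∈ D) ∧ (r z = 0 ↔ z ∈ frontier D))) := by
  set n := ν p with hn
  have hn1 : ‖n‖ = 1 := (h.hν p hp).1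
  let f : ℂ → ℂ := fun z => (r z : ℂ) + I * (((starRingEnd ℂ) n * z).im : ℝ)
  have hpU := h.hfU hp
  have hrd : ∀ z ∈ U, HasFDerivAt r (fderiv ℝ r z) z := fun z hz =>
    ((h.hr.differentiableOn one_ne_zero).differentiableAt (h.hU.mem_nhds hz)).hasFDerivAt
  have hfd : ∀ z ∈ U, HasFDerivAt f (chartD (fderiv ℝ r z) n) z := by
    intro z hz
    have h1 := ofRealCLM.hasFDerivAt.comp z (hrd z hz)
    have h2 := (I • (ofRealCLM.comp (imCLM.comp
      (ContinuousLinearMap.mul ℝ ℂ ((starRingEnd ℂ) n))))).hasFDerivAt (x := z)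
    have h3 := h1.add h2
    refine h3.congr_of_eventuallyEq ?_
    filter_upwards with y
    simp [f]
  have hfc : ContDiffAt ℝ 1 f p := by
    have h1 : ContDiffAt ℝ 1 r p := h.hr.contDiffAt (h.hU.mem_nhds hpU)
    have h2 := (ofRealCLM.contDiff (n := 1)).contDiffAt.comp p h1
    have h3 := (I • (ofRealCLM.comp (imCLM.comp
      (ContinuousLinearMap.mul ℝ ℂ ((starRingEnd ℂ) n))))).contDiff (n := 1)
    refine (h2.add h3.contDiffAt).congr_of_eventuallyEq ?_
    filter_upwards with y
    simp [f]
  have hdet : (chartD (fderiv ℝ r p) n).det ≠ 0 := by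
    rw [chartD_det]; exact (h.hpos p hp).ne'
  have hfp : HasFDerivAt f ((ContinuousLinearMap.toContinuousLinearEquivOfDetNeZero _ hdet :
      ℂ ≃L[ℝ] ℂ) : ℂ →L[ℝ] ℂ) p := by
    rw [ContinuousLinearMap.coe_toContinuousLinearEquivOfDetNeZero]
    exact hfd p hpU
  let Ψ0 := hfc.toOpenPartialHomeomorph f hfp one_ne_zero
  have hΨ0 : ∀ z, Ψ0 z = f z := fun z => rfl
  have hpΨ0 : p ∈ Ψ0.source := hfc.mem_toOpenPartialHomeomorph_source hfp one_ne_zero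
  -- restrict to where J > 0
  have hJc : ContinuousOn (fun z => fderiv ℝ r z n) U :=
    (h.hr.continuousOn_fderiv_of_isOpen h.hU le_rfl).clm_apply continuousOn_const
  let S : Set ℂ := U ∩ (fun z => fderiv ℝ r z n) ⁻¹' (Ioi 0)
  have hS : IsOpen S := hJc.isOpen_inter_preimage h.hU isOpen_Ioi
  have hpS : p ∈ S := ⟨hpU, h.hpos p hp⟩
  let Ψ := Ψ0.restrOpen S hS
  have hΨ : ∀ z, Ψ z = f z := fun z => rfl
  have hsrc : Ψ.source = Ψ0.source ∩ S := Ψ0.restrOpen_source S hS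
  have hpΨ : p ∈ Ψ.source := by rw [hsrc]; exact ⟨hpΨ0, hpS⟩
  have hfpv : f p = I * (((starRingEnd ℂ) n * p).im : ℝ) := by simp [f, h.h0 p hp]
  set y0 := ((starRingEnd ℂ) n * p).im with hy0
  have hpt : f p ∈ Ψ.target := Ψ.map_source hpΨ
  obtain ⟨δ, hδ, hball⟩ := Metric.isOpen_iff.mp Ψ.open_target _ hpt
  have hbox : {w : ℂ | |w.re| ≤ δ / 3 ∧ |w.im - y0| ≤ δ / 3} ⊆ Ψ.target := by
    rintro w ⟨h1, h2⟩
    apply hball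
    rw [mem_ball, dist_eq_norm, hfpv]
    refine lt_of_le_of_lt (norm_le_abs_re_add_abs_im _) ?_
    simp
    linarith
  refine ⟨Ψ, n, δ / 3, y0, by positivity, hn1, hpΨ, ?_, fun z => rfl, ?_, hbox, ?_, ?_⟩
  · rw [hsrc]; exact fun z hz => hz.2.1
  · rw [hsrc]; exact fun z hz => hz.2.2
  · rw [hΨ, hfpv]; simp; positivity
  -- topology
  have hre : ∀ z, (Ψ z).re = r z := by intro z; rw [hΨ]; simp [f]
  have him : ∀ z, (Ψ z).im = ((starRingEnd ℂ) n * z).im := by intro z; rw [hΨ]; simp [f]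
  set B : Set ℂ := {w : ℂ | w.re ∈ Ioo (-(δ / 3)) 0 ∧ w.im ∈ Ioo (y0 - δ / 3) (y0 + δ / 3)} with hB
  have hBconv : Convex ℝ B := by
    have h1 : Convex ℝ (reCLM ⁻¹' (Ioo (-(δ / 3)) 0)) :=
      (convex_Ioo _ _).linear_preimage (reCLM : ℂ →ₗ[ℝ] ℝ)
    have h2 : Convex ℝ (imCLM ⁻¹' (Ioo (y0 - δ / 3) (y0 + δ / 3))) :=
      (convex_Ioo _ _).linear_preimage (imCLM : ℂ →ₗ[ℝ] ℝ)
    exact h1.inter h2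
  have hBt : B ⊆ Ψ.target := by
    intro w hw
    apply hbox
    obtain ⟨⟨h1, h2⟩, h3, h4⟩ := hw
    exact ⟨abs_le.mpr ⟨h1.le, by linarith⟩, abs_le.mpr ⟨by linarith, by linarith⟩⟩
  have hconn : IsPreconnected (Ψ.symm '' B) :=
    hBconv.isPreconnected.image _ (Ψ.continuousOn_symm.mono hBt)
  have hmemB : ∀ z ∈ Ψ.source, Ψ z ∈ B → z ∈ Ψ.symm '' B := fun z hz hzB =>
    ⟨Ψ z, hzB, Ψ.left_inv hz⟩
  have hnegB : ∀ z ∈ Ψ.symm '' B, r z < 0 := by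
    rintro _ ⟨w, hw, rfl⟩
    rw [← hre, Ψ.right_inv (hBt hw)]; exact hw.1.2
  have hsub : Ψ.symm '' B ⊆ D := by
    have hne : (Ψ.symm '' B ∩ D).Nonempty := by
      have hev := (h.hν p hp).2.1
      have hct : Tendsto (fun t : ℝ => p - t • n) (𝓝[>] 0) (𝓝 p) := by
        have : Continuous (fun t : ℝ => p - t • n) := by fun_prop
        simpa using (this.tendsto 0).mono_left (nhdsWithin_le_nhds (s := Ioi 0))
      have h1 : ∀ᶠ t in 𝓝[>] (0:ℝ), p - t • n ∈ Ψ.source ∧ Ψ (p - t • n) ∈ ball (f p) (δ / 3) := by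
        have q1 : ∀ᶠ z in 𝓝 p, z ∈ Ψ.source := Ψ.open_source.mem_nhds hpΨ
        have q2 : ∀ᶠ z in 𝓝 p, Ψ z ∈ ball (f p) (δ / 3) :=
          (Ψ.continuousAt hpΨ).eventually (ball_mem_nhds _ (by positivity))
        exact hct.eventually (q1.and q2)
      obtain ⟨t, ht1, ht2, ht3⟩ := (hev.and h1).exists
      refine ⟨p - t • n, hmemB _ ht2 ?_, ht1.2⟩
      rw [mem_ball, dist_eq_norm] at ht3
      have hr1 := (abs_re_le_norm _).trans_lt ht3
      have hi1 := (abs_im_le_norm _).trans_lt ht3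
      rw [sub_re, hfpv] at hr1
      rw [sub_im, hfpv] at hi1
      simp at hr1 hi1
      have hneg : r (p - t • n) < 0 := by
        refine h.hneg _ ⟨?_, ht1.2⟩
        rw [hsrc] at ht2; exact ht2.2.1
      have e1 : p - (t:ℂ) * n = p - t • n := by simp
      rw [e1] at hr1 hi1
      rw [abs_lt] at hr1 hi1
      refine ⟨⟨by linarith, by rw [hre]; exact hneg⟩, by linarith, by linarith⟩
    by_contra hcon
    have hnf : ∀ z ∈ Ψ.symm '' B, z ∉ frontier D := by
      intro z hz1 hz2
      have := hnegB z hz1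
      rw [h.h0 z hz2] at this
      exact lt_irrefl _ this
    rw [h.hD.frontier_eq] at hnf
    have hcov : Ψ.symm '' B ⊆ D ∪ (closure D)ᶜ := by
      intro z hz
      by_cases hzD : z ∈ D
      · exact Or.inl hzD
      · exact Or.inr (fun hc => hnf z hz ⟨hc, hzD⟩)
    have hne2 : (Ψ.symm '' B ∩ (closure D)ᶜ).Nonempty := by
      obtain ⟨z, hz1, hz2⟩ := not_subset.mp hcon
      exact ⟨z, hz1, fun hc => hnf z hz1 ⟨hc, hz2⟩⟩
    obtain ⟨z, _, hz1, hz2⟩ := hconn D (closure D)ᶜ h.hD isClosed_closure.isOpen_compl hcov hne hne2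
    exact hz2 (subset_closure hz1)
  intro z hz h1 h2
  have hzU : z ∈ U := by rw [hsrc] at hz; exact hz.2.1
  have hmem : r z < 0 → z ∈ D := by
    intro hneg
    apply hsub
    apply hmemB z hz
    rw [abs_lt] at h1 h2
    exact ⟨⟨h1.1, by rw [hre]; exact hneg⟩, by linarith, by linarith⟩
  refine ⟨⟨hmem, fun hzD => h.hneg z ⟨hzU, hzD⟩⟩, ?_, h.h0 z⟩
  intro hz0
  rw [h.hD.frontier_eq]
  refine ⟨?_, fun hzD => by have := h.hneg z ⟨hzU, hzD⟩; linarith⟩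
  -- approximate by Ψ.symm (Ψ z - t)
  have hct : Tendsto (fun t : ℝ => Ψ.symm (Ψ z - t)) (𝓝[>] 0) (𝓝 z) := by
    have h3 : ContinuousAt Ψ.symm (Ψ z) := Ψ.symm.continuousAt (Ψ.map_source hz)
    have h4 : Tendsto (fun t : ℝ => Ψ z - t) (𝓝[>] 0) (𝓝 (Ψ z)) := by
      have : Continuous (fun t : ℝ => Ψ z - t) := by fun_prop
      simpa using (this.tendsto 0).mono_left (nhdsWithin_le_nhds (s := Ioi 0))
    have := h3.tendsto.comp h4
    rwa [Ψ.left_inv hz] at this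
  refine mem_closure_of_tendsto hct ?_
  have : Ioo (0:ℝ) (δ / 3) ∈ 𝓝[>] (0:ℝ) := Ioo_mem_nhdsGT (by positivity)
  filter_upwards [this] with t ht
  apply hsub
  refine ⟨Ψ z - t, ⟨?_, ?_⟩, rfl⟩
  · rw [sub_re, hre, hz0]; simp; exact ⟨ht.2, ht.1⟩
  · rw [abs_lt] at h2
    rw [sub_im]; simp; constructor <;> linarith

end WS


namespace WS
open Topology

theorem chart_algebra (l : ℂ →L[ℝ] ℝ) {n ν v : ℂ} (hν : ‖ν‖ = 1)
    (h1 : ((starRingEnd ℂ) ν * v).re = 0) (h2 : l v = 0) (h3 : ((starRingEnd ℂ) n * v).im = 1)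
    (h4 : 0 < l ν) (h5 : 0 < l n) : l (I * ν) = 0 ∧ ‖v‖ * l n = l ν := by
  set τ := ((starRingEnd ℂ) ν * v).im with hτ
  have hνν : ν * (starRingEnd ℂ) ν = 1 := by
    rw [Complex.mul_conj, Complex.normSq_eq_norm_sq, hν]; simp
  have hv : v = τ • (I * ν) := by
    have e : (starRingEnd ℂ) ν * v = τ * I := by
      apply Complex.ext <;> simp [← hτ, h1]
    calc v = ν * (starRingEnd ℂ) ν * v := by rw [hνν, one_mul]
      _ = ν * ((starRingEnd ℂ) ν * v) := by ring
      _ = _ := by rw [e]; simp; ring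
  have hτ0 : τ ≠ 0 := by
    intro h0
    rw [h0, zero_smul] at hv
    rw [hv] at h3
    simp at h3
  have hl : l (I * ν) = 0 := by
    have h6 : l v = τ * l (I * ν) := by rw [hv, map_smul]; simp
    rw [h2] at h6
    exact (mul_eq_zero.mp h6.symm).resolve_left hτ0
  refine ⟨hl, ?_⟩
  have hn : n = ((starRingEnd ℂ) ν * n).re • ν + ((starRingEnd ℂ) ν * n).im • (I * ν) := by
    calc n = ν * (starRingEnd ℂ) ν * n := by rw [hνν, one_mul]
      _ = ν * ((starRingEnd ℂ) ν * n) := by ring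
      _ = ν * (((starRingEnd ℂ) ν * n).re + ((starRingEnd ℂ) ν * n).im * I) := by rw [re_add_im]
      _ = _ := by simp only [real_smul]; ring
  have hln : l n = ((starRingEnd ℂ) ν * n).re * l ν := by
    conv_lhs => rw [hn]
    rw [map_add, map_smul, map_smul, hl]; simp
  have h7 : τ * ((starRingEnd ℂ) ν * n).re = 1 := by
    rw [hv] at h3
    rw [← h3]
    simp
    ring
  have h8 : τ * l n = l ν := by rw [hln, ← mul_assoc, h7, one_mul]
  have hτp : 0 < τ := by
    by_contra hcon
    push Not at hcon
    nlinarith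
  have : ‖v‖ = τ := by
    rw [hv, norm_smul, norm_mul, hν, norm_I, Real.norm_eq_abs, abs_of_pos hτp]; ring
  rw [this, h8]

theorem fderiv_sq (l : ℂ →L[ℝ] ℝ) {ν : ℂ} (hν : ‖ν‖ = 1) (h0 : l (I * ν) = 0) (h4 : 0 < l ν) :
    l ν = Real.sqrt ((l 1) ^ 2 + (l I) ^ 2) ∧ ∀ v, l v = ((starRingEnd ℂ) ν * v).re * l ν := by
  have hn : ∀ v, l v = ((starRingEnd ℂ) ν * v).re * l ν := by
    intro v
    have hνν : ν * (starRingEnd ℂ) ν = 1 := by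
      rw [Complex.mul_conj, Complex.normSq_eq_norm_sq, hν]; simp
    have hn : v = ((starRingEnd ℂ) ν * v).re • ν + ((starRingEnd ℂ) ν * v).im • (I * ν) := by
      calc v = ν * (starRingEnd ℂ) ν * v := by rw [hνν, one_mul]
        _ = ν * ((starRingEnd ℂ) ν * v) := by ring
        _ = ν * (((starRingEnd ℂ) ν * v).re + ((starRingEnd ℂ) ν * v).im * I) := by rw [re_add_im]
        _ = _ := by simp only [real_smul]; ring
    conv_lhs => rw [hn]
    rw [map_add, map_smul, map_smul, h0]; simp
  refine ⟨?_, hn⟩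
  rw [hn 1, hn I]
  have : ν.re ^ 2 + ν.im ^ 2 = 1 := by
    have := Complex.normSq_eq_norm_sq ν
    rw [hν, normSq_apply] at this; linarith
  symm
  rw [Real.sqrt_eq_iff_mul_self_eq (by positivity) h4.le]
  simp
  linear_combination ((l ν)^2) * this

theorem poisson_line (s : ℝ) (hs : 0 < s) (q : ℝ) :
    ∫⁻ y : ℝ, ENNReal.ofReal (s / (s ^ 2 + (y - q) ^ 2)) ≤ ENNReal.ofReal Real.pi := by
  have e : ∀ y : ℝ, s / (s ^ 2 + (y - q) ^ 2) = s⁻¹ * (1 + (s⁻¹ * (y - q)) ^ 2)⁻¹ := by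
    intro y
    have : 0 < s ^ 2 + (y - q) ^ 2 := by positivity
    have : 0 < 1 + (s⁻¹ * (y - q)) ^ 2 := by positivity
    field_simp
  simp_rw [e]
  have hi : Integrable (fun y : ℝ => s⁻¹ * (1 + (s⁻¹ * (y - q)) ^ 2)⁻¹) := by
    have h1 := integrable_inv_one_add_sq.comp_mul_left' (inv_ne_zero hs.ne')
    exact (h1.comp_sub_right q).const_mul _
  rw [← ofReal_integral_eq_lintegral_ofReal hi (ae_of_all _ fun y => by positivity)]
  refine ENNReal.ofReal_le_ofReal (le_of_eq ?_)
  rw [integral_const_mul, integral_sub_right_eq_self (fun y : ℝ => (1 + (s⁻¹ * y) ^ 2)⁻¹) q,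
    Measure.integral_comp_mul_left (fun y : ℝ => (1 + y ^ 2)⁻¹), integral_univ_inv_one_add_sq]
  rw [inv_inv, abs_of_pos hs]
  simp
  field_simp

end WS


namespace WS
open Topology

theorem local_collar {D U : Set ℂ} {r : ℂ → ℝ} {ν : ℂ → ℂ} (h : Coll D U r ν) {p : ℂ}
    (hp : p ∈ frontier D) : ∃ V, IsOpen V ∧ p ∈ V ∧ V ⊆ U ∧
    (∀ z ∈ frontier D ∩ V, fderiv ℝ r z (I * ν z) = 0) ∧
    μH[1] (frontier D ∩ V) < ⊤ ∧
    (∃ M : ENNReal, M ≠ ⊤ ∧ ∀ q : ℂ, ∀ s : ℝ, 0 < s → ∫⁻ z in frontier D ∩ V,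
      ENNReal.ofReal (s / (s ^ 2 + ‖z - q‖ ^ 2)) ∂μH[1] ≤ M) ∧
    (∀ κ : ℝ → ℝ, Continuous κ → (∀ x, x ∉ Icc (1:ℝ) 2 → κ x = 0) → ∀ φ : ℂ → ℂ,
      ContinuousOn φ (closure D ∩ V) → ∀ Kc, IsCompact Kc → Kc ⊆ V → (∀ z, z ∉ Kc → φ z = 0) →
      Tendsto (fun ε : ℝ => ∫ z in D ∩ V, ((ε⁻¹ * κ (-r z / ε) : ℝ) : ℂ) * φ z) (𝓝[>] 0)
        (𝓝 (((∫ t, κ t : ℝ) : ℂ) *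
          ∫ z in frontier D ∩ V, φ z / ((fderiv ℝ r z (ν z) : ℝ) : ℂ) ∂μH[1]))) := by
  obtain ⟨Ψ, n, a, y0, ha, hn, hpΨ, hsU, hΨ, hJ, hbox, hpa, htop⟩ := chart_exists h hp
  have hre : ∀ z, (Ψ z).re = r z := by intro z; rw [hΨ]; simp
  have him : ∀ z, (Ψ z).im = ((starRingEnd ℂ) n * z).im := by intro z; rw [hΨ]; simp
  have hrd : ∀ z ∈ U, HasFDerivAt r (fderiv ℝ r z) z := fun z hz =>
    ((h.hr.differentiableOn one_ne_zero).differentiableAt (h.hU.mem_nhds hz)).hasFDerivAt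
  have hfdc : ContinuousOn (fderiv ℝ r) U := h.hr.continuousOn_fderiv_of_isOpen h.hU le_rfl
  have hfd : ∀ z ∈ U, HasFDerivAt Ψ (chartD (fderiv ℝ r z) n) z := by
    intro z hz
    have h1 := ofRealCLM.hasFDerivAt.comp z (hrd z hz)
    have h2 := (I • (ofRealCLM.comp (imCLM.comp
      (ContinuousLinearMap.mul ℝ ℂ ((starRingEnd ℂ) n))))).hasFDerivAt (x := z)
    refine (h1.add h2).congr_of_eventuallyEq ?_
    filter_upwards with y
    rw [hΨ]; simp
  let Q : Set ℂ := {w : ℂ | |w.re| < a ∧ |w.im - y0| < a}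
  have hQo : IsOpen Q := by
    have h1 : IsOpen {w : ℂ | |w.re| < a} := isOpen_lt (continuous_re.abs) continuous_const
    have h2 : IsOpen {w : ℂ | |w.im - y0| < a} :=
      isOpen_lt ((continuous_im.sub continuous_const).abs) continuous_const
    exact h1.inter h2
  have hQt : Q ⊆ Ψ.target := fun w hw => hbox ⟨hw.1.le, hw.2.le⟩
  let V : Set ℂ := Ψ.source ∩ Ψ ⁻¹' Q
  have hV : IsOpen V := Ψ.isOpen_inter_preimage hQo
  have hgV : ∀ w ∈ Q, Ψ.symm w ∈ V := fun w hw =>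
    ⟨Ψ.map_target (hQt hw), by rw [mem_preimage, Ψ.right_inv (hQt hw)]; exact hw⟩
  have hVU : V ⊆ U := fun z hz => hsU hz.1
  -- the curve
  let γ : ℝ → ℂ := fun y => Ψ.symm (y * I)
  have hyt : ∀ y ∈ Icc (y0 - a) (y0 + a), ((y:ℂ) * I) ∈ Ψ.target := by
    intro y hy
    apply hbox
    simp
    exact ⟨ha.le, abs_le.mpr ⟨by linarith [hy.1], by linarith [hy.2]⟩⟩
  have hyQ : ∀ y ∈ Ioo (y0 - a) (y0 + a), ((y:ℂ) * I) ∈ Q := by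
    intro y hy
    refine ⟨by simpa using ha, ?_⟩
    simp
    exact abs_lt.mpr ⟨by linarith [hy.1], by linarith [hy.2]⟩
  have hγs : ∀ y ∈ Icc (y0 - a) (y0 + a), γ y ∈ Ψ.source := fun y hy => Ψ.map_target (hyt y hy)
  have hγΨ : ∀ y ∈ Icc (y0 - a) (y0 + a), Ψ (γ y) = y * I := fun y hy => Ψ.right_inv (hyt y hy)
  have hγim : ∀ y ∈ Icc (y0 - a) (y0 + a), ((starRingEnd ℂ) n * γ y).im = y := by
    intro y hy; rw [← him, hγΨ y hy]; simp
  let v : ℂ → ℂ := fun z => n * (I - ((fderiv ℝ r z (I * n) / fderiv ℝ r z n : ℝ) : ℂ))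
  have hnn : (starRingEnd ℂ) n * n = 1 := by
    rw [mul_comm, Complex.mul_conj, Complex.normSq_eq_norm_sq, hn]; simp
  have hv1 : ∀ z ∈ Ψ.source, fderiv ℝ r z (v z) = 0 := by
    intro z hz
    have hJz := hJ z hz
    have e : v z = I * n - (fderiv ℝ r z (I * n) / fderiv ℝ r z n) • n := by
      simp [v]; ring
    rw [e, map_sub, map_smul]
    simp
    field_simp
    ring
  have hv2 : ∀ z, ((starRingEnd ℂ) n * v z).im = 1 := by
    intro z
    simp only [v]
    rw [← mul_assoc, hnn, one_mul]; simp
  have hγd : ∀ y ∈ Icc (y0 - a) (y0 + a), HasDerivAt γ (v (γ y)) y := by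
    intro y hy
    have hdet : (chartD (fderiv ℝ r (γ y)) n).det ≠ 0 := by
      rw [chartD_det]; exact (hJ _ (hγs y hy)).ne'
    have h1 : HasFDerivAt Ψ ((ContinuousLinearMap.toContinuousLinearEquivOfDetNeZero _ hdet :
      ℂ ≃L[ℝ] ℂ) : ℂ →L[ℝ] ℂ) (Ψ.symm (y * I)) := by
      rw [ContinuousLinearMap.coe_toContinuousLinearEquivOfDetNeZero]
      exact hfd _ (hsU (hγs y hy))
    have h2 := Ψ.hasFDerivAt_symm (hyt y hy) h1
    have h3 : HasDerivAt (fun y : ℝ => (y:ℂ) * I) I y := by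
      have := (ofRealCLM.hasDerivAt (x := y)).mul_const I
      simpa using this
    have h4 := h2.comp_hasDerivAt y h3
    refine h4.congr_deriv ?_
    rw [ContinuousLinearEquiv.coe_coe, ContinuousLinearEquiv.symm_apply_eq,
      ContinuousLinearMap.toContinuousLinearEquivOfDetNeZero_apply, chartD_apply,
      hv1 _ (hγs y hy), hv2]
    simp
  have hγc : ContinuousOn γ (Icc (y0 - a) (y0 + a)) :=
    fun y hy => (hγd y hy).continuousAt.continuousWithinAt
  have hvc : ContinuousOn v Ψ.source := by
    have h1 : ContinuousOn (fun z => fderiv ℝ r z (I * n)) Ψ.source :=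
      (hfdc.mono hsU).clm_apply continuousOn_const
    have h2 : ContinuousOn (fun z => fderiv ℝ r z n) Ψ.source :=
      (hfdc.mono hsU).clm_apply continuousOn_const
    exact continuousOn_const.mul (continuousOn_const.sub
      (continuous_ofReal.comp_continuousOn (h1.div h2 (fun z hz => (hJ z hz).ne'))))
  have hγ'c : ContinuousOn (fun y => v (γ y)) (Icc (y0 - a) (y0 + a)) := hvc.comp hγc hγs
  have hinj : InjOn γ (Icc (y0 - a) (y0 + a)) := by
    intro y hy y' hy' he
    rw [← hγim y hy, ← hγim y' hy', he]
  have hγf : ∀ y ∈ Ioo (y0 - a) (y0 + a), γ y ∈ frontier D := by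
    intro y hy
    have hy' := Ioo_subset_Icc_self hy
    have hq := hyQ y hy
    rw [← hγΨ y hy'] at hq
    refine ((htop (γ y) (hγs y hy') hq.1 hq.2).2).mp ?_
    rw [← hre, hγΨ y hy']; simp
  have himg : frontier D ∩ V = γ '' Ioo (y0 - a) (y0 + a) := by
    ext z
    constructor
    · rintro ⟨hz1, hz2, hz3⟩
      have e : Ψ z = (((Ψ z).im : ℝ) : ℂ) * I := by
        apply Complex.ext
        · simp [hre, h.h0 z hz1]
        · simp
      have h3 := abs_lt.mp hz3.2
      refine ⟨(Ψ z).im, ⟨by linarith, by linarith⟩, ?_⟩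
      simp only [γ]
      rw [← e, Ψ.left_inv hz2]
    · rintro ⟨y, hy, rfl⟩
      exact ⟨hγf y hy, hgV _ (hyQ y hy)⟩
  have halg : ∀ y ∈ Ioo (y0 - a) (y0 + a), fderiv ℝ r (γ y) (I * ν (γ y)) = 0 ∧
      ‖v (γ y)‖ * fderiv ℝ r (γ y) n = fderiv ℝ r (γ y) (ν (γ y)) := by
    intro y hy
    have hy' := Ioo_subset_Icc_self hy
    obtain ⟨q1, q2, q3⟩ := h.hν (γ y) (hγf y hy)
    have hds : HasDerivAt (fun t : ℝ => γ (y + t)) (v (γ y)) 0 := by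
      have h1 : HasDerivAt γ (v (γ y)) (y + 0) := by rw [add_zero]; exact hγd y hy'
      exact h1.comp_const_add y 0
    have hev : ∀ᶠ t in 𝓝 (0:ℝ), γ (y + t) ∈ frontier D := by
      have : Tendsto (fun t : ℝ => y + t) (𝓝 0) (𝓝 y) := by
        have : Continuous (fun t : ℝ => y + t) := by fun_prop
        simpa using this.tendsto 0
      filter_upwards [this.eventually (Ioo_mem_nhds hy.1 hy.2)] with t ht using hγf _ ht
    have h3 := q3 (fun t => γ (y + t)) (by simp) hev hds.differentiableAt
    rw [hds.deriv] at h3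
    exact chart_algebra _ q1 h3 (hv1 _ (hγs y hy')) (hv2 _) (h.hpos _ (hγf y hy))
      (hJ _ (hγs y hy'))
  have hortho : ∀ z ∈ frontier D ∩ V, fderiv ℝ r z (I * ν z) = 0 := by
    intro z hz
    rw [himg] at hz
    obtain ⟨y, hy, rfl⟩ := hz
    exact (halg y hy).1
  -- bound for the speed
  obtain ⟨C, hC⟩ := isCompact_Icc.exists_bound_of_continuousOn hγ'c
  have hCe : ∀ y ∈ Ioo (y0 - a) (y0 + a), ‖v (γ y)‖ₑ ≤ ENNReal.ofReal C := by
    intro y hy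
    rw [← ofReal_norm]
    exact ENNReal.ofReal_le_ofReal (hC y (Ioo_subset_Icc_self hy))
  have hmeas := hausdorff_restrict hγd hγ'c hinj Ioo_subset_Icc_self measurableSet_Ioo
  have hγm : AEMeasurable γ (volume.restrict (Ioo (y0 - a) (y0 + a))) :=
    (hγc.mono Ioo_subset_Icc_self).aemeasurable measurableSet_Ioo
  have hγ'm : AEMeasurable (fun y => v (γ y)) (volume.restrict (Ioo (y0 - a) (y0 + a))) :=
    (hγ'c.mono Ioo_subset_Icc_self).aemeasurable measurableSet_Ioo
  have hγm2 : AEMeasurable γ ((volume.restrict (Ioo (y0 - a) (y0 + a))).withDensity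
      (fun y => ‖v (γ y)‖ₑ)) := hγm.mono_ac (withDensity_absolutelyContinuous _ _)
  refine ⟨V, hV, ⟨hpΨ, hpa⟩, hVU, hortho, ?_, ⟨ENNReal.ofReal C * ENNReal.ofReal Real.pi,
    ENNReal.mul_ne_top ENNReal.ofReal_ne_top ENNReal.ofReal_ne_top, ?_⟩, ?_⟩
  · rw [himg, hausdorff_curve hγd hγ'c hinj Ioo_subset_Icc_self measurableSet_Ioo]
    calc _ ≤ ∫⁻ y in Ioo (y0 - a) (y0 + a), ENNReal.ofReal C :=
          setLIntegral_mono' measurableSet_Ioo hCe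
      _ < ⊤ := by
          rw [setLIntegral_const]
          exact ENNReal.mul_lt_top ENNReal.ofReal_lt_top (by simp)
  · intro q s hs
    have hmm : Measurable (fun z : ℂ => ENNReal.ofReal (s / (s ^ 2 + ‖z - q‖ ^ 2))) := by
      fun_prop
    rw [himg, hmeas, lintegral_map' hmm.aemeasurable hγm2,
      lintegral_withDensity_eq_lintegral_mul₀
        (g := fun y => ENNReal.ofReal (s / (s ^ 2 + ‖γ y - q‖ ^ 2))) hγ'm.enorm
        (hmm.comp_aemeasurable hγm)]
    calc _ ≤ ∫⁻ y in Ioo (y0 - a) (y0 + a), ENNReal.ofReal C *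
          ENNReal.ofReal (s / (s ^ 2 + (y - ((starRingEnd ℂ) n * q).im) ^ 2)) := by
          refine setLIntegral_mono' measurableSet_Ioo ?_
          intro y hy
          simp only [Pi.mul_apply, Function.comp]
          refine mul_le_mul' (hCe y hy) ?_
          · have h1 : |((starRingEnd ℂ) n * (γ y - q)).im| ≤ ‖γ y - q‖ := by
              refine (abs_im_le_norm _).trans ?_
              rw [norm_mul, RCLike.norm_conj, hn, one_mul]
            rw [mul_sub, sub_im, hγim y (Ioo_subset_Icc_self hy)] at h1
            have h2 := pow_le_pow_left₀ (abs_nonneg _) h1 2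
            rw [sq_abs] at h2
            apply ENNReal.ofReal_le_ofReal
            gcongr
      _ ≤ ∫⁻ y, ENNReal.ofReal C *
          ENNReal.ofReal (s / (s ^ 2 + (y - ((starRingEnd ℂ) n * q).im) ^ 2)) :=
          setLIntegral_le_lintegral _ _
      _ ≤ _ := by
          rw [lintegral_const_mul _ (by fun_prop)]
          gcongr
          exact poisson_line s hs _
  · intro κ hκ hκ0 φ hφ Kc hKc hKV hφ0
    let F : ℂ → ℂ := Q.indicator (fun w => φ (Ψ.symm w) / ((fderiv ℝ r (Ψ.symm w) n : ℝ) : ℂ))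
    have hVn : ∀ z ∈ V, (((fderiv ℝ r z n : ℝ) : ℂ)) ≠ 0 := fun z hz => by
      exact_mod_cast (hJ z hz.1).ne'
    have hK2 : IsClosed (Ψ '' Kc) :=
      (hKc.image_of_continuousOn (Ψ.continuousOn.mono (fun z hz => (hKV hz).1))).isClosed
    have hF0 : ∀ w, w ∉ Ψ '' Kc → F w = 0 := by
      intro w hw
      by_cases hwQ : w ∈ Q
      · have : Ψ.symm w ∉ Kc := fun hc => hw ⟨_, hc, Ψ.right_inv (hQt hwQ)⟩
        simp only [F]
        rw [indicator_of_mem hwQ, hφ0 _ this, zero_div]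
      · exact indicator_of_notMem hwQ _
    have hFc : ContinuousOn F {w | w.re ≤ 0} := by
      intro w hw
      by_cases hwK : w ∈ Ψ '' Kc
      · have hwQ : w ∈ Q := by
          obtain ⟨z, hz, rfl⟩ := hwK
          exact (hKV hz).2
        have hmaps : MapsTo Ψ.symm ({w | w.re ≤ 0} ∩ Q) (closure D ∩ V) := by
          intro w' hw'
          refine ⟨?_, hgV _ hw'.2⟩
          have hVw := hgV _ hw'.2
          have ht := htop _ hVw.1 hVw.2.1 hVw.2.2
          have hrle : r (Ψ.symm w') ≤ 0 := by
            rw [← hre, Ψ.right_inv (hQt hw'.2)]; exact hw'.1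
          rcases hrle.lt_or_eq with h1 | h1
          · exact subset_closure (ht.1.mp h1)
          · exact frontier_subset_closure (ht.2.mp h1)
        have hc1 : ContinuousOn (fun w => φ (Ψ.symm w) / ((fderiv ℝ r (Ψ.symm w) n : ℝ) : ℂ))
            ({w | w.re ≤ 0} ∩ Q) := by
          have hsc : ContinuousOn Ψ.symm ({w | w.re ≤ 0} ∩ Q) :=
            Ψ.continuousOn_symm.mono (fun w' hw' => hQt hw'.2)
          refine (hφ.comp hsc hmaps).div ?_ (fun w' hw' => hVn _ (hmaps hw').2)
          refine continuous_ofReal.comp_continuousOn ?_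
          exact (ContinuousOn.clm_apply (hfdc.comp hsc (fun w' hw' => hVU (hmaps hw').2))
            continuousOn_const)
        have hc2 := hc1 w ⟨hw, hwQ⟩
        have hc3 : ContinuousWithinAt F ({w | w.re ≤ 0} ∩ Q) w :=
          hc2.congr (fun w' hw' => indicator_of_mem hw'.2 _) (indicator_of_mem hwQ _)
        exact (continuousWithinAt_inter (hQo.mem_nhds hwQ)).mp hc3
      · have : (fun _ => (0:ℂ)) =ᶠ[𝓝 w] F := by
          filter_upwards [hK2.isOpen_compl.mem_nhds hwK] with w' hw' using (hF0 w' hw').symm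
        exact (continuousAt_const.congr this).continuousWithinAt
    have hFM : ∀ w : ℂ, |y0| + a < |w.im| → F w = 0 := by
      intro w hw
      refine indicator_of_notMem ?_ _
      intro hwQ
      have h1 := hwQ.2
      have := abs_sub_abs_le_abs_sub w.im y0
      linarith
    have hlim := halfplane_collar hκ hκ0 hFc hFM
    -- boundary integral
    have hbd : ∫ y : ℝ, F (y * I) =
        ∫ z in frontier D ∩ V, φ z / ((fderiv ℝ r z (ν z) : ℝ) : ℂ) ∂μH[1] := by
      have hmf : MeasurableSet (frontier D ∩ V) := isClosed_frontier.measurableSet.inter hV.measurableSet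
      have hcg : ∀ z ∈ frontier D ∩ V, φ z / ((fderiv ℝ r z (ν z) : ℝ) : ℂ) =
          φ z / ((Real.sqrt ((fderiv ℝ r z 1) ^ 2 + (fderiv ℝ r z I) ^ 2) : ℝ) : ℂ) := by
        intro z hz
        rw [← (fderiv_sq (fderiv ℝ r z) (h.hν z hz.1).1 (hortho z hz) (h.hpos z hz.1)).1]
      rw [setIntegral_congr_fun hmf hcg]
      have hcont : ContinuousOn (fun z => φ z / ((Real.sqrt ((fderiv ℝ r z 1) ^ 2 +
          (fderiv ℝ r z I) ^ 2) : ℝ) : ℂ)) (frontier D ∩ V) := by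
        refine (hφ.mono (inter_subset_inter_left _ frontier_subset_closure)).div ?_ ?_
        · refine continuous_ofReal.comp_continuousOn (ContinuousOn.sqrt ?_)
          have hm : ContinuousOn (fderiv ℝ r) (frontier D ∩ V) := hfdc.mono (fun z hz => hVU hz.2)
          exact ((hm.clm_apply continuousOn_const).pow 2).add
            ((hm.clm_apply continuousOn_const).pow 2)
        · intro z hz
          rw [← (fderiv_sq (fderiv ℝ r z) (h.hν z hz.1).1 (hortho z hz) (h.hpos z hz.1)).1]
          exact_mod_cast (h.hpos z hz.1).ne'
      have hsm := hcont.aestronglyMeasurable (μ := μH[1]) hmf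
      rw [himg, hmeas] at hsm ⊢
      rw [integral_map hγm2 hsm]
      have := integral_withDensity_eq_integral_smul₀ (hγ'm.nnnorm)
        (fun y => φ (γ y) / ((Real.sqrt ((fderiv ℝ r (γ y) 1) ^ 2 +
          (fderiv ℝ r (γ y) I) ^ 2) : ℝ) : ℂ))
      refine Eq.trans ?_ this.symm
      rw [← setIntegral_eq_integral_of_forall_compl_eq_zero (s := Ioo (y0 - a) (y0 + a))]
      · refine setIntegral_congr_fun measurableSet_Ioo ?_
        intro y hy
        simp only [F]
        rw [indicator_of_mem (hyQ y hy)]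
        have hfr : γ y ∈ frontier D ∩ V := ⟨hγf y hy, hgV _ (hyQ y hy)⟩
        rw [← (fderiv_sq (fderiv ℝ r (γ y)) (h.hν _ hfr.1).1 (hortho _ hfr) (h.hpos _ hfr.1)).1]
        rw [← (halg y hy).2]
        have hvn : ‖v (γ y)‖ ≠ 0 := by
          intro h0
          have := (halg y hy).2
          rw [h0, zero_mul] at this
          exact (h.hpos _ hfr.1).ne this
        have hvn' : ((‖v (γ y)‖ : ℝ) : ℂ) ≠ 0 := by exact_mod_cast hvn
        have hJn := hVn _ hfr.2
        rw [NNReal.smul_def, coe_nnnorm, real_smul, ofReal_mul]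
        change φ (γ y) / ((fderiv ℝ r (γ y) n : ℝ) : ℂ) = _
        field_simp
      · intro y hy
        refine indicator_of_notMem ?_ _
        intro hq
        have := abs_lt.mp hq.2
        simp at this
        exact hy ⟨by linarith, by linarith⟩
    rw [hbd] at hlim
    refine hlim.congr ?_
    intro ε
    have hms : MeasurableSet (D ∩ V) := h.hD.measurableSet.inter hV.measurableSet
    have hcv := integral_image_eq_integral_abs_det_fderiv_smul volume hms
      (f := Ψ) (f' := fun z => chartD (fderiv ℝ r z) n)
      (fun z hz => (hfd z (hVU hz.2)).hasFDerivWithinAt)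
      (Ψ.injOn.mono (fun z hz => hz.2.1)) (fun w => ((ε⁻¹ * κ (-w.re / ε) : ℝ) : ℂ) * F w)
    have himg2 : Ψ '' (D ∩ V) = {w | w.re < 0} ∩ Q := by
      ext w
      constructor
      · rintro ⟨z, hz, rfl⟩
        refine ⟨?_, hz.2.2⟩
        change (Ψ z).re < 0
        rw [hre]; exact h.hneg z ⟨hVU hz.2, hz.1⟩
      · rintro ⟨h1, h2⟩
        have hVw := hgV _ h2
        refine ⟨Ψ.symm w, ⟨?_, hVw⟩, Ψ.right_inv (hQt h2)⟩
        refine (htop _ hVw.1 hVw.2.1 hVw.2.2).1.mp ?_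
        rw [← hre, Ψ.right_inv (hQt h2)]; exact h1
    rw [himg2] at hcv
    have hms2 : MeasurableSet {w : ℂ | w.re < 0} := measurableSet_lt measurable_re measurable_const
    have e1 : ∫ w in {w : ℂ | w.re < 0}, ((ε⁻¹ * κ (-w.re / ε) : ℝ) : ℂ) * F w =
        ∫ w in {w : ℂ | w.re < 0} ∩ Q, ((ε⁻¹ * κ (-w.re / ε) : ℝ) : ℂ) * F w := by
      refine setIntegral_eq_of_subset_of_forall_sdiff_eq_zero hms2 inter_subset_left ?_
      intro w hw
      have : F w = 0 := indicator_of_notMem (fun hq => hw.2 ⟨hw.1, hq⟩) _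
      rw [this, mul_zero]
    rw [e1, hcv]
    refine setIntegral_congr_fun hms ?_
    intro z hz
    have hJz := hJ z hz.2.1
    simp only [F]
    rw [chartD_det, hre, indicator_of_mem (show Ψ z ∈ Q from hz.2.2), Ψ.left_inv hz.2.1, abs_of_pos hJz, real_smul]
    have := hVn z hz.2
    field_simp

end WS


namespace WS
open Topology

theorem Coll.cpt {D U : Set ℂ} {r : ℂ → ℝ} {ν : ℂ → ℂ} (h : Coll D U r ν) :
    IsCompact (frontier D) :=
  h.hb.isCompact_closure.of_isClosed_subset isClosed_frontier frontier_subset_closure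

theorem Coll.mono {D U U' : Set ℂ} {r : ℂ → ℝ} {ν : ℂ → ℂ} (h : Coll D U r ν)
    (hU' : IsOpen U') (h1 : U' ⊆ U) (h2 : frontier D ⊆ U') : Coll D U' r ν where
  hD := h.hD
  hb := h.hb
  hU := hU'
  hfU := h2
  hr := h.hr.mono h1
  h0 := h.h0
  hneg := fun z hz => h.hneg z ⟨h1 hz.1, hz.2⟩
  hν := h.hν
  hpos := h.hpos

theorem Coll.ortho {D U : Set ℂ} {r : ℂ → ℝ} {ν : ℂ → ℂ} (h : Coll D U r ν) :
    ∀ z ∈ frontier D, fderiv ℝ r z (I * ν z) = 0 := by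
  intro z hz
  obtain ⟨V, hV, hpV, hVU, ho, -⟩ := local_collar h hz
  exact ho z ⟨hz, hpV⟩

theorem Coll.finite {D U : Set ℂ} {r : ℂ → ℝ} {ν : ℂ → ℂ} (h : Coll D U r ν) :
    μH[1] (frontier D) < ⊤ := by
  choose! V hV using fun p (hp : p ∈ frontier D) => local_collar h hp
  obtain ⟨t, ht, hcov⟩ := h.cpt.elim_nhds_subcover V
    (fun p hp => (hV p hp).1.mem_nhds (hV p hp).2.1)
  have hsub : frontier D ⊆ ⋃ x ∈ t, frontier D ∩ V x := by
    intro z hz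
    obtain ⟨x, hx, hzx⟩ := mem_iUnion₂.mp (hcov hz)
    exact mem_iUnion₂.mpr ⟨x, hx, hz, hzx⟩
  refine ((measure_mono hsub).trans (measure_biUnion_finset_le _ _)).trans_lt ?_
  exact ENNReal.sum_lt_top.mpr fun x hx => (hV x (ht x hx)).2.2.2.2.1

theorem Coll.poisson {D U : Set ℂ} {r : ℂ → ℝ} {ν : ℂ → ℂ} (h : Coll D U r ν) :
    ∃ M : ENNReal, M ≠ ⊤ ∧ ∀ q : ℂ, ∀ s : ℝ, 0 < s → ∫⁻ z in frontier D,
      ENNReal.ofReal (s / (s ^ 2 + ‖z - q‖ ^ 2)) ∂μH[1] ≤ M := by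
  choose! V hV using fun p (hp : p ∈ frontier D) => local_collar h hp
  choose! M hM using fun p (hp : p ∈ frontier D) => (hV p hp).2.2.2.2.2.1
  obtain ⟨t, ht, hcov⟩ := h.cpt.elim_nhds_subcover V
    (fun p hp => (hV p hp).1.mem_nhds (hV p hp).2.1)
  have hsub : frontier D ⊆ ⋃ x : t, frontier D ∩ V x := by
    intro z hz
    obtain ⟨x, hx, hzx⟩ := mem_iUnion₂.mp (hcov hz)
    exact mem_iUnion.mpr ⟨⟨x, hx⟩, hz, hzx⟩
  refine ⟨∑ x : t, M x, ?_, ?_⟩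
  · exact (ENNReal.sum_lt_top.mpr fun (x : t) _ => ((hM x.1 (ht x.1 x.2)).1).lt_top).ne
  · intro q s hs
    refine (lintegral_mono_set hsub).trans ((lintegral_iUnion_le _ _).trans ?_)
    rw [tsum_fintype]
    exact Finset.sum_le_sum fun x _ => (hM x.1 (ht x.1 x.2)).2 q s hs

theorem Coll.bint {D U : Set ℂ} {r : ℂ → ℝ} {ν : ℂ → ℂ} (h : Coll D U r ν) {φ : ℂ → ℂ}
    (hφ : ContinuousOn φ (frontier D)) : IntegrableOn φ (frontier D) μH[1] := by
  obtain ⟨C, hC⟩ := h.cpt.exists_bound_of_continuousOn hφ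
  have : IsFiniteMeasure ((μH[1] : Measure ℂ).restrict (frontier D)) :=
    ⟨by rw [Measure.restrict_apply_univ]; exact h.finite⟩
  refine Integrable.of_bound (hφ.aestronglyMeasurable isClosed_frontier.measurableSet) C ?_
  exact (ae_restrict_iff' isClosed_frontier.measurableSet).mpr (Eventually.of_forall hC)

theorem Coll.ncont {D U : Set ℂ} {r : ℂ → ℝ} {ν : ℂ → ℂ} (h : Coll D U r ν) :
    ContinuousOn (fun z => fderiv ℝ r z (ν z)) (frontier D) := by
  have hfdc : ContinuousOn (fderiv ℝ r) (frontier D) :=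
    (h.hr.continuousOn_fderiv_of_isOpen h.hU le_rfl).mono h.hfU
  have : ContinuousOn (fun z => √((fderiv ℝ r z 1) ^ 2 + (fderiv ℝ r z I) ^ 2)) (frontier D) :=
    (((hfdc.clm_apply continuousOn_const).pow 2).add
      ((hfdc.clm_apply continuousOn_const).pow 2)).sqrt
  refine this.congr fun z hz => ?_
  exact (fderiv_sq _ (h.hν z hz).1 (h.ortho z hz) (h.hpos z hz)).1

theorem global_collar {D U : Set ℂ} {r : ℂ → ℝ} {ν : ℂ → ℂ} (h : Coll D U r ν)
    {κ : ℝ → ℝ} (hκ : Continuous κ) (hκs : ∀ x, x ∉ Icc (1:ℝ) 2 → κ x = 0)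
    {R : ℂ → ℝ} (hR : ContinuousOn R D) (hR0 : ∀ z ∈ D, 0 < R z)
    (hRr : ∀ z ∈ U ∩ D, R z = - r z) {φ : ℂ → ℂ} (hφ : ContinuousOn φ (closure D ∩ U)) :
    Tendsto (fun ε : ℝ => ∫ z in D, ((ε⁻¹ * κ (R z / ε) : ℝ) : ℂ) * φ z) (𝓝[>] 0)
        (𝓝 (((∫ t, κ t : ℝ) : ℂ) *
          ∫ z in frontier D, φ z / ((fderiv ℝ r z (ν z) : ℝ) : ℂ) ∂μH[1])) := by
  choose! V hV using fun p (hp : p ∈ frontier D) => local_collar h hp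
  obtain ⟨t, ht, hcov⟩ := h.cpt.elim_nhds_subcover V
    (fun p hp => (hV p hp).1.mem_nhds (hV p hp).2.1)
  let e := t.equivFin.symm
  let W : Fin t.card → Set ℂ := fun i => V (e i)
  have heF : ∀ i, ((e i : t) : ℂ) ∈ frontier D := fun i => ht _ (e i).2
  have hWo : ∀ i, IsOpen (W i) := fun i => (hV _ (heF i)).1
  have hcov' : frontier D ⊆ ⋃ i, W i := by
    intro z hz
    obtain ⟨x, hx, hzx⟩ := mem_iUnion₂.mp (hcov hz)
    exact mem_iUnion.mpr ⟨t.equivFin ⟨x, hx⟩, by simpa [W, e] using hzx⟩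
  obtain ⟨δ, hδ, hth⟩ := h.cpt.exists_cthickening_subset_open (isOpen_iUnion hWo) hcov'
  obtain ⟨f, hf1, hf2, hf3, hf4⟩ := exists_continuous_sum_one_of_isOpen_isCompact hWo
    (h.cpt.cthickening (r := δ)) hth
  have hf0 : ∀ i z, z ∉ tsupport (f i) → f i z = 0 := fun i z hz => image_eq_zero_of_notMem_tsupport hz
  have hWU : ∀ i, W i ⊆ U := fun i => (hV _ (heF i)).2.2.1
  have hclD : ∀ z ∈ closure D, z ∉ frontier D → z ∈ D := by
    intro z hz hzf
    by_contra hzD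
    exact hzf ⟨hz, by rwa [h.hD.interior_eq]⟩
  have hDm := h.hD.measurableSet
  -- compact core
  have hKd : IsCompact (closure D \ thickening δ (frontier D)) :=
    h.hb.isCompact_closure.diff isOpen_thickening
  have hKD : closure D \ thickening δ (frontier D) ⊆ D := fun z hz =>
    hclD z hz.1 fun hf => hz.2 (self_subset_thickening hδ _ hf)
  obtain ⟨c, hc, hcR⟩ : ∃ c > 0, ∀ z ∈ closure D \ thickening δ (frontier D), c ≤ R z := by
    rcases (closure D \ thickening δ (frontier D)).eq_empty_or_nonempty with he | hne
    · exact ⟨1, one_pos, by simp [he]⟩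
    · obtain ⟨z, hz, hmin⟩ := hKd.exists_isMinOn hne (hR.mono hKD)
      exact ⟨R z, hR0 z (hKD hz), fun w hw => hmin hw⟩
  have hcont_rU : ContinuousOn r U := h.hr.continuousOn
  have hev : ∀ᶠ ε : ℝ in 𝓝[>] 0, ∑ i, ∫ z in D ∩ W i, ((ε⁻¹ * κ (-r z / ε) : ℝ) : ℂ) *
      ((f i z : ℂ) * φ z) = ∫ z in D, ((ε⁻¹ * κ (R z / ε) : ℝ) : ℂ) * φ z := by
    have : Iio (c / 2) ∈ 𝓝[>] (0:ℝ) := mem_nhdsWithin_of_mem_nhds (Iio_mem_nhds (by linarith))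
    filter_upwards [this, self_mem_nhdsWithin] with ε hε1 hε0
    have hε0 : 0 < ε := hε0
    have hε1 : ε < c / 2 := hε1
    have hIntg : ∀ i, IntegrableOn (fun z => ((ε⁻¹ * κ (R z / ε) : ℝ) : ℂ) *
      ((f i z : ℂ) * φ z)) D := by
      intro i
      have hK0 : IsCompact (closure D ∩ tsupport (f i)) :=
        (hf4 i).isCompact.inter_left isClosed_closure
      have hK0U : closure D ∩ tsupport (f i) ⊆ U := fun z hz => hWU i (hf1 i hz.2)
      let S := (closure D ∩ tsupport (f i)) ∩ r ⁻¹' Iic (-ε)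
      have hS : IsCompact S := by
        refine hK0.of_isClosed_subset ?_ inter_subset_left
        exact (hcont_rU.mono hK0U).preimage_isClosed_of_isClosed hK0.isClosed isClosed_Iic
      have hSD : S ⊆ D := by
        intro z hz
        refine hclD z hz.1.1 fun hzf => ?_
        have h1 := h.h0 z hzf
        have h2 : r z ≤ -ε := hz.2
        linarith
      have hcS : ContinuousOn (fun z => ((ε⁻¹ * κ (R z / ε) : ℝ) : ℂ) *
          ((f i z : ℂ) * φ z)) S := by
        refine ContinuousOn.mul ?_ (ContinuousOn.mul ?_ ?_)
        · exact continuous_ofReal.comp_continuousOn (continuousOn_const.mul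
            (hκ.comp_continuousOn ((hR.mono hSD).div_const ε)))
        · exact (continuous_ofReal.comp (f i).continuous).continuousOn
        · exact hφ.mono fun z hz => ⟨hz.1.1, hK0U hz.1⟩
      refine (hcS.integrableOn_compact hS).of_forall_sdiff_eq_zero hDm ?_
      intro z hz
      by_cases hzs : z ∈ tsupport (f i)
      · have hzU : z ∈ U := hK0U ⟨subset_closure hz.1, hzs⟩
        have hr' : -ε < r z := by
          by_contra hcon
          exact hz.2 ⟨⟨subset_closure hz.1, hzs⟩, not_lt.mp hcon⟩
        have : κ (R z / ε) = 0 := by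
          apply hκs
          rw [hRr z ⟨hzU, hz.1⟩]
          intro hh
          have := (le_div_iff₀ hε0).mp hh.1
          linarith
        rw [this]; simp
      · rw [hf0 i z hzs]; simp
    have e1 : ∀ i, ∫ z in D ∩ W i, ((ε⁻¹ * κ (-r z / ε) : ℝ) : ℂ) * ((f i z : ℂ) * φ z) =
        ∫ z in D, ((ε⁻¹ * κ (R z / ε) : ℝ) : ℂ) * ((f i z : ℂ) * φ z) := by
      intro i
      rw [setIntegral_eq_of_subset_of_forall_sdiff_eq_zero hDm (inter_subset_left (t := W i))]
      · refine setIntegral_congr_fun (hDm.inter (hWo i).measurableSet) fun z hz => ?_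
        rw [hRr z ⟨hWU i hz.2, hz.1⟩]
      · intro z hz
        rw [hf0 i z (fun hzs => hz.2 ⟨hz.1, hf1 i hzs⟩)]; simp
    rw [Finset.sum_congr rfl fun i _ => e1 i, ← integral_finsetSum _ fun i _ => hIntg i]
    refine setIntegral_congr_fun hDm fun z hz => ?_
    by_cases hzt : z ∈ thickening δ (frontier D)
    · have := hf2 (thickening_subset_cthickening _ _ hzt)
      simp only [Finset.sum_apply, Pi.one_apply] at this
      rw [← Finset.mul_sum, ← Finset.sum_mul, ← ofReal_sum, this]; simp
    · have h1 := hcR z ⟨subset_closure hz, hzt⟩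
      have : κ (R z / ε) = 0 := by
        apply hκs
        intro hh
        have := (div_le_iff₀ hε0).mp hh.2
        linarith
      simp [this]
  refine Tendsto.congr' hev ?_
  have hlim := fun i => (hV _ (heF i)).2.2.2.2.2.2 κ hκ hκs (fun z => (f i z : ℂ) * φ z)
    (((continuous_ofReal.comp (f i).continuous).continuousOn).mul
      (hφ.mono (inter_subset_inter_right _ (hWU i)))) (tsupport (f i)) (hf4 i) (hf1 i)
      (fun z hz => by rw [hf0 i z hz]; simp)
  have := tendsto_finsetSum Finset.univ fun i _ => hlim i
  convert this using 2
  rw [← Finset.mul_sum]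
  congr 1
  have hφF : ContinuousOn φ (frontier D) :=
    hφ.mono fun z hz => ⟨frontier_subset_closure hz, h.hfU hz⟩
  have hden : ContinuousOn (fun z => ((fderiv ℝ r z (ν z) : ℝ) : ℂ)) (frontier D) :=
    continuous_ofReal.comp_continuousOn h.ncont
  have hden0 : ∀ z ∈ frontier D, ((fderiv ℝ r z (ν z) : ℝ) : ℂ) ≠ 0 := fun z hz =>
    ofReal_ne_zero.mpr (h.hpos z hz).ne'
  have e2 : ∀ i, ∫ z in frontier D ∩ W i, (f i z : ℂ) * φ z / ((fderiv ℝ r z (ν z) : ℝ) : ℂ) ∂μH[1]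
      = ∫ z in frontier D, (f i z : ℂ) * φ z / ((fderiv ℝ r z (ν z) : ℝ) : ℂ) ∂μH[1] := by
    intro i
    rw [setIntegral_eq_of_subset_of_forall_sdiff_eq_zero isClosed_frontier.measurableSet
      (inter_subset_left (t := W i))]
    intro z hz
    rw [hf0 i z (fun hzs => hz.2 ⟨hz.1, hf1 i hzs⟩)]; simp
  rw [show (∑ i, ∫ z in frontier D ∩ V (e i), (f i z : ℂ) * φ z /
    ((fderiv ℝ r z (ν z) : ℝ) : ℂ) ∂μH[1]) = _ from Finset.sum_congr rfl fun i _ => e2 i,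
    ← integral_finsetSum]
  · refine setIntegral_congr_fun isClosed_frontier.measurableSet fun z hz => ?_
    have := hf2 (self_subset_cthickening _ hz)
    simp only [Finset.sum_apply, Pi.one_apply] at this
    rw [← Finset.sum_div, ← Finset.sum_mul, ← ofReal_sum, this]; simp
  · intro i _
    exact h.bint ((((continuous_ofReal.comp (f i).continuous).continuousOn).mul hφF).div
      hden hden0)

end WS


namespace WS
open Topology

/-- twice the holomorphic derivative of a real function -/
noncomputable def hdz (h : ℂ → ℝ) (z : ℂ) : ℂ :=
  ((fderiv ℝ h z 1 : ℝ) : ℂ) - I * ((fderiv ℝ h z I : ℝ) : ℂ)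

theorem hdz_of_re {h : ℂ → ℝ} {f : ℂ → ℂ} {f' z : ℂ} (hf : HasDerivAt f f' z)
    (he : ∀ᶠ y in 𝓝 z, h y = (f y).re) :
    hdz h z = f' ∧ HasD (fun z => (h z : ℂ)) (f' / 2) ((starRingEnd ℂ) f' / 2) z := by
  have h1 := reCLM.hasFDerivAt.comp z (hf.hasFDerivAt.restrictScalars ℝ)
  have h2 : HasFDerivAt h _ z := h1.congr_of_eventuallyEq he
  refine ⟨?_, ?_⟩
  · rw [hdz, h2.fderiv]
    apply Complex.ext <;> simp
  · have h3 := ofRealCLM.hasFDerivAt.comp z h2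
    refine HasFDerivAt.congr_fderiv h3 ?_
    ext <;> apply Complex.ext <;> simp <;> ring

theorem harm_hdz {h : ℂ → ℝ} {D : Set ℂ} (hh : HarmonicOnD h D) :
    DifferentiableOn ℂ (hdz h) D ∧ ContinuousOn h D ∧
    ∀ z ∈ D, HasD (fun z => (h z : ℂ)) (hdz h z / 2) ((starRingEnd ℂ) (hdz h z) / 2) z := by
  refine ⟨?_, ?_, ?_⟩
  · intro z hz
    obtain ⟨ρ, hρ, hb, f, hf, he⟩ := hh z hz
    have h1 : ∀ y ∈ ball z ρ, hdz h y = deriv f y := fun y hy =>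
      (hdz_of_re ((hf.differentiableAt (isOpen_ball.mem_nhds hy)).hasDerivAt)
        (eventually_of_mem (isOpen_ball.mem_nhds hy) he)).1
    have h2 : DifferentiableAt ℂ (deriv f) z :=
      (hf.deriv isOpen_ball).differentiableAt (ball_mem_nhds z hρ)
    refine (h2.congr_of_eventuallyEq ?_).differentiableWithinAt
    exact eventually_of_mem (ball_mem_nhds z hρ) h1
  · intro z hz
    obtain ⟨ρ, hρ, hb, f, hf, he⟩ := hh z hz
    have h2 : ContinuousAt f z := (hf.differentiableAt (ball_mem_nhds z hρ)).continuousAt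
    have h3 : ContinuousAt (fun y => (f y).re) z := continuous_re.continuousAt.comp h2
    exact (h3.congr (eventually_of_mem (ball_mem_nhds z hρ) fun y hy => (he y hy).symm)).continuousWithinAt
  · intro z hz
    obtain ⟨ρ, hρ, hb, f, hf, he⟩ := hh z hz
    have := hdz_of_re ((hf.differentiableAt (ball_mem_nhds z hρ)).hasDerivAt)
        (eventually_of_mem (ball_mem_nhds z hρ) he)
    rw [this.1]; exact this.2

theorem harm_add {h u : ℂ → ℝ} {D : Set ℂ} (hh : HarmonicOnD h D) (hu : HarmonicOnD u D) :
    HarmonicOnD (fun z => h z + u z) D := by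
  intro z hz
  obtain ⟨ρ, hρ, hb, f, hf, he⟩ := hh z hz
  obtain ⟨ρ', hρ', hb', f', hf', he'⟩ := hu z hz
  have h1 : ball z (min ρ ρ') ⊆ ball z ρ := ball_subset_ball (min_le_left _ _)
  have h2 : ball z (min ρ ρ') ⊆ ball z ρ' := ball_subset_ball (min_le_right _ _)
  refine ⟨min ρ ρ', lt_min hρ hρ', h1.trans hb, fun z => f z + f' z, (hf.mono h1).add (hf'.mono h2), ?_⟩
  intro w hw
  simp [he w (h1 hw), he' w (h2 hw)]

noncomputable def wf (a : ℂ → ℂ) (h : ℂ → ℝ) (z : ℂ) : ℝ := ‖a z‖ ^ 2 * Real.exp (2 * h z)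
noncomputable def Af (a : ℂ → ℂ) (h : ℂ → ℝ) (z : ℂ) : ℂ := deriv a z + a z * hdz h z
noncomputable def Vf (a : ℂ → ℂ) (h : ℂ → ℝ) (z : ℂ) : ℂ :=
  (starRingEnd ℂ) (a z) * Af a h z * (Real.exp (2 * h z) : ℝ)
noncomputable def Jf (a : ℂ → ℂ) (h : ℂ → ℝ) (z : ℂ) : ℝ := ‖Af a h z‖ ^ 2 * Real.exp (2 * h z)

section
variable {D : Set ℂ} {a : ℂ → ℂ} {h : ℂ → ℝ}

theorem wf_nonneg (z : ℂ) : 0 ≤ wf a h z := by unfold wf; positivity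
theorem Jf_nonneg (z : ℂ) : 0 ≤ Jf a h z := by unfold Jf; positivity

theorem Vf_sq (z : ℂ) : ‖Vf a h z‖ ^ 2 = wf a h z * Jf a h z := by
  unfold Vf wf Jf
  rw [norm_mul, norm_mul, RCLike.norm_conj, norm_real, Real.norm_eq_abs, abs_of_pos (Real.exp_pos _)]
  ring

theorem exp_HasD (hh : HarmonicOnD h D) {z : ℂ} (hz : z ∈ D) :
    HasD (fun z => ((Real.exp (2 * h z) : ℝ) : ℂ)) ((Real.exp (2 * h z) : ℝ) * hdz h z)
      ((Real.exp (2 * h z) : ℝ) * (starRingEnd ℂ) (hdz h z)) z := by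
  have h1 := (harm_hdz hh).2.2 z hz
  have h2 : HasDerivAt (fun x : ℝ => Real.exp (2 * x)) (Real.exp (2 * h z) * 2) (h z) := by
    have := ((hasDerivAt_id (h z)).const_mul 2).exp
    simpa using this
  have := h1.real_comp h2
  convert this using 1 <;> push_cast <;> ring

theorem Af_holo (hD : IsOpen D) (ha : DifferentiableOn ℂ a D) (hh : HarmonicOnD h D) :
    DifferentiableOn ℂ (Af a h) D :=
  (ha.deriv hD).add (ha.mul (harm_hdz hh).1)

theorem expc (hh : HarmonicOnD h D) :
    ContinuousOn (fun z => Real.exp (2 * h z)) D :=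
  Real.continuous_exp.comp_continuousOn (continuousOn_const.mul (harm_hdz hh).2.1)

theorem wf_cont (ha : DifferentiableOn ℂ a D) (hh : HarmonicOnD h D) :
    ContinuousOn (wf a h) D := (ha.continuousOn.norm.pow 2).mul (expc hh)

theorem Jf_cont (hD : IsOpen D) (ha : DifferentiableOn ℂ a D) (hh : HarmonicOnD h D) :
    ContinuousOn (Jf a h) D := ((Af_holo hD ha hh).continuousOn.norm.pow 2).mul (expc hh)

theorem Vf_cont (hD : IsOpen D) (ha : DifferentiableOn ℂ a D) (hh : HarmonicOnD h D) :
    ContinuousOn (Vf a h) D :=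
  ((continuous_conj.comp_continuousOn ha.continuousOn).mul (Af_holo hD ha hh).continuousOn).mul
    (continuous_ofReal.comp_continuousOn (expc hh))

theorem wf_HasD (hD : IsOpen D) (ha : DifferentiableOn ℂ a D) (hh : HarmonicOnD h D) {z : ℂ}
    (hz : z ∈ D) :
    HasD (fun z => (wf a h z : ℂ)) (Vf a h z) ((starRingEnd ℂ) (Vf a h z)) z := by
  have h1 := HasD.of_deriv ((ha.differentiableAt (hD.mem_nhds hz)).hasDerivAt)
  have h2 := (h1.mul h1.conj).mul (exp_HasD hh hz)
  have e : (fun z => (wf a h z : ℂ)) = fun z => a z * (starRingEnd ℂ) (a z) *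
      ((Real.exp (2 * h z) : ℝ) : ℂ) := by
    funext z; rw [wf, mul_conj, normSq_eq_norm_sq]; push_cast; rfl
  rw [e]
  convert h2 using 1 <;> simp only [Vf, Af, map_mul, map_add, conj_conj, conj_ofReal, map_zero] <;> ring

/-- derivative of `Vf`; the antiholomorphic part is `Jf` -/
theorem Vf_HasD (hD : IsOpen D) (ha : DifferentiableOn ℂ a D) (hh : HarmonicOnD h D) :
    ∃ X : ℂ → ℂ, ContinuousOn X D ∧ ∀ z ∈ D, HasD (Vf a h) (X z) (Jf a h z : ℂ) z := by
  have hA := Af_holo hD ha hh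
  refine ⟨fun z => (starRingEnd ℂ) (a z) * (deriv (Af a h) z + Af a h z * hdz h z) *
    (Real.exp (2 * h z) : ℝ), ?_, ?_⟩
  · exact ((continuous_conj.comp_continuousOn ha.continuousOn).mul
      ((hA.deriv hD).continuousOn.add (hA.continuousOn.mul (harm_hdz hh).1.continuousOn))).mul
      (continuous_ofReal.comp_continuousOn (expc hh))
  · intro z hz
    have h1 := HasD.of_deriv ((ha.differentiableAt (hD.mem_nhds hz)).hasDerivAt)
    have h2 := HasD.of_deriv ((hA.differentiableAt (hD.mem_nhds hz)).hasDerivAt)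
    have h3 := (h1.conj.mul h2).mul (exp_HasD hh hz)
    have e : (Jf a h z : ℂ) = (starRingEnd ℂ) (Af a h z) * Af a h z * (Real.exp (2 * h z) : ℝ) := by
      rw [conj_mul', Jf]; push_cast; rfl
    rw [e]
    refine HasD.congr (f := fun z => (starRingEnd ℂ) (a z) * Af a h z * (Real.exp (2 * h z) : ℝ))
      ?_ (Eventually.of_forall fun _ => rfl)
    convert h3 using 1
    · simp only [map_zero]; ring
    · have : (starRingEnd ℂ) (Af a h z) = (starRingEnd ℂ) (deriv a z) +
        (starRingEnd ℂ) (a z) * (starRingEnd ℂ) (hdz h z) := by simp [Af]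
      rw [this]; ring
end

/-- bump function facts -/
theorem bump_exists : ∃ κ1 κ0 : ℝ → ℝ, Continuous κ1 ∧ (∀ x, 0 ≤ κ1 x) ∧
    (∀ x, x ∉ Icc (1:ℝ) 2 → κ1 x = 0) ∧ (∫ t, κ1 t = 1) ∧
    (∀ t, HasDerivAt κ0 (κ1 t) t) ∧ (∀ t, t ≤ 1 → κ0 t = 0) ∧ (∀ t, 2 ≤ t → κ0 t = 1) ∧
    (∀ t, 0 ≤ κ0 t) ∧ (∀ t, κ0 t ≤ 1) := by
  let f : ContDiffBump (3/2 : ℝ) := ⟨1/4, 1/2, by norm_num, by norm_num⟩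
  let κ1 := f.normed volume
  have hc : Continuous κ1 := f.continuous_normed
  have h0 : ∀ x, 0 ≤ κ1 x := f.nonneg_normed
  have hz : ∀ x, x ∉ Ioo (1:ℝ) 2 → κ1 x = 0 := by
    intro x hx
    by_contra hne
    have : x ∈ Function.support κ1 := hne
    rw [f.support_normed_eq] at this
    apply hx
    rw [Real.ball_eq_Ioo] at this
    simp only [f] at this
    constructor <;> linarith [this.1, this.2]
  have h1 : ∫ t, κ1 t = 1 := f.integral_normed
  have hi : ∀ x y, IntervalIntegrable κ1 volume x y := fun x y => hc.intervalIntegrable x y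
  have hlo : ∀ t, t ≤ 1 → ∫ x in (1:ℝ)..t, κ1 x = 0 := by
    intro t ht
    rw [intervalIntegral.integral_congr (g := fun _ => 0)]
    · simp
    · intro x hx
      rw [uIcc_of_ge ht] at hx
      exact hz x fun hh => absurd hx.2 (not_le.mpr hh.1)
  have hhi0 : ∀ t, 2 ≤ t → ∫ x in (2:ℝ)..t, κ1 x = 0 := by
    intro t ht
    rw [intervalIntegral.integral_congr (g := fun _ => 0)]
    · simp
    · intro x hx
      rw [uIcc_of_le ht] at hx
      exact hz x fun hh => absurd hx.1 (not_le.mpr hh.2)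
  have h12 : ∫ x in (1:ℝ)..2, κ1 x = 1 := by
    rw [intervalIntegral.integral_of_le (by norm_num)]
    refine Eq.trans ?_ h1
    exact setIntegral_eq_integral_of_forall_compl_eq_zero fun x hx => hz x fun hh => hx ⟨hh.1, hh.2.le⟩
  have hhi : ∀ t, 2 ≤ t → ∫ x in (1:ℝ)..t, κ1 x = 1 := by
    intro t ht
    rw [← intervalIntegral.integral_add_adjacent_intervals (hi 1 2) (hi 2 t), h12, hhi0 t ht, add_zero]
  have hnn : ∀ t, 0 ≤ ∫ x in (1:ℝ)..t, κ1 x := by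
    intro t
    rcases le_total t 1 with ht | ht
    · rw [hlo t ht]
    · exact intervalIntegral.integral_nonneg ht fun x _ => h0 x
  refine ⟨κ1, fun t => ∫ x in (1:ℝ)..t, κ1 x, hc, h0, fun x hx => hz x fun hh => hx (Ioo_subset_Icc_self hh),
    h1, fun t => ?_, hlo, hhi, hnn, ?_⟩
  · exact intervalIntegral.integral_hasDerivAt_right (hi 1 t) hc.aestronglyMeasurable.stronglyMeasurableAtFilter
      hc.continuousAt
  · intro t
    rcases le_total t 2 with ht | ht
    · have := intervalIntegral.integral_add_adjacent_intervals (hi 1 t) (hi t 2)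
      have h3 : 0 ≤ ∫ x in t..(2:ℝ), κ1 x := intervalIntegral.integral_nonneg ht fun x _ => h0 x
      linarith
    · exact (hhi t ht).le

end WS


namespace WS
open Topology

def a0 (z0 : ℂ) (z : ℂ) : ℂ := z - z0

theorem a0_holo (z0 : ℂ) (D : Set ℂ) : DifferentiableOn ℂ (a0 z0) D :=
  (differentiable_id.sub_const z0).differentiableOn

theorem a0_deriv (z0 z : ℂ) : deriv (a0 z0) z = 1 :=
  ((hasDerivAt_id z).sub_const z0).deriv

structure GS (D : Set ℂ) (z0 : ℂ) (h : ℂ → ℝ) : Prop where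
  hD : IsOpen D
  hb : Bornology.IsBounded D
  hc : IsPreconnected D
  hz : z0 ∈ D
  hh : HarmonicOnD h D
  lt : ∀ z ∈ D, wf (a0 z0) h z < 1
  lim : ∀ p ∈ frontier D, Tendsto (wf (a0 z0) h) (𝓝[D] p) (𝓝 1)

section
variable {D : Set ℂ} {z0 : ℂ} {h : ℂ → ℝ}

theorem intOn_of_cpt (hD : IsOpen D) {f : ℂ → ℂ} (hf : ContinuousOn f D) {Kc : Set ℂ}
    (hK : IsCompact Kc) (hKD : Kc ⊆ D) (h0 : ∀ z ∈ D, z ∉ Kc → f z = 0) : IntegrableOn f D :=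
  ((hf.mono hKD).integrableOn_compact hK).of_forall_sdiff_eq_zero hD.measurableSet
    fun z hz => h0 z hz.1 hz.2

theorem intOn_of_cptR (hD : IsOpen D) {f : ℂ → ℝ} (hf : ContinuousOn f D) {Kc : Set ℂ}
    (hK : IsCompact Kc) (hKD : Kc ⊆ D) (h0 : ∀ z ∈ D, z ∉ Kc → f z = 0) : IntegrableOn f D :=
  ((hf.mono hKD).integrableOn_compact hK).of_forall_sdiff_eq_zero hD.measurableSet
    fun z hz => h0 z hz.1 hz.2

theorem GS.cont (S : GS D z0 h) : ContinuousOn (wf (a0 z0) h) D := wf_cont (a0_holo z0 D) S.hh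

theorem GS.cpt (S : GS D z0 h) {c : ℝ} (hc : c < 1) : IsCompact {z | z ∈ D ∧ wf (a0 z0) h z ≤ c} := by
  refine Metric.isCompact_of_isClosed_isBounded ?_ (S.hb.subset fun z hz => hz.1)
  rw [← closure_subset_iff_isClosed]
  intro z hz
  have hzD : z ∈ closure D := closure_mono (fun z hz => hz.1) hz
  have hfr : ∃ᶠ y in 𝓝[D] z, wf (a0 z0) h y ≤ c := by
    rw [mem_closure_iff_frequently] at hz
    rw [nhdsWithin, frequently_inf_principal]
    exact hz.mono fun y hy => ⟨hy.1, hy.2⟩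
  by_cases hzD' : z ∈ D
  · refine ⟨hzD', ?_⟩
    by_contra hcon
    have h1 : ∀ᶠ y in 𝓝[D] z, c < wf (a0 z0) h y := S.cont z hzD' (Ioi_mem_nhds (not_le.mp hcon))
    exact hfr (h1.mono fun y hy => not_le.mpr hy)
  · exfalso
    have hzf : z ∈ frontier D := ⟨hzD, by rwa [S.hD.interior_eq]⟩
    have h1 : ∀ᶠ y in 𝓝[D] z, c < wf (a0 z0) h y := S.lim z hzf (Ioi_mem_nhds hc)
    exact hfr (h1.mono fun y hy => not_le.mpr hy)

theorem GS.chiHasD (S : GS D z0 h) {χ χ' : ℝ → ℝ} (hχ : ∀ x, HasDerivAt χ (χ' x) x) :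
    ∀ z ∈ D, HasD (fun z => ((χ (wf (a0 z0) h z) : ℝ) : ℂ)) ((χ' (wf (a0 z0) h z) : ℝ) * Vf (a0 z0) h z)
      ((χ' (wf (a0 z0) h z) : ℝ) * (starRingEnd ℂ) (Vf (a0 z0) h z)) z := fun z hz =>
  (wf_HasD S.hD (a0_holo z0 D) S.hh hz).real_comp (hχ _)

theorem GS.chicont (S : GS D z0 h) {χ : ℝ → ℝ} (hχ : Continuous χ) :
    ContinuousOn (fun z => ((χ (wf (a0 z0) h z) : ℝ) : ℂ)) D :=
  continuous_ofReal.comp_continuousOn (hχ.comp_continuousOn S.cont)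

theorem GS.I2 (S : GS D z0 h) {χ χ' : ℝ → ℝ} (hχ : ∀ x, HasDerivAt χ (χ' x) x)
    (hχ' : Continuous χ') {τ : ℝ} (hτ : 0 < τ) (hs : ∀ x, 1 - τ ≤ x → χ x = 0) {m : ℂ → ℂ}
    (hm : DifferentiableOn ℂ m D) {ζ : ℂ} (hζ : ζ ∈ D) {s c : ℝ} (hζs : wf (a0 z0) h ζ < s)
    (hc : ∀ x, x ≤ s → χ x = c) :
    ∫ z in D, m z / (z - ζ) * ((χ' (wf (a0 z0) h z) : ℝ) * (starRingEnd ℂ) (Vf (a0 z0) h z)) =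
      -Real.pi * (c * m ζ) ∧ IntegrableOn (fun z => m z / (z - ζ) *
        ((χ' (wf (a0 z0) h z) : ℝ) * (starRingEnd ℂ) (Vf (a0 z0) h z))) D := by
  have hVc := Vf_cont S.hD (a0_holo z0 D) S.hh
  refine pompeiu_plateau S.hD (S.chiHasD hχ) ((S.chicont hχ').mul hVc)
    ((S.chicont hχ').mul (continuous_conj.comp_continuousOn hVc))
    (S.cpt (c := 1 - τ) (by linarith)) (fun z hz => hz.1) ?_ hm hζ ?_
  · intro z hz hzK
    rw [hs _ (not_le.mp fun hh => hzK ⟨hz, hh⟩).le]; simp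
  · have := (S.cont.continuousAt (S.hD.mem_nhds hζ)).eventually (Iio_mem_nhds hζs)
    filter_upwards [this] with y hy
    rw [hc _ (le_of_lt hy)]

theorem GS.I2' (S : GS D z0 h) {χ χ' : ℝ → ℝ} (hχ : ∀ x, HasDerivAt χ (χ' x) x)
    (hχ' : Continuous χ') {τ : ℝ} (hτ : 0 < τ) (hs : ∀ x, 1 - τ ≤ x → χ x = 0) {m : ℂ → ℂ}
    (hm : DifferentiableOn ℂ m D) :
    ∫ z in D, m z * ((χ' (wf (a0 z0) h z) : ℝ) * (starRingEnd ℂ) (Vf (a0 z0) h z)) = 0 := by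
  have hVc := Vf_cont S.hD (a0_holo z0 D) S.hh
  have hχc : Continuous χ := continuous_iff_continuousAt.mpr fun x => (hχ x).continuousAt
  have h1 : ∀ z ∈ D, HasD (fun z => m z * ((χ (wf (a0 z0) h z) : ℝ) : ℂ)) _ _ z := fun z hz =>
    (HasD.of_deriv ((hm.differentiableAt (S.hD.mem_nhds hz)).hasDerivAt)).mul (S.chiHasD hχ z hz)
  have := (integral_HasD_zero S.hD h1 ?_ ?_
    (S.cpt (c := 1 - τ) (by linarith)) (fun z hz => hz.1) ?_).2.1
  · simpa using this
  · exact ((hm.deriv S.hD).continuousOn.mul (S.chicont hχc)).add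
      (hm.continuousOn.mul ((S.chicont hχ').mul hVc))
  · exact (continuousOn_const.mul (S.chicont hχc)).add
      (hm.continuousOn.mul ((S.chicont hχ').mul (continuous_conj.comp_continuousOn hVc)))
  · intro z hz hzK
    rw [hs _ (not_le.mp fun hh => hzK ⟨hz, hh⟩).le]; simp

theorem GS.I1 (S : GS D z0 h) {κ1 κ0 : ℝ → ℝ} (hκ1 : Continuous κ1)
    (hκ : ∀ t, HasDerivAt κ0 (κ1 t) t) (hκ0 : ∀ t, t ≤ 1 → κ0 t = 0) (hκn : ∀ t, 0 ≤ κ0 t)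
    {a : ℂ → ℂ} {H : ℂ → ℝ} (ha : DifferentiableOn ℂ a D) (hH : HarmonicOnD H D) {ε : ℝ}
    (hε : 0 < ε) :
    IntegrableOn (fun z => wf a H z * Jf (a0 z0) h z * κ0 ((1 - wf (a0 z0) h z) / ε)) D ∧
    ∫ z in D, wf a H z * Jf (a0 z0) h z * κ0 ((1 - wf (a0 z0) h z) / ε) ≤
    ∫ z in D, (ε⁻¹ * κ1 ((1 - wf (a0 z0) h z) / ε)) * (wf a H z * ‖Vf (a0 z0) h z‖ ^ 2) := by
  have hκcont : Continuous κ0 := continuous_iff_continuousAt.mpr fun x => (hκ x).continuousAt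
  have hκ10 : ∀ t, t < 1 → κ1 t = 0 := by
    intro t ht
    refine (hκ t).unique ((hasDerivAt_const t 0).congr_of_eventuallyEq ?_)
    filter_upwards [Iio_mem_nhds ht] with y hy using hκ0 y (le_of_lt hy)
  set E := wf (a0 z0) h with hE
  let ω : ℝ → ℝ := fun x => - κ0 ((1 - x) / ε)
  let ω' : ℝ → ℝ := fun x => ε⁻¹ * κ1 ((1 - x) / ε)
  let ξ : ℝ → ℝ := fun x => ∫ t in x..1, κ0 ((1 - t) / ε)
  have hωd : ∀ x, HasDerivAt ω (ω' x) x := by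
    intro x
    have h1 : HasDerivAt (fun x : ℝ => (1 - x) / ε) (-1 / ε) x :=
      ((hasDerivAt_id x).const_sub 1).div_const ε
    have := ((hκ ((1 - x) / ε)).comp x h1).neg
    exact this.congr_deriv (by simp only [ω']; ring)
  have hω'c : Continuous ω' := by fun_prop
  have hωc : Continuous ω := by fun_prop
  have hξd : ∀ x, HasDerivAt ξ (ω x) x := by
    intro x
    have hc : Continuous fun t : ℝ => κ0 ((1 - t) / ε) := by fun_prop
    exact intervalIntegral.integral_hasDerivAt_left (hc.intervalIntegrable _ _)
      hc.aestronglyMeasurable.stronglyMeasurableAtFilter hc.continuousAt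
  have hξc : Continuous ξ := continuous_iff_continuousAt.mpr fun x => (hξd x).continuousAt
  have hle1 : ∀ x, 1 - ε ≤ x → (1 - x) / ε ≤ 1 := by
    intro x hx; rw [div_le_one hε]; linarith
  have hω0 : ∀ x, 1 - ε ≤ x → ω x = 0 := by
    intro x hx; simp only [ω]; rw [hκ0 _ (hle1 x hx), neg_zero]
  have hξ0 : ∀ x, 1 - ε ≤ x → ξ x = 0 := by
    intro x hx
    simp only [ξ]
    rw [intervalIntegral.integral_congr (g := fun _ => 0)]
    · simp
    · intro t ht
      apply hκ0 _ (hle1 t _)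
      have := ht.1
      exact le_trans (le_min hx (by linarith)) this
  have hξnn : ∀ x, x ≤ 1 → 0 ≤ ξ x := fun x hx => intervalIntegral.integral_nonneg hx fun t _ => hκn _
  have hω'0 : ∀ x, 1 - ε < x → ω' x = 0 := by
    intro x hx; simp only [ω']
    rw [hκ10 _ (by rw [div_lt_one hε]; linarith), mul_zero]
  -- differential identities
  have hac := a0_holo z0 D
  obtain ⟨X, hXc, hX⟩ := Vf_HasD S.hD hac S.hh
  obtain ⟨Y, hYc, hY⟩ := Vf_HasD S.hD ha hH
  have hVc := Vf_cont S.hD hac S.hh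
  have hVwc := Vf_cont S.hD ha hH
  have hwc := wf_cont ha hH
  have hJc := Jf_cont S.hD hac S.hh
  have hJwc := Jf_cont S.hD ha hH
  have cc : ∀ {f : ℂ → ℂ}, ContinuousOn f D → ContinuousOn (fun z => (starRingEnd ℂ) (f z)) D :=
    fun hf => continuous_conj.comp_continuousOn hf
  have cr : ∀ {f : ℂ → ℝ}, ContinuousOn f D → ContinuousOn (fun z => (f z : ℂ)) D :=
    fun hf => continuous_ofReal.comp_continuousOn hf
  have hφ1 : ∀ z ∈ D, HasD (fun z => (wf a H z : ℂ) * (((ω (E z) : ℝ) : ℂ) * Vf (a0 z0) h z)) _ _ z :=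
    fun z hz => (wf_HasD S.hD ha hH hz).mul ((S.chiHasD hωd z hz).mul (hX z hz))
  have hφ2 : ∀ z ∈ D, HasD (fun z => (starRingEnd ℂ) (Vf a H z) * ((ξ (E z) : ℝ) : ℂ)) _ _ z :=
    fun z hz => (hY z hz).conj.mul (S.chiHasD hξd z hz)
  have hK := S.cpt (c := 1 - ε) (by linarith)
  have hout : ∀ z ∈ D, z ∉ {z | z ∈ D ∧ wf (a0 z0) h z ≤ 1 - ε} → 1 - ε < E z :=
    fun z hz hzK => not_le.mp fun hh => hzK ⟨hz, hh⟩
  have c1 := S.chicont hωc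
  have c2 := S.chicont hω'c
  have c3 := S.chicont hξc
  obtain ⟨-, i1, -, j1⟩ := integral_HasD_zero S.hD hφ1
    (((hVwc).mul (c1.mul hVc)).add ((cr hwc).mul (((c2.mul hVc).mul hVc).add (c1.mul hXc))))
    (((cc hVwc).mul (c1.mul hVc)).add ((cr hwc).mul (((c2.mul (cc hVc)).mul hVc).add (c1.mul (cr hJc)))))
    hK (fun z hz => hz.1) (fun z hz hzK => by rw [hω0 _ (hout z hz hzK).le]; simp)
  obtain ⟨i2, -, j2, -⟩ := integral_HasD_zero S.hD hφ2
    (((cc (cr hJwc)).mul c3).add ((cc hVwc).mul (c1.mul hVc)))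
    (((cc hYc).mul c3).add ((cc hVwc).mul (c1.mul (cc hVc))))
    hK (fun z hz => hz.1) (fun z hz hzK => by rw [hξ0 _ (hout z hz hzK).le]; simp)
  have hEc := S.cont
  have k1 : IntegrableOn (fun z => wf a H z * Jf (a0 z0) h z * κ0 ((1 - E z) / ε)) D := by
    refine intOn_of_cptR S.hD ((hwc.mul hJc).mul ?_) hK (fun z hz => hz.1) ?_
    · exact hκcont.comp_continuousOn ((continuousOn_const.sub hEc).div_const ε)
    · intro z hz hzK
      rw [hκ0 _ (hle1 _ (hout z hz hzK).le), mul_zero]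
  have k2 : IntegrableOn (fun z => (ε⁻¹ * κ1 ((1 - E z) / ε)) * (wf a H z * ‖Vf (a0 z0) h z‖ ^ 2)) D := by
    refine intOn_of_cptR S.hD (ContinuousOn.mul ?_ (hwc.mul (hVc.norm.pow 2))) hK (fun z hz => hz.1) ?_
    · exact hω'c.comp_continuousOn hEc
    · intro z hz hzK
      have := hω'0 _ (hout z hz hzK)
      simp only [ω'] at this
      rw [this, zero_mul]
  refine ⟨k1, ?_⟩
  have e0 := integral_sub j1 j2
  rw [i1, i2, sub_zero] at e0
  have e1 : ∫ z in D, (((ε⁻¹ * κ1 ((1 - E z) / ε)) * (wf a H z * ‖Vf (a0 z0) h z‖ ^ 2) -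
      wf a H z * Jf (a0 z0) h z * κ0 ((1 - E z) / ε) - ξ (E z) * Jf a H z : ℝ) : ℂ) = 0 := by
    rw [← e0]
    refine setIntegral_congr_fun S.hD.measurableSet fun z hz => ?_
    have hv : ((‖Vf (a0 z0) h z‖ : ℝ) : ℂ) ^ 2 = (starRingEnd ℂ) (Vf (a0 z0) h z) * Vf (a0 z0) h z :=
      (conj_mul' _).symm
    simp only [ω, ω', ← hE, conj_ofReal]
    push_cast
    rw [hv]
    ring
  rw [integral_complex_ofReal] at e1
  have e2 : ∫ z in D, ((ε⁻¹ * κ1 ((1 - E z) / ε)) * (wf a H z * ‖Vf (a0 z0) h z‖ ^ 2) -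
      wf a H z * Jf (a0 z0) h z * κ0 ((1 - E z) / ε) - ξ (E z) * Jf a H z) = 0 := by
    exact_mod_cast e1
  have k3 : IntegrableOn (fun z => ξ (E z) * Jf a H z) D := by
    refine intOn_of_cptR S.hD ((hξc.comp_continuousOn hEc).mul hJwc) hK (fun z hz => hz.1) ?_
    intro z hz hzK
    rw [hξ0 _ (hout z hz hzK).le, zero_mul]
  have k21 : IntegrableOn (fun z => (ε⁻¹ * κ1 ((1 - E z) / ε)) * (wf a H z * ‖Vf (a0 z0) h z‖ ^ 2) -
      wf a H z * Jf (a0 z0) h z * κ0 ((1 - E z) / ε)) D := k2.sub k1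
  rw [integral_sub k21 k3, integral_sub k2 k1] at e2
  have : 0 ≤ ∫ z in D, ξ (E z) * Jf a H z :=
    setIntegral_nonneg S.hD.measurableSet fun z hz =>
      mul_nonneg (hξnn _ (S.lt z hz).le) (Jf_nonneg z)
  linarith

end
end WS


namespace WS
open Topology

theorem HasD_real {g : ℂ → ℝ} {z : ℂ} (hg : DifferentiableAt ℝ g z) :
    HasD (fun z => (g z : ℂ)) (hdz g z / 2) ((starRingEnd ℂ) (hdz g z) / 2) z := by
  have h3 := ofRealCLM.hasFDerivAt.comp z hg.hasFDerivAt
  refine HasFDerivAt.congr_fderiv h3 ?_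
  ext x
  have hx := real_lin_apply (fderiv ℝ g z) x
  apply Complex.ext <;> simp [hdz] <;> linarith

structure BS (D : Set ℂ) (z0 : ℂ) (h : ℂ → ℝ) (U : Set ℂ) (g : ℂ → ℝ) (ν : ℂ → ℂ) : Prop where
  S : GS D z0 h
  hU : IsOpen U
  hfU : frontier D ⊆ U
  hg : ContDiffOn ℝ 1 g U
  g0 : ∀ z ∈ frontier D, g z = 0
  hgE : ∀ z ∈ U ∩ D, wf (a0 z0) h z = Real.exp (2 * g z)
  hν : IsOutwardUnitNormal D ν
  hpos : ∀ z ∈ frontier D, 0 < fderiv ℝ g z (ν z)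

section
variable {D : Set ℂ} {z0 : ℂ} {h : ℂ → ℝ} {U : Set ℂ} {g : ℂ → ℝ} {ν : ℂ → ℂ}

theorem BS.coll (T : BS D z0 h U g ν) : Coll D U g ν where
  hD := T.S.hD
  hb := T.S.hb
  hU := T.hU
  hfU := T.hfU
  hr := T.hg
  h0 := T.g0
  hneg := by
    intro z hz
    have h1 := T.hgE z hz
    have h2 := T.S.lt z hz.2
    rw [h1, Real.exp_lt_one_iff] at h2
    linarith
  hν := T.hν
  hpos := T.hpos

theorem BS.gdiff (T : BS D z0 h U g ν) {z : ℂ} (hz : z ∈ U) : DifferentiableAt ℝ g z :=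
  (T.hg.differentiableOn one_ne_zero).differentiableAt (T.hU.mem_nhds hz)

theorem BS.fdr (T : BS D z0 h U g ν) {z : ℂ} (hz : z ∈ frontier D) :
    fderiv ℝ (fun z => Real.exp (2 * g z) - 1) z (ν z) = 2 * fderiv ℝ g z (ν z) := by
  have h1 := (((T.gdiff (T.hfU hz)).hasFDerivAt.const_mul 2).exp).sub_const 1
  rw [h1.fderiv, T.g0 z hz]
  simp

theorem BS.collr (T : BS D z0 h U g ν) : Coll D U (fun z => Real.exp (2 * g z) - 1) ν where
  hD := T.S.hD
  hb := T.S.hb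
  hU := T.hU
  hfU := T.hfU
  hr := ((contDiffOn_const.mul T.hg).exp).sub contDiffOn_const
  h0 := by intro z hz; simp [T.g0 z hz]
  hneg := by
    intro z hz
    have := T.S.lt z hz.2
    rw [T.hgE z hz] at this
    linarith
  hν := T.hν
  hpos := by
    intro z hz
    rw [T.fdr hz]
    linarith [T.hpos z hz]

theorem BS.clD (T : BS D z0 h U g ν) {z : ℂ} (hz : z ∈ closure D) : z ∈ D ∨ z ∈ frontier D := by
  by_cases hzD : z ∈ D
  · exact Or.inl hzD
  · exact Or.inr ⟨hz, by rwa [T.S.hD.interior_eq]⟩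

theorem BS.fnD (T : BS D z0 h U g ν) {z : ℂ} (hz : z ∈ frontier D) : z ∉ D := by
  have := hz.2
  rwa [T.S.hD.interior_eq] at this

theorem BS.Veq (T : BS D z0 h U g ν) {z : ℂ} (hz : z ∈ U ∩ D) :
    Vf (a0 z0) h z = (Real.exp (2 * g z) : ℝ) * hdz g z := by
  have h1 := wf_HasD T.S.hD (a0_holo z0 D) T.S.hh hz.2
  have h2 : HasDerivAt (fun x : ℝ => Real.exp (2 * x)) (Real.exp (2 * g z) * 2) (g z) := by
    have := ((hasDerivAt_id (g z)).const_mul 2).exp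
    simpa using this
  have h3 := (HasD_real (T.gdiff hz.1)).real_comp h2
  have h4 := h3.congr (g := fun z => (wf (a0 z0) h z : ℂ)) (by
    filter_upwards [(T.hU.inter T.S.hD).mem_nhds hz] with y hy
    rw [T.hgE y hy])
  rw [(h1.unique h4).1]
  push_cast; ring

theorem BS.hdzb (T : BS D z0 h U g ν) {z : ℂ} (hz : z ∈ frontier D) :
    (starRingEnd ℂ) (hdz g z) = (fderiv ℝ g z (ν z) : ℝ) * ν z := by
  have h1 := (fderiv_sq _ (T.hν z hz).1 (T.coll.ortho z hz) (T.hpos z hz)).2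
  rw [hdz, h1 1, h1 I]
  apply Complex.ext <;> simp <;> ring

theorem BS.hdzc (T : BS D z0 h U g ν) : ContinuousOn (hdz g) U := by
  have hf : ContinuousOn (fderiv ℝ g) U := T.hg.continuousOn_fderiv_of_isOpen T.hU le_rfl
  exact (continuous_ofReal.comp_continuousOn (hf.clm_apply continuousOn_const)).sub
    (continuousOn_const.mul (continuous_ofReal.comp_continuousOn (hf.clm_apply continuousOn_const)))

theorem BS.nuc (T : BS D z0 h U g ν) : ContinuousOn ν (frontier D) := by
  have h1 : ContinuousOn (fun z => (starRingEnd ℂ) (hdz g z) / ((fderiv ℝ g z (ν z) : ℝ) : ℂ))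
      (frontier D) :=
    (continuous_conj.comp_continuousOn (T.hdzc.mono T.hfU)).div
      (continuous_ofReal.comp_continuousOn T.coll.ncont)
      (fun z hz => ofReal_ne_zero.mpr (T.hpos z hz).ne')
  refine h1.congr fun z hz => ?_
  have := ofReal_ne_zero.mpr (T.hpos z hz).ne'
  simp only [T.hdzb hz]
  field_simp

theorem BS.collar (T : BS D z0 h U g ν) {κ : ℝ → ℝ} (hκ : Continuous κ)
    (hκs : ∀ x, x ∉ Icc (1:ℝ) 2 → κ x = 0) (hκ1 : ∫ t, κ t = 1) {U' : Set ℂ} (hU' : IsOpen U')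
    (hUU : U' ⊆ U) (hfU' : frontier D ⊆ U') {φ : ℂ → ℂ} (hφ : ContinuousOn φ (closure D ∩ U')) :
    Tendsto (fun ε : ℝ => ∫ z in D, ((ε⁻¹ * κ ((1 - wf (a0 z0) h z) / ε) : ℝ) : ℂ) * φ z) (𝓝[>] 0)
      (𝓝 (∫ z in frontier D, φ z / (2 * ((fderiv ℝ g z (ν z) : ℝ) : ℂ)) ∂μH[1])) := by
  have := global_collar (T.collr.mono hU' hUU hfU') hκ hκs (R := fun z => 1 - wf (a0 z0) h z)
    (continuousOn_const.sub T.S.cont) (fun z hz => by linarith [T.S.lt z hz])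
    (fun z hz => by rw [T.hgE z ⟨hUU hz.1, hz.2⟩]; ring) hφ
  rw [hκ1, ofReal_one, one_mul] at this
  convert this using 2
  refine setIntegral_congr_fun isClosed_frontier.measurableSet fun z hz => ?_
  rw [T.fdr hz]; push_cast; rfl

open Classical in
/-- extension of `Vf` to the boundary -/
noncomputable def Vh (D : Set ℂ) (z0 : ℂ) (h g : ℂ → ℝ) (z : ℂ) : ℂ :=
  if z ∈ D then Vf (a0 z0) h z else hdz g z

theorem BS.Vhc (T : BS D z0 h U g ν) : ContinuousOn (Vh D z0 h g) (closure D ∩ U) := by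
  have h1 : ContinuousOn (fun z => ((Real.exp (2 * g z) : ℝ) : ℂ) * hdz g z) (closure D ∩ U) :=
    ((continuous_ofReal.comp_continuousOn (Real.continuous_exp.comp_continuousOn
      (continuousOn_const.mul T.hg.continuousOn))).mul T.hdzc).mono inter_subset_right
  refine h1.congr fun z hz => ?_
  rcases T.clD hz.1 with hzD | hzf
  · rw [Vh, if_pos hzD, T.Veq ⟨hz.2, hzD⟩]
  · rw [Vh, if_neg (T.fnD hzf)]; simp [T.g0 z hzf]

/-- derivative facts for `χ(x)=κ0((1-x)/ε)` -/
theorem chi_deriv {κ1 κ0 : ℝ → ℝ} (hκ : ∀ t, HasDerivAt κ0 (κ1 t) t) (ε : ℝ) (x : ℝ) :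
    HasDerivAt (fun x => κ0 ((1 - x) / ε)) (-(ε⁻¹ * κ1 ((1 - x) / ε))) x := by
  have h1 : HasDerivAt (fun x : ℝ => (1 - x) / ε) (-1 / ε) x :=
    ((hasDerivAt_id x).const_sub 1).div_const ε
  have := ((hκ ((1 - x) / ε)).comp x h1)
  exact this.congr_deriv (by ring)

theorem BS.cauchyE (T : BS D z0 h U g ν) {κ1 κ0 : ℝ → ℝ} (hc : Continuous κ1)
    (hκ : ∀ t, HasDerivAt κ0 (κ1 t) t)
    (h0 : ∀ t, t ≤ 1 → κ0 t = 0) (h1 : ∀ t, 2 ≤ t → κ0 t = 1) {m : ℂ → ℂ}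
    (hm : DifferentiableOn ℂ m D) {ζ : ℂ} (hζ : ζ ∈ D) {ε : ℝ} (hε : 0 < ε)
    (hζε : wf (a0 z0) h ζ < 1 - 2 * ε) :
    ∫ z in D, ((ε⁻¹ * κ1 ((1 - wf (a0 z0) h z) / ε) : ℝ) : ℂ) * (m z / (z - ζ) *
        (starRingEnd ℂ) (Vf (a0 z0) h z)) = Real.pi * m ζ ∧
    IntegrableOn (fun z => ((ε⁻¹ * κ1 ((1 - wf (a0 z0) h z) / ε) : ℝ) : ℂ) * (m z / (z - ζ) *
        (starRingEnd ℂ) (Vf (a0 z0) h z))) D := by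
  have := T.S.I2 (chi_deriv hκ ε) (by fun_prop) hε (fun x hx => h0 _ (by
      rw [div_le_one hε]; linarith)) hm hζ hζε (c := 1) (fun x hx => h1 _ (by
      rw [le_div_iff₀ hε]; linarith))
  have e : (fun z => ((ε⁻¹ * κ1 ((1 - wf (a0 z0) h z) / ε) : ℝ) : ℂ) * (m z / (z - ζ) *
        (starRingEnd ℂ) (Vf (a0 z0) h z))) = fun z => -(m z / (z - ζ) *
        (((-(ε⁻¹ * κ1 ((1 - wf (a0 z0) h z) / ε)) : ℝ) : ℂ) * (starRingEnd ℂ) (Vf (a0 z0) h z))) := by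
    funext z; push_cast; ring
  rw [e]
  refine ⟨?_, this.2.neg⟩
  rw [integral_neg, this.1]; push_cast; ring

theorem BS.cauchy (T : BS D z0 h U g ν) {m : ℂ → ℂ} (hm : DifferentiableOn ℂ m D)
    (hmc : ContinuousOn m (closure D)) {ζ : ℂ} (hζ : ζ ∈ D) :
    ∫ z in frontier D, m z * ν z / (z - ζ) ∂μH[1] = 2 * Real.pi * m ζ := by
  obtain ⟨κ1, κ0, hc, hn, hs, hi, hκ, h0, h1, -, -⟩ := bump_exists
  have hUo : IsOpen (U \ {ζ}) := T.hU.sdiff isClosed_singleton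
  have hfr : frontier D ⊆ U \ {ζ} := fun z hz => ⟨T.hfU hz, fun he => T.fnD hz (he ▸ hζ)⟩
  have hφ : ContinuousOn (fun z => m z / (z - ζ) * (starRingEnd ℂ) (Vh D z0 h g z))
      (closure D ∩ (U \ {ζ})) := by
    refine ContinuousOn.mul ((hmc.mono inter_subset_left).div
      (continuousOn_id.sub continuousOn_const) fun z hz => ?_) ?_
    · exact sub_ne_zero.mpr hz.2.2
    · exact continuous_conj.comp_continuousOn (T.Vhc.mono fun z hz => ⟨hz.1, hz.2.1⟩)
  have h2 := T.collar hc hs hi hUo sdiff_subset hfr hφ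
  have h3 : ∀ᶠ ε : ℝ in 𝓝[>] 0, ∫ z in D, ((ε⁻¹ * κ1 ((1 - wf (a0 z0) h z) / ε) : ℝ) : ℂ) *
      (m z / (z - ζ) * (starRingEnd ℂ) (Vh D z0 h g z)) = Real.pi * m ζ := by
    have hlt := T.S.lt ζ hζ
    have : Iio ((1 - wf (a0 z0) h ζ) / 2) ∈ 𝓝[>] (0:ℝ) :=
      mem_nhdsWithin_of_mem_nhds (Iio_mem_nhds (by linarith))
    filter_upwards [this, self_mem_nhdsWithin] with ε hε1 hε0
    have hε1 : ε < (1 - wf (a0 z0) h ζ) / 2 := hε1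
    rw [← (T.cauchyE hc hκ h0 h1 hm hζ hε0 (by linarith)).1]
    refine setIntegral_congr_fun T.S.hD.measurableSet fun z hz => ?_
    simp only [Vh, if_pos hz]
  have h4 := tendsto_nhds_unique h2 (tendsto_const_nhds.congr' (h3.mono fun _ h => h.symm))
  have e : ∫ z in frontier D, m z * ν z / (z - ζ) ∂μH[1] =
      ∫ z in frontier D, 2 * (m z / (z - ζ) * (starRingEnd ℂ) (Vh D z0 h g z) /
        (2 * ((fderiv ℝ g z (ν z) : ℝ) : ℂ))) ∂μH[1] := by
    refine setIntegral_congr_fun isClosed_frontier.measurableSet fun z hz => ?_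
    have := ofReal_ne_zero.mpr (T.hpos z hz).ne'
    have h6 : z - ζ ≠ 0 := sub_ne_zero.mpr (hfr hz).2
    simp only [Vh, if_neg (T.fnD hz), T.hdzb hz]
    field_simp
  rw [e, integral_const_mul, h4]; ring

theorem BS.cauchy0 (T : BS D z0 h U g ν) {m : ℂ → ℂ} (hm : DifferentiableOn ℂ m D)
    (hmc : ContinuousOn m (closure D)) :
    ∫ z in frontier D, m z * ν z ∂μH[1] = 0 := by
  have hd := T.S.hz
  have h1 := T.cauchy (m := fun z => m z * (z - z0)) (hm.mul (a0_holo z0 D))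
    (hmc.mul (continuousOn_id.sub continuousOn_const)) hd
  rw [sub_self, mul_zero, mul_zero] at h1
  rw [← h1]
  refine setIntegral_congr_fun isClosed_frontier.measurableSet fun z hz => ?_
  have h6 : z - z0 ≠ 0 := sub_ne_zero.mpr fun he => T.fnD hz (he ▸ hd)
  field_simp

end
end WS


namespace WS
open Topology

noncomputable def Ci (D : Set ℂ) (ν q : ℂ → ℂ) (ζ : ℂ) : ℂ :=
  ((2 * Real.pi : ℝ) : ℂ)⁻¹ * ∫ z in frontier D, q z * ν z / (z - ζ) ∂μH[1]

theorem Coll.bintR {D U : Set ℂ} {r : ℂ → ℝ} {ν : ℂ → ℂ} (h : Coll D U r ν) {φ : ℂ → ℝ}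
    (hφ : ContinuousOn φ (frontier D)) : IntegrableOn φ (frontier D) μH[1] := by
  have := (h.bint (continuous_ofReal.comp_continuousOn hφ)).re
  exact this

theorem kernel_est {A B t s c : ℝ} (hs : 0 < s) (hc : 0 < c) (hA : s ≤ A) (hB : c * s ≤ B)
    (htA : t ≤ A + s) (htB : t ≤ B + s) (ht : 0 ≤ t) :
    2 * s / (A * B) ≤ 2 * (2 + 3 / c) * (s / (s ^ 2 + t ^ 2)) := by
  have hA0 : 0 < A := hs.trans_le hA
  have hB0 : 0 < B := (mul_pos hc hs).trans_le hB
  have h1 : s ≤ B / c := by rw [le_div_iff₀ hc]; linarith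
  have h2 : s ^ 2 ≤ A * (B / c) := by nlinarith
  have h3 : t ^ 2 ≤ (2 * A) * (B + B / c) := by
    have : t ≤ 2 * A := by linarith
    have : t ≤ B + B / c := by linarith
    nlinarith
  have h4 : s ^ 2 + t ^ 2 ≤ (2 + 3 / c) * (A * B) := by
    calc _ ≤ A * (B / c) + (2 * A) * (B + B / c) := by linarith
      _ = _ := by field_simp; ring
  have h5 : 0 < s ^ 2 + t ^ 2 := by positivity
  rw [div_le_iff₀ (by positivity)]
  have : 2 * (2 + 3 / c) * (s / (s ^ 2 + t ^ 2)) * (A * B) =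
      2 * s * (((2 + 3 / c) * (A * B)) / (s ^ 2 + t ^ 2)) := by field_simp
  rw [this]
  have h6 : 1 ≤ ((2 + 3 / c) * (A * B)) / (s ^ 2 + t ^ 2) := by rwa [le_div_iff₀ h5, one_mul]
  nlinarith

section
variable {D : Set ℂ} {z0 : ℂ} {h : ℂ → ℝ} {U : Set ℂ} {g : ℂ → ℝ} {ν : ℂ → ℂ}

theorem BS.Ci_holo (T : BS D z0 h U g ν) {q : ℂ → ℂ} (hq : ContinuousOn q (frontier D)) :
    DifferentiableOn ℂ (Ci D ν q) D := by
  intro ζ hζ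
  obtain ⟨d, hd, hb⟩ := Metric.isOpen_iff.mp T.S.hD ζ hζ
  have hqν := hq.mul T.nuc
  obtain ⟨Q, hQ⟩ := T.coll.cpt.exists_bound_of_continuousOn hqν
  have hms : MeasurableSet (frontier D) := isClosed_frontier.measurableSet
  have hdist : ∀ z ∈ frontier D, ∀ w ∈ ball ζ (d / 2), d / 2 ≤ ‖z - w‖ := by
    intro z hz w hw
    by_contra hcon
    refine T.fnD hz (hb ?_)
    rw [mem_ball] at hw ⊢
    rw [← dist_eq_norm] at hcon
    linarith [dist_triangle z w ζ]
  have hne : ∀ z ∈ frontier D, ∀ w ∈ ball ζ (d / 2), z - w ≠ 0 := by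
    intro z hz w hw he
    have := hdist z hz w hw
    rw [he, norm_zero] at this; linarith
  have hIntg : ∀ w ∈ ball ζ (d / 2), IntegrableOn (fun z => q z * ν z / (z - w)) (frontier D) μH[1] :=
    fun w hw => T.coll.bint (hqν.div (continuousOn_id.sub continuousOn_const) fun z hz => hne z hz w hw)
  have hfin : IsFiniteMeasure ((μH[1] : Measure ℂ).restrict (frontier D)) :=
    ⟨by rw [Measure.restrict_apply_univ]; exact T.coll.finite⟩
  have key := hasDerivAt_integral_of_dominated_loc_of_deriv_le (μ := (μH[1] : Measure ℂ).restrict (frontier D))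
    (F := fun w z => q z * ν z / (z - w)) (F' := fun w z => q z * ν z / (z - w) ^ 2)
    (bound := fun _ => Q / (d / 2) ^ 2) (x₀ := ζ) (ball_mem_nhds ζ (half_pos hd))
    (eventually_of_mem (ball_mem_nhds ζ (half_pos hd)) fun w hw => (hIntg w hw).aestronglyMeasurable)
    (hIntg ζ (mem_ball_self (half_pos hd)))
    (ContinuousOn.aestronglyMeasurable (hqν.div ((continuousOn_id.sub continuousOn_const).pow 2)
      fun z hz => pow_ne_zero 2 (hne z hz ζ (mem_ball_self (half_pos hd)))) hms)
    ?_ (integrable_const _) ?_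
  · exact ((key.2.differentiableAt).const_mul _).differentiableWithinAt
  · refine (ae_restrict_iff' hms).mpr (Eventually.of_forall fun z hz w hw => ?_)
    rw [norm_div, norm_pow]
    have h1 := hdist z hz w hw
    have h2 := hQ z hz
    have h3 : 0 ≤ Q := (norm_nonneg _).trans h2
    gcongr
    exact h2
  · refine (ae_restrict_iff' hms).mpr (Eventually.of_forall fun z hz w hw => ?_)
    have h1 : HasDerivAt (fun w : ℂ => z - w) (-1) w := (hasDerivAt_id w).const_sub z
    have h2 := (hasDerivAt_const w (q z * ν z)).div h1 (hne z hz w hw)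
    exact h2.congr_deriv (by simp)

set_option maxHeartbeats 2000000 in
theorem BS.plemelj (T : BS D z0 h U g ν) {q : ℂ → ℂ} (hq : ContinuousOn q (frontier D)) {p : ℂ}
    (hp : p ∈ frontier D) : ∃ ζs : ℂ → ℂ, Tendsto ζs (𝓝[D] p) (𝓝 p) ∧
    (∀ᶠ ζ in 𝓝[D] p, ζs ζ ∉ closure D) ∧
    Tendsto (fun ζ => Ci D ν q ζ - Ci D ν q (ζs ζ)) (𝓝[D] p) (𝓝 (q p)) := by
  have hms : MeasurableSet (frontier D) := isClosed_frontier.measurableSet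
  choose P hPf hPd using fun ζ : ℂ => T.coll.cpt.exists_infDist_eq_dist ⟨p, hp⟩ ζ
  let s : ℂ → ℝ := fun ζ => dist ζ (P ζ)
  have hsmin : ∀ ζ, ∀ z ∈ frontier D, s ζ ≤ dist ζ z := fun ζ z hz => by
    simp only [s]; rw [← hPd ζ]; exact infDist_le_dist_of_mem hz
  have hid : Tendsto (fun ζ : ℂ => dist ζ p) (𝓝[D] p) (𝓝 0) := by
    have : Tendsto (fun ζ : ℂ => dist ζ p) (𝓝 p) (𝓝 (dist p p)) :=
      (continuous_id.dist continuous_const).tendsto p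
    rw [dist_self] at this
    exact this.mono_left nhdsWithin_le_nhds
  have hs0 : Tendsto s (𝓝[D] p) (𝓝 0) :=
    squeeze_zero (fun _ => dist_nonneg) (fun ζ => hsmin ζ p hp) hid
  have hPp : Tendsto P (𝓝[D] p) (𝓝 p) := by
    rw [tendsto_iff_dist_tendsto_zero]
    refine squeeze_zero (fun _ => dist_nonneg) (fun ζ => ?_) (by simpa using hs0.add hid)
    have := dist_triangle (P ζ) ζ p
    rw [dist_comm (P ζ) ζ] at this
    exact this
  have hPp' : Tendsto P (𝓝[D] p) (𝓝[frontier D] p) :=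
    tendsto_nhdsWithin_iff.mpr ⟨hPp, Eventually.of_forall hPf⟩
  have hνP : Tendsto (fun ζ => ν (P ζ)) (𝓝[D] p) (𝓝 (ν p)) := (T.nuc p hp).tendsto.comp hPp'
  let ζs : ℂ → ℂ := fun ζ => P ζ + (s ζ : ℂ) * ν (P ζ)
  have hζs : Tendsto ζs (𝓝[D] p) (𝓝 p) := by
    have := hPp.add (((continuous_ofReal.tendsto 0).comp hs0).mul hνP)
    simpa using this
  have hspos : ∀ ζ ∈ D, 0 < s ζ := fun ζ hζ => dist_pos.mpr fun he => T.fnD (hPf ζ) (he ▸ hζ)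
  -- strict derivative
  have hcd : ContDiffAt ℝ 1 g p := T.hg.contDiffAt (T.hU.mem_nhds (T.hfU hp))
  have hst : HasStrictFDerivAt g (fderiv ℝ g p) p := hcd.hasStrictFDerivAt one_ne_zero
  set l := fderiv ℝ g p with hl
  have hm : 0 < l (ν p) := T.hpos p hp
  set m := l (ν p) with hmdef
  have hlo := hst.isLittleO.bound (show 0 < m / 4 by linarith)
  have hlo1 : ∀ᶠ ζ in 𝓝[D] p, ‖g (ζs ζ) - g (P ζ) - l (ζs ζ - P ζ)‖ ≤ m / 4 * ‖ζs ζ - P ζ‖ :=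
    (hζs.prodMk_nhds hPp).eventually hlo
  have hlν : ∀ᶠ ζ in 𝓝[D] p, 3 * m / 4 < l (ν (P ζ)) := by
    have := (l.continuous.tendsto (ν p)).comp hνP
    exact this.eventually (Ioi_mem_nhds (by rw [← hmdef]; linarith))
  have hsd : ∀ ζ, ‖ζs ζ - P ζ‖ = s ζ := by
    intro ζ
    simp only [ζs, add_sub_cancel_left, norm_mul, norm_real, (T.hν _ (hPf ζ)).1, mul_one]
    exact abs_of_nonneg dist_nonneg
  have hgl : ∀ᶠ ζ in 𝓝[D] p, m / 2 * s ζ ≤ g (ζs ζ) := by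
    filter_upwards [hlo1, hlν, self_mem_nhdsWithin] with ζ h1 h2 h3
    rw [hsd, T.g0 _ (hPf ζ), sub_zero, Real.norm_eq_abs] at h1
    have h4 : l (ζs ζ - P ζ) = s ζ * l (ν (P ζ)) := by
      have : ζs ζ - P ζ = s ζ • ν (P ζ) := by simp [ζs]
      rw [this, map_smul, smul_eq_mul]
    rw [h4] at h1
    have h5 := (abs_le.mp h1).1
    have h6 := hspos ζ h3
    nlinarith
  have hout : ∀ᶠ ζ in 𝓝[D] p, ζs ζ ∉ closure D := by
    filter_upwards [hgl, self_mem_nhdsWithin, hζs.eventually (T.hU.mem_nhds (T.hfU hp))] with ζ h1 h2 h3 h4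
    have h5 : 0 < g (ζs ζ) := lt_of_lt_of_le (mul_pos (by linarith) (hspos ζ h2)) h1
    rcases T.clD h4 with h6 | h6
    · exact absurd (T.coll.hneg _ ⟨h3, h6⟩) (not_lt.mpr h5.le)
    · rw [T.g0 _ h6] at h5; exact lt_irrefl _ h5
  obtain ⟨r0, hr0, hball⟩ : ∃ r0 > 0, ∀ x ∈ ball p r0, ∀ y ∈ ball p r0,
      |g x - g y| ≤ (‖l‖ + m / 4) * ‖x - y‖ := by
    rw [nhds_prod_eq] at hlo
    obtain ⟨t1, ht1, ht2⟩ := (eventually_prod_self_iff' (r := fun x : ℂ × ℂ =>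
      ‖g x.1 - g x.2 - l (x.1 - x.2)‖ ≤ m / 4 * ‖x.1 - x.2‖)).mp hlo
    obtain ⟨r0, hr0, hrb⟩ := Metric.mem_nhds_iff.mp ht1
    refine ⟨r0, hr0, fun x hx y hy => ?_⟩
    have h1 := ht2 x (hrb hx) y (hrb hy)
    have h2 := l.le_opNorm (x - y)
    have h3 : |g x - g y| ≤ ‖g x - g y - l (x - y)‖ + ‖l (x - y)‖ := by
      have := norm_add_le (g x - g y - l (x - y)) (l (x - y))
      rwa [sub_add_cancel, Real.norm_eq_abs] at this
    simp only at h1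
    linarith
  set Λ := ‖l‖ + m / 4 with hΛ
  have hΛ0 : 0 < Λ := by have := norm_nonneg l; linarith
  let c := min 1 (m / (2 * Λ))
  have hc0 : 0 < c := lt_min one_pos (by positivity)
  have hdst : ∀ᶠ ζ in 𝓝[D] p, ∀ z ∈ frontier D, c * s ζ ≤ ‖z - ζs ζ‖ := by
    filter_upwards [hgl, self_mem_nhdsWithin, hζs.eventually (ball_mem_nhds p (half_pos hr0)),
      hs0.eventually (Iio_mem_nhds (half_pos hr0))] with ζ h1 h2 h3 h4 z hz
    have h4 : s ζ < r0 / 2 := h4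
    have h5 := hspos ζ h2
    by_cases hzb : z ∈ ball p r0
    · have h6 := hball _ (ball_subset_ball (by linarith) h3) z hzb
      rw [T.g0 z hz, sub_zero, norm_sub_rev] at h6
      have h7 := (le_abs_self _).trans h6
      have h8 : c ≤ m / (2 * Λ) := min_le_right _ _
      have h9 : m / (2 * Λ) * s ζ ≤ ‖z - ζs ζ‖ := by
        rw [div_mul_eq_mul_div, div_le_iff₀ (by positivity)]; linarith
      exact (mul_le_mul_of_nonneg_right h8 h5.le).trans h9
    · have h6 : r0 ≤ dist z p := not_lt.mp hzb
      have h7 := dist_triangle z (ζs ζ) p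
      have h8 : dist (ζs ζ) p < r0 / 2 := h3
      rw [dist_eq_norm z (ζs ζ)] at h7
      have h9 : c ≤ 1 := min_le_left _ _
      nlinarith
  -- the estimate
  have hqν := hq.mul T.nuc
  obtain ⟨Q, hQ⟩ := T.coll.cpt.exists_bound_of_continuousOn hq
  have hQ0 : 0 ≤ Q := (norm_nonneg _).trans (hQ p hp)
  obtain ⟨M, hM, hMb⟩ := T.coll.poisson
  have hfin : IsFiniteMeasure ((μH[1] : Measure ℂ).restrict (frontier D)) :=
    ⟨by rw [Measure.restrict_apply_univ]; exact T.coll.finite⟩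
  set Cc := 2 * (2 + 3 / c) with hCc
  have hCc0 : 0 < Cc := by positivity
  set H1 := ((μH[1] : Measure ℂ).restrict (frontier D)).real univ with hH1
  refine ⟨ζs, hζs, hout, ?_⟩
  have hest : ∀ η > 0, ∃ B : ℝ, ∀ᶠ ζ in 𝓝[D] p, ‖Ci D ν q ζ - Ci D ν q (ζs ζ) - q p‖ ≤
      (2 * Real.pi)⁻¹ * (Cc * η * M.toReal + B * s ζ * H1) := by
    intro η hη
    obtain ⟨r1, hr1, hr1b⟩ : ∃ r1 > 0, ∀ z ∈ frontier D, dist z p < r1 → ‖q z - q p‖ ≤ η := by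
      obtain ⟨r1, hr1, h2⟩ := Metric.continuousOn_iff.mp hq p hp η hη
      exact ⟨r1, hr1, fun z hz hzp => by rw [← dist_eq_norm]; exact (h2 z hz hzp).le⟩
    refine ⟨Cc * (2 * Q) * (4 / r1 ^ 2), ?_⟩
    filter_upwards [hout, hdst, self_mem_nhdsWithin, hPp.eventually (ball_mem_nhds p (half_pos hr1))]
      with ζ ho hdz' hζD hPb
    have hs := hspos ζ hζD
    have hne1 : ∀ z ∈ frontier D, z - ζ ≠ 0 := fun z hz => sub_ne_zero.mpr fun he => T.fnD hz (he ▸ hζD)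
    have hne2 : ∀ z ∈ frontier D, z - ζs ζ ≠ 0 := fun z hz =>
      sub_ne_zero.mpr fun he => ho (he ▸ frontier_subset_closure hz)
    have i1 : ∀ {f : ℂ → ℂ}, ContinuousOn f (frontier D) →
        IntegrableOn (fun z => f z * ν z / (z - ζ)) (frontier D) μH[1] := fun hf =>
      T.coll.bint ((hf.mul T.nuc).div (continuousOn_id.sub continuousOn_const) hne1)
    have i2 : ∀ {f : ℂ → ℂ}, ContinuousOn f (frontier D) →
        IntegrableOn (fun z => f z * ν z / (z - ζs ζ)) (frontier D) μH[1] := fun hf =>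
      T.coll.bint ((hf.mul T.nuc).div (continuousOn_id.sub continuousOn_const) hne2)
    have c1 : ∫ z in frontier D, q p * ν z / (z - ζ) ∂μH[1] = 2 * Real.pi * q p :=
      T.cauchy (m := fun _ => q p) (differentiableOn_const _) continuousOn_const hζD
    have c2 : ∫ z in frontier D, q p * ν z / (z - ζs ζ) ∂μH[1] = 0 := by
      have hcl : ∀ z ∈ closure D, z - ζs ζ ≠ 0 := fun z hz => sub_ne_zero.mpr fun he => ho (he ▸ hz)
      have := T.cauchy0 (m := fun z => q p / (z - ζs ζ))
        ((differentiableOn_const _).div (differentiableOn_id.sub_const _)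
          fun z hz => hcl z (subset_closure hz))
        (continuousOn_const.div (continuousOn_id.sub continuousOn_const) hcl)
      rw [← this]
      refine integral_congr_ae (Eventually.of_forall fun z => ?_)
      simp only; ring
    have hpi : (Real.pi : ℂ) ≠ 0 := ofReal_ne_zero.mpr Real.pi_ne_zero
    have e1 : Ci D ν q ζ - Ci D ν q (ζs ζ) - q p = ((2 * Real.pi : ℝ) : ℂ)⁻¹ *
        ∫ z in frontier D, (q z - q p) * ν z * (1 / (z - ζ) - 1 / (z - ζs ζ)) ∂μH[1] := by
      have e2 : ∫ z in frontier D, (q z - q p) * ν z * (1 / (z - ζ) - 1 / (z - ζs ζ)) ∂μH[1] =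
          ∫ z in frontier D, ((q z * ν z / (z - ζ) - q z * ν z / (z - ζs ζ)) -
            (q p * ν z / (z - ζ) - q p * ν z / (z - ζs ζ))) ∂μH[1] := by
        refine integral_congr_ae (Eventually.of_forall fun z => ?_)
        simp only; ring
      have i3 : IntegrableOn (fun z => q z * ν z / (z - ζ) - q z * ν z / (z - ζs ζ)) (frontier D) μH[1] :=
        (i1 hq).sub (i2 hq)
      have i4 : IntegrableOn (fun z => q p * ν z / (z - ζ) - q p * ν z / (z - ζs ζ)) (frontier D) μH[1] :=
        (i1 continuousOn_const).sub (i2 continuousOn_const)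
      rw [e2, integral_sub i3 i4, integral_sub (i1 hq) (i2 hq),
        integral_sub (i1 continuousOn_const) (i2 continuousOn_const), c1, c2]
      simp only [Ci]
      push_cast
      field_simp
      ring
    rw [e1, norm_mul]
    have e3 : ‖((2 * Real.pi : ℝ) : ℂ)⁻¹‖ = (2 * Real.pi)⁻¹ := by
      rw [norm_inv, norm_real, Real.norm_eq_abs, abs_of_pos (by positivity)]
    rw [e3]
    refine mul_le_mul_of_nonneg_left ?_ (by positivity)
    have hPc : ContinuousOn (fun z => s ζ / (s ζ ^ 2 + ‖z - P ζ‖ ^ 2)) (frontier D) := by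
      refine continuousOn_const.div (by fun_prop) fun z _ => ?_
      positivity
    have hPi := T.coll.bintR hPc
    have hbd : ∫ z in frontier D, (Cc * η * (s ζ / (s ζ ^ 2 + ‖z - P ζ‖ ^ 2)) +
        Cc * (2 * Q) * (4 / r1 ^ 2) * s ζ) ∂μH[1] ≤
        Cc * η * M.toReal + Cc * (2 * Q) * (4 / r1 ^ 2) * s ζ * H1 := by
      rw [integral_add (hPi.const_mul _) (integrable_const _), integral_const_mul, integral_const,
        smul_eq_mul, mul_comm (Measure.real _ _)]
      gcongr
      rw [integral_eq_lintegral_of_nonneg_ae (Eventually.of_forall fun z => by positivity)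
        hPi.aestronglyMeasurable]
      exact ENNReal.toReal_mono hM (hMb _ _ hs)
    refine (norm_integral_le_of_norm_le ((hPi.const_mul _).add (integrable_const _)) ?_).trans hbd
    refine (ae_restrict_iff' hms).mpr (Eventually.of_forall fun z hz => ?_)
    have hA : s ζ ≤ ‖z - ζ‖ := by
      rw [← dist_eq_norm, dist_comm]; exact hsmin ζ z hz
    have hk : ‖1 / (z - ζ) - 1 / (z - ζs ζ)‖ ≤ Cc * (s ζ / (s ζ ^ 2 + ‖z - P ζ‖ ^ 2)) := by
      have h1 : 1 / (z - ζ) - 1 / (z - ζs ζ) = (ζ - ζs ζ) / ((z - ζ) * (z - ζs ζ)) := by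
        field_simp [hne1 z hz, hne2 z hz]; ring
      rw [h1, norm_div, norm_mul]
      have h2 : ‖ζ - ζs ζ‖ ≤ 2 * s ζ := by
        have := norm_sub_le_norm_sub_add_norm_sub ζ (P ζ) (ζs ζ)
        rw [norm_sub_rev (P ζ), hsd] at this
        have h3 : ‖ζ - P ζ‖ = s ζ := (dist_eq_norm _ _).symm
        linarith
      refine (div_le_div_of_nonneg_right h2 (by positivity)).trans ?_
      refine kernel_est hs hc0 hA (hdz' z hz) ?_ ?_ (norm_nonneg _)
      · have := norm_sub_le_norm_sub_add_norm_sub z ζ (P ζ)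
        have h3 : ‖ζ - P ζ‖ = s ζ := (dist_eq_norm _ _).symm
        linarith
      · have := norm_sub_le_norm_sub_add_norm_sub z (ζs ζ) (P ζ)
        rw [hsd] at this
        exact this
    rw [norm_mul, norm_mul, (T.hν z hz).1, mul_one]
    have hkn : 0 ≤ s ζ / (s ζ ^ 2 + ‖z - P ζ‖ ^ 2) := by positivity
    by_cases hzr : dist z p < r1
    · have h1 := hr1b z hz hzr
      have h2 : 0 ≤ Cc * (2 * Q) * (4 / r1 ^ 2) * s ζ := by positivity
      have h3 := mul_le_mul h1 hk (norm_nonneg _) hη.le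
      have h6 : η * (Cc * (s ζ / (s ζ ^ 2 + ‖z - P ζ‖ ^ 2))) =
        Cc * η * (s ζ / (s ζ ^ 2 + ‖z - P ζ‖ ^ 2)) := by ring
      rw [h6] at h3
      exact h3.trans (le_add_of_nonneg_right h2)
    · have h1 : ‖q z - q p‖ ≤ 2 * Q := (norm_sub_le _ _).trans (by linarith [hQ z hz, hQ p hp])
      have h2 : r1 / 2 ≤ ‖z - P ζ‖ := by
        have h3 := dist_triangle z (P ζ) p
        have h4 : dist (P ζ) p < r1 / 2 := hPb
        rw [dist_eq_norm z (P ζ)] at h3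
        linarith [not_lt.mp hzr]
      have h3 : s ζ / (s ζ ^ 2 + ‖z - P ζ‖ ^ 2) ≤ 4 / r1 ^ 2 * s ζ := by
        rw [div_le_iff₀ (by positivity)]
        have h5 : (r1 / 2) ^ 2 ≤ s ζ ^ 2 + ‖z - P ζ‖ ^ 2 := by
          have := pow_le_pow_left₀ (by positivity) h2 2
          nlinarith [sq_nonneg (s ζ)]
        have h6 : 4 / r1 ^ 2 * (r1 / 2) ^ 2 = 1 := by field_simp; norm_num
        have h7 : 1 ≤ 4 / r1 ^ 2 * (s ζ ^ 2 + ‖z - P ζ‖ ^ 2) := by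
          rw [← h6]; exact mul_le_mul_of_nonneg_left h5 (by positivity)
        nlinarith
      have h4 := mul_le_mul h1 (hk.trans (mul_le_mul_of_nonneg_left h3 hCc0.le)) (norm_nonneg _)
        (by positivity)
      have h5 : 0 ≤ Cc * η * (s ζ / (s ζ ^ 2 + ‖z - P ζ‖ ^ 2)) := by positivity
      have h6 : 2 * Q * (Cc * (4 / r1 ^ 2 * s ζ)) = Cc * (2 * Q) * (4 / r1 ^ 2) * s ζ := by ring
      rw [h6] at h4
      exact h4.trans (le_add_of_nonneg_left h5)
  rw [Metric.tendsto_nhds]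
  intro η hη
  have hden : 0 < (2 * Real.pi)⁻¹ * (Cc * (M.toReal + 1)) := by positivity
  obtain ⟨B, hB⟩ := hest (η / (2 * ((2 * Real.pi)⁻¹ * (Cc * (M.toReal + 1))))) (by positivity)
  have hlim : Tendsto (fun ζ => (2 * Real.pi)⁻¹ * (B * s ζ * H1)) (𝓝[D] p) (𝓝 0) := by
    have := ((hs0.const_mul B).mul_const H1).const_mul (2 * Real.pi)⁻¹
    simpa using this
  filter_upwards [hB, hlim.eventually (Iio_mem_nhds (half_pos hη))] with ζ h1 h2
  have h2 : (2 * Real.pi)⁻¹ * (B * s ζ * H1) < η / 2 := h2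
  rw [dist_eq_norm]
  refine lt_of_le_of_lt h1 ?_
  have h3 : (2 * Real.pi)⁻¹ * (Cc * (η / (2 * ((2 * Real.pi)⁻¹ * (Cc * (M.toReal + 1))))) * M.toReal) ≤ η / 2 := by
    have hMn : 0 ≤ M.toReal := ENNReal.toReal_nonneg
    have : (2 * Real.pi)⁻¹ * (Cc * (η / (2 * ((2 * Real.pi)⁻¹ * (Cc * (M.toReal + 1))))) * M.toReal) =
        η / 2 * (M.toReal / (M.toReal + 1)) := by field_simp
    rw [this]
    have h4 : M.toReal / (M.toReal + 1) ≤ 1 := by rw [div_le_one (by linarith)]; linarith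
    nlinarith
  linarith

end
end WS


namespace WS
open Topology

structure MS (D : Set ℂ) (z0 : ℂ) (h : ℂ → ℝ) (U : Set ℂ) (g : ℂ → ℝ) (ν : ℂ → ℂ)
    (u : ℂ → ℝ) (k : ℂ → ℂ) : Prop where
  T : BS D z0 h U g ν
  hu : HarmonicOnD u D
  huc : ContinuousOn u (closure D)
  hk : DifferentiableOn ℂ k D
  hkc : ContinuousOn k (closure D)
  rep : ∀ f : ℂ → ℂ, DifferentiableOn ℂ f D → ContinuousOn f (closure D) →
    f z0 = ((2 * Real.pi : ℝ) : ℂ)⁻¹ * ∫ z in frontier D, f z * (starRingEnd ℂ) (k z) *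
      ((Real.exp (-2 * u z) * (fderiv ℝ g z (ν z))⁻¹ : ℝ) : ℂ) ∂μH[1]

variable {D : Set ℂ} {z0 : ℂ} {h : ℂ → ℝ} {U : Set ℂ} {g : ℂ → ℝ} {ν : ℂ → ℂ} {u : ℂ → ℝ}
  {k : ℂ → ℂ}

noncomputable def qf (g : ℂ → ℝ) (ν : ℂ → ℂ) (u : ℂ → ℝ) (k : ℂ → ℂ) (z : ℂ) : ℂ :=
  (starRingEnd ℂ) (k z) * ((Real.exp (-2 * u z) * (fderiv ℝ g z (ν z))⁻¹ : ℝ) : ℂ) *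
    (starRingEnd ℂ) (ν z)

theorem MS.wtc (M : MS D z0 h U g ν u k) :
    ContinuousOn (fun z => Real.exp (-2 * u z) * (fderiv ℝ g z (ν z))⁻¹) (frontier D) :=
  (Real.continuous_exp.comp_continuousOn (continuousOn_const.mul
    (M.huc.mono frontier_subset_closure))).mul
    (M.T.coll.ncont.inv₀ fun z hz => (M.T.hpos z hz).ne')

theorem MS.qc (M : MS D z0 h U g ν u k) : ContinuousOn (qf g ν u k) (frontier D) :=
  ((continuous_conj.comp_continuousOn (M.hkc.mono frontier_subset_closure)).mul
    (continuous_ofReal.comp_continuousOn M.wtc)).mul (continuous_conj.comp_continuousOn M.T.nuc)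

theorem MS.out (M : MS D z0 h U g ν u k) {ζ : ℂ} (hζ : ζ ∉ closure D) :
    Ci D ν (qf g ν u k) ζ = 1 / (z0 - ζ) := by
  have hne : ∀ z ∈ closure D, z - ζ ≠ 0 := fun z hz => sub_ne_zero.mpr fun he => hζ (he ▸ hz)
  have := M.rep (fun z => 1 / (z - ζ))
    ((differentiableOn_const _).div (differentiableOn_id.sub_const _)
      fun z hz => hne z (subset_closure hz))
    (continuousOn_const.div (continuousOn_id.sub continuousOn_const) hne)
  rw [this, Ci]
  congr 1
  refine setIntegral_congr_fun isClosed_frontier.measurableSet fun z hz => ?_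
  have h1 : (starRingEnd ℂ) (ν z) * ν z = 1 := by
    rw [mul_comm, mul_conj, normSq_eq_norm_sq, (M.T.hν z hz).1]; norm_num
  simp only [qf]
  rw [mul_assoc _ ((starRingEnd ℂ) (ν z)), h1]
  ring

noncomputable def Lf (D : Set ℂ) (z0 : ℂ) (g : ℂ → ℝ) (ν : ℂ → ℂ) (u : ℂ → ℝ) (k : ℂ → ℂ) (z : ℂ) : ℂ :=
  Ci D ν (qf g ν u k) z + 1 / (z - z0)

noncomputable def elf (D : Set ℂ) (z0 : ℂ) (g : ℂ → ℝ) (ν : ℂ → ℂ) (u : ℂ → ℝ) (k : ℂ → ℂ) (z : ℂ) : ℂ :=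
  1 + (z - z0) * Ci D ν (qf g ν u k) z

theorem elf_eq {z : ℂ} (hz : z ≠ z0) : elf D z0 g ν u k z = (z - z0) * Lf D z0 g ν u k z := by
  have := sub_ne_zero.mpr hz
  simp only [elf, Lf]; field_simp; ring

theorem elf_z0 : elf D z0 g ν u k z0 = 1 := by simp [elf]

theorem MS.elf_holo (M : MS D z0 h U g ν u k) : DifferentiableOn ℂ (elf D z0 g ν u k) D :=
  (differentiableOn_const _).add ((differentiableOn_id.sub_const _).mul (M.T.Ci_holo M.qc))

theorem MS.z0U (M : MS D z0 h U g ν u k) : z0 ∉ U := by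
  intro hz
  have := M.T.hgE z0 ⟨hz, M.T.S.hz⟩
  have h2 := Real.exp_pos (2 * g z0)
  rw [← this] at h2
  simp [wf, a0] at h2

theorem MS.Llim (M : MS D z0 h U g ν u k) {p : ℂ} (hp : p ∈ frontier D) :
    Tendsto (Lf D z0 g ν u k) (𝓝[D] p) (𝓝 (qf g ν u k p)) := by
  obtain ⟨ζs, h1, h2, h3⟩ := M.T.plemelj M.qc hp
  have hpz : p - z0 ≠ 0 := sub_ne_zero.mpr fun he => M.T.fnD hp (he ▸ M.T.S.hz)
  have h0 : Tendsto (fun ζ : ℂ => ζ) (𝓝[D] p) (𝓝 p) := tendsto_id.mono_left nhdsWithin_le_nhds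
  have h4 : Tendsto (fun ζ => 1 / (ζ - z0) - 1 / (ζs ζ - z0)) (𝓝[D] p) (𝓝 (1 / (p - z0) - 1 / (p - z0))) :=
    (tendsto_const_nhds.div (h0.sub_const z0) hpz).sub
      (tendsto_const_nhds.div (h1.sub_const z0) hpz)
  have h5 := h3.add h4
  rw [sub_self, add_zero] at h5
  refine h5.congr' ?_
  filter_upwards [h2] with ζ hζ
  rw [M.out hζ, Lf, ← neg_sub (ζs ζ) z0, div_neg]
  ring

noncomputable def Lh (D : Set ℂ) (z0 : ℂ) (g : ℂ → ℝ) (ν : ℂ → ℂ) (u : ℂ → ℝ) (k : ℂ → ℂ) (z : ℂ) : ℂ :=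
  open Classical in if z ∈ D then Lf D z0 g ν u k z else qf g ν u k z

theorem MS.Lhc (M : MS D z0 h U g ν u k) : ContinuousOn (Lh D z0 g ν u k) (closure D ∩ U) := by
  rintro p ⟨hp, hpU⟩
  rcases M.T.clD hp with hpD | hpf
  · have hz : p - z0 ≠ 0 := sub_ne_zero.mpr fun he => M.z0U (he ▸ hpU)
    have h1 : ContinuousAt (Lf D z0 g ν u k) p :=
      (((M.T.Ci_holo M.qc) p hpD).differentiableAt (M.T.S.hD.mem_nhds hpD)).continuousAt.add
        (continuousAt_const.div (continuousAt_id.sub continuousAt_const) hz)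
    refine (h1.congr ?_).continuousWithinAt
    filter_upwards [M.T.S.hD.mem_nhds hpD] with z hz
    rw [Lh, if_pos hz]
  · have hLp : Lh D z0 g ν u k p = qf g ν u k p := by rw [Lh, if_neg (M.T.fnD hpf)]
    have hsub : closure D ∩ U ⊆ D ∪ frontier D := fun z hz => M.T.clD hz.1
    refine ContinuousWithinAt.mono ?_ hsub
    rw [ContinuousWithinAt, nhdsWithin_union, hLp]
    refine Tendsto.sup ?_ ?_
    · refine (M.Llim hpf).congr' ?_
      filter_upwards [self_mem_nhdsWithin] with z hz
      rw [Lh, if_pos hz]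
    · refine (M.qc p hpf).congr' ?_
      filter_upwards [self_mem_nhdsWithin] with z hz
      rw [Lh, if_neg (M.T.fnD hz)]

theorem qf_norm (M : MS D z0 h U g ν u k) {z : ℂ} (hz : z ∈ frontier D) :
    ‖qf g ν u k z‖ ^ 2 * Real.exp (2 * u z) * ‖hdz g z‖ ^ 2 = ‖k z‖ ^ 2 * Real.exp (-2 * u z) := by
  have h1 := M.T.hdzb hz
  have hp := M.T.hpos z hz
  have h2 : ‖hdz g z‖ = fderiv ℝ g z (ν z) := by
    rw [← RCLike.norm_conj, h1, norm_mul, (M.T.hν z hz).1, norm_real, Real.norm_eq_abs, abs_of_pos hp, mul_one]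
  have h3 : ‖qf g ν u k z‖ = ‖k z‖ * (Real.exp (-2 * u z) * (fderiv ℝ g z (ν z))⁻¹) := by
    rw [qf, norm_mul, norm_mul, RCLike.norm_conj, RCLike.norm_conj, (M.T.hν z hz).1, norm_real,
      Real.norm_eq_abs, abs_of_pos (by positivity), mul_one]
  rw [h2, h3]
  have h4 : Real.exp (-2 * u z) * Real.exp (2 * u z) = 1 := by
    rw [← Real.exp_add]; simp
  have h5 : fderiv ℝ g z (ν z) * (fderiv ℝ g z (ν z))⁻¹ = 1 := mul_inv_cancel₀ hp.ne'
  generalize fderiv ℝ g z (ν z) = G at *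
  generalize Real.exp (-2 * u z) = e1 at *
  generalize Real.exp (2 * u z) = e2 at *
  generalize G⁻¹ = Gi at *
  calc (‖k z‖ * (e1 * Gi)) ^ 2 * e2 * G ^ 2 = ‖k z‖ ^ 2 * e1 * (e1 * e2) * (G * Gi) ^ 2 := by ring
    _ = _ := by rw [h4, h5]; ring

/-- The weight `w`. -/
noncomputable def ww (D : Set ℂ) (z0 : ℂ) (h g : ℂ → ℝ) (ν : ℂ → ℂ) (u : ℂ → ℝ) (k : ℂ → ℂ) (z : ℂ) : ℝ :=
  wf (elf D z0 g ν u k) (fun z => h z + u z) z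

theorem MS.wEq (M : MS D z0 h U g ν u k) {z : ℂ} (hz : z ≠ z0) :
    ww D z0 h g ν u k z = ‖Lf D z0 g ν u k z‖ ^ 2 * Real.exp (2 * u z) * wf (a0 z0) h z := by
  rw [ww, wf, wf, elf_eq hz, norm_mul, mul_add, Real.exp_add, a0]; ring

/-- K on the diagonal as a boundary integral, from `rep` -/
theorem MS.Kint (M : MS D z0 h U g ν u k) :
    ∫ z in frontier D, (((‖k z‖ ^ 2 * Real.exp (-2 * u z) : ℝ)) : ℂ) /
      (2 * ((fderiv ℝ g z (ν z) : ℝ) : ℂ)) ∂μH[1] = Real.pi * k z0 := by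
  have h1 := M.rep k M.hk M.hkc
  have h2 : ∫ z in frontier D, (((‖k z‖ ^ 2 * Real.exp (-2 * u z) : ℝ)) : ℂ) /
      (2 * ((fderiv ℝ g z (ν z) : ℝ) : ℂ)) ∂μH[1] = 2⁻¹ * ∫ z in frontier D, k z * (starRingEnd ℂ) (k z) *
      ((Real.exp (-2 * u z) * (fderiv ℝ g z (ν z))⁻¹ : ℝ) : ℂ) ∂μH[1] := by
    rw [← integral_const_mul]
    refine setIntegral_congr_fun isClosed_frontier.measurableSet fun z hz => ?_
    have hp : ((fderiv ℝ g z (ν z) : ℝ) : ℂ) ≠ 0 := ofReal_ne_zero.mpr (M.T.hpos z hz).ne'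
    rw [mul_conj, normSq_eq_norm_sq]
    push_cast
    field_simp
  rw [h2]
  have hpi : (Real.pi : ℂ) ≠ 0 := ofReal_ne_zero.mpr Real.pi_ne_zero
  rw [h1]
  push_cast
  field_simp

theorem BS.supp (T : BS D z0 h U g ν) {κ : ℝ → ℝ} (hκs : ∀ x, x ∉ Icc (1:ℝ) 2 → κ x = 0) :
    ∀ᶠ ε : ℝ in 𝓝[>] 0, ∀ z ∈ D, z ∉ U → κ ((1 - wf (a0 z0) h z) / ε) = 0 := by
  have hsub : closure D \ U ⊆ D := fun z hz => (T.clD hz.1).resolve_right fun hf => hz.2 (T.hfU hf)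
  have hcp : IsCompact (closure D \ U) := T.S.hb.isCompact_closure.diff T.hU
  obtain ⟨c, hc1, hc⟩ : ∃ c < 1, ∀ z ∈ closure D \ U, wf (a0 z0) h z ≤ c := by
    rcases (closure D \ U).eq_empty_or_nonempty with he | hne
    · exact ⟨0, one_pos, fun z hz => by rw [he] at hz; exact hz.elim⟩
    · obtain ⟨x, hx, hm⟩ := hcp.exists_isMaxOn hne (T.S.cont.mono hsub)
      exact ⟨_, T.S.lt x (hsub hx), fun z hz => hm hz⟩
  filter_upwards [self_mem_nhdsWithin, mem_nhdsWithin_of_mem_nhds (Iio_mem_nhds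
    (show (0:ℝ) < (1 - c) / 2 by linarith))] with ε h1 h2 z hz hzU
  have h1 : 0 < ε := h1
  have h2 : ε < (1 - c) / 2 := h2
  refine hκs _ fun h3 => ?_
  have h4 := (div_le_iff₀ h1).mp h3.2
  linarith [hc z ⟨subset_closure hz, hzU⟩]

/-- collar limit for `w |V|^2` -/
theorem MS.wlim (M : MS D z0 h U g ν u k) {κ : ℝ → ℝ} (hκ : Continuous κ)
    (hκs : ∀ x, x ∉ Icc (1:ℝ) 2 → κ x = 0) (hκ1 : ∫ t, κ t = 1) :
    Tendsto (fun ε : ℝ => ∫ z in D, (ε⁻¹ * κ ((1 - wf (a0 z0) h z) / ε)) *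
      (ww D z0 h g ν u k z * ‖Vf (a0 z0) h z‖ ^ 2)) (𝓝[>] 0) (𝓝 (Real.pi * (k z0).re)) := by
  set φ : ℂ → ℂ := fun z => ((‖Lh D z0 g ν u k z‖ ^ 2 * Real.exp (2 * u z) * Real.exp (2 * g z) *
    ‖Vh D z0 h g z‖ ^ 2 : ℝ) : ℂ) with hφ
  have huU : ContinuousOn u (closure D ∩ U) := M.huc.mono inter_subset_left
  have hgU : ContinuousOn g (closure D ∩ U) := M.T.hg.continuousOn.mono inter_subset_right
  have hφc : ContinuousOn φ (closure D ∩ U) :=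
    continuous_ofReal.comp_continuousOn ((((M.Lhc.norm.pow 2).mul
      (Real.continuous_exp.comp_continuousOn (continuousOn_const.mul huU))).mul
      (Real.continuous_exp.comp_continuousOn (continuousOn_const.mul hgU))).mul (M.T.Vhc.norm.pow 2))
  have h1 := M.T.collar hκ hκs hκ1 M.T.hU subset_rfl M.T.hfU hφc
  have h2 : ∫ z in frontier D, φ z / (2 * ((fderiv ℝ g z (ν z) : ℝ) : ℂ)) ∂μH[1] = Real.pi * k z0 := by
    rw [← M.Kint]
    refine setIntegral_congr_fun isClosed_frontier.measurableSet fun z hz => ?_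
    have hn := M.T.fnD hz
    simp only [hφ]
    rw [Lh, if_neg hn, Vh, if_neg hn, M.T.g0 z hz, mul_zero, Real.exp_zero, mul_one, qf_norm M hz]
  rw [h2] at h1
  have h3 := (Complex.continuous_re.tendsto _).comp h1
  have h4 : (Real.pi * k z0 : ℂ).re = Real.pi * (k z0).re := by simp
  rw [h4] at h3
  refine h3.congr' ?_
  filter_upwards [M.T.supp hκs] with ε hε
  have h5 : ∫ z in D, ((ε⁻¹ * κ ((1 - wf (a0 z0) h z) / ε) : ℝ) : ℂ) * φ z =
      ∫ z in D, (((ε⁻¹ * κ ((1 - wf (a0 z0) h z) / ε)) *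
      (ww D z0 h g ν u k z * ‖Vf (a0 z0) h z‖ ^ 2) : ℝ) : ℂ) := by
    refine setIntegral_congr_fun M.T.S.hD.measurableSet fun z hz => ?_
    by_cases hzU : z ∈ U
    · have hne : z ≠ z0 := fun he => M.z0U (he ▸ hzU)
      simp only [hφ]
      rw [Lh, if_pos hz, Vh, if_pos hz, M.wEq hne, M.T.hgE z ⟨hzU, hz⟩]
      push_cast; ring
    · simp only [hε z hz hzU]; simp
  simp only [Function.comp]
  rw [h5, integral_complex_ofReal, ofReal_re]

end WS


namespace WS
open Topology

theorem fatou_real {α : Type*} [MeasurableSpace α] {μ : Measure α} {f : ℕ → α → ℝ} {F : α → ℝ}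
    (hf : ∀ n, Integrable (f n) μ) (hn : ∀ n, 0 ≤ᵐ[μ] f n)
    (hF : ∀ᵐ x ∂μ, Tendsto (fun n => f n x) atTop (𝓝 (F x))) {I : ℕ → ℝ} {c : ℝ}
    (hI : ∀ n, ∫ x, f n x ∂μ ≤ I n) (hc : Tendsto I atTop (𝓝 c)) :
    Integrable F μ ∧ ∫ x, F x ∂μ ≤ c := by
  have hFm : AEStronglyMeasurable F μ :=
    aestronglyMeasurable_of_tendsto_ae atTop (fun n => (hf n).aestronglyMeasurable) hF
  have hFn : 0 ≤ᵐ[μ] F := by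
    filter_upwards [hF, ae_all_iff.mpr hn] with x hx hx2
    exact ge_of_tendsto' hx hx2
  have hc0 : 0 ≤ c := ge_of_tendsto' hc fun n => (integral_nonneg_of_ae (hn n)).trans (hI n)
  have key : ∫⁻ x, ENNReal.ofReal (F x) ∂μ ≤ ENNReal.ofReal c := by
    calc ∫⁻ x, ENNReal.ofReal (F x) ∂μ = ∫⁻ x, liminf (fun n => ENNReal.ofReal (f n x)) atTop ∂μ := by
          refine lintegral_congr_ae ?_
          filter_upwards [hF] with x hx
          exact ((ENNReal.continuous_ofReal.tendsto _).comp hx).liminf_eq.symm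
      _ ≤ liminf (fun n => ∫⁻ x, ENNReal.ofReal (f n x) ∂μ) atTop :=
          lintegral_liminf_le' fun n => (hf n).aestronglyMeasurable.aemeasurable.ennreal_ofReal
      _ ≤ liminf (fun n => ENNReal.ofReal (I n)) atTop := by
          refine liminf_le_liminf (Eventually.of_forall fun n => ?_)
          rw [← ofReal_integral_eq_lintegral_ofReal (hf n) (hn n)]
          exact ENNReal.ofReal_le_ofReal (hI n)
      _ = ENNReal.ofReal c := ((ENNReal.continuous_ofReal.tendsto _).comp hc).liminf_eq
  refine ⟨⟨hFm, ?_⟩, ?_⟩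
  · rw [hasFiniteIntegral_iff_ofReal hFn]; exact key.trans_lt ENNReal.ofReal_lt_top
  · rw [integral_eq_lintegral_of_nonneg_ae hFn hFm]
    exact ENNReal.toReal_le_of_le_ofReal hc0 key

variable {D : Set ℂ} {z0 : ℂ} {h : ℂ → ℝ} {U : Set ℂ} {g : ℂ → ℝ} {ν : ℂ → ℂ} {u : ℂ → ℝ}
  {k : ℂ → ℂ}

/-- κ0(x/ε) → 1 for positive x -/
theorem kap_one {κ0 : ℝ → ℝ} (h1 : ∀ t, 2 ≤ t → κ0 t = 1) {x : ℝ} (hx : 0 < x) :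
    ∀ᶠ ε : ℝ in 𝓝[>] 0, κ0 (x / ε) = 1 := by
  filter_upwards [self_mem_nhdsWithin, mem_nhdsWithin_of_mem_nhds (Iio_mem_nhds (half_pos hx))] with ε h2 h3
  have h2 : 0 < ε := h2
  have h3 : ε < x / 2 := h3
  refine h1 _ ?_
  rw [le_div_iff₀ h2]; linarith

theorem GS.fatou (S : GS D z0 h) {κ1 κ0 : ℝ → ℝ} (hκ1 : Continuous κ1)
    (hκ : ∀ t, HasDerivAt κ0 (κ1 t) t) (hκ0 : ∀ t, t ≤ 1 → κ0 t = 0) (hκn : ∀ t, 0 ≤ κ0 t)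
    (hκo : ∀ t, 2 ≤ t → κ0 t = 1)
    {a : ℂ → ℂ} {H : ℂ → ℝ} (ha : DifferentiableOn ℂ a D) (hH : HarmonicOnD H D) {c : ℝ}
    (hc : Tendsto (fun ε : ℝ => ∫ z in D, (ε⁻¹ * κ1 ((1 - wf (a0 z0) h z) / ε)) *
      (wf a H z * ‖Vf (a0 z0) h z‖ ^ 2)) (𝓝[>] 0) (𝓝 c)) :
    IntegrableOn (fun z => wf a H z * Jf (a0 z0) h z) D ∧
    ∫ z in D, wf a H z * Jf (a0 z0) h z ≤ c := by
  have hε : Tendsto (fun n : ℕ => 1 / ((n : ℝ) + 1)) atTop (𝓝[>] 0) :=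
    tendsto_nhdsWithin_iff.mpr ⟨tendsto_one_div_add_atTop_nhds_zero_nat,
      Eventually.of_forall fun n => mem_Ioi.mpr Nat.one_div_pos_of_nat⟩
  have hp : ∀ n : ℕ, 0 < 1 / ((n : ℝ) + 1) := fun n => Nat.one_div_pos_of_nat
  refine fatou_real (fun n => (S.I1 hκ1 hκ hκ0 hκn ha hH (hp n)).1) (fun n => ?_) ?_
    (fun n => (S.I1 hκ1 hκ hκ0 hκn ha hH (hp n)).2) (hc.comp hε)
  · exact Eventually.of_forall fun z => mul_nonneg (mul_nonneg (wf_nonneg z) (Jf_nonneg z)) (hκn _)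
  · refine (ae_restrict_iff' S.hD.measurableSet).mpr (Eventually.of_forall fun z hz => ?_)
    refine tendsto_const_nhds.congr' ?_
    filter_upwards [hε.eventually (kap_one hκo (sub_pos.mpr (S.lt z hz)))] with n hn
    rw [hn, mul_one]

theorem gcut {κ0 : ℝ → ℝ} (hc : Continuous κ0) (hκ0 : ∀ t, t ≤ 1 → κ0 t = 0) (hκn : ∀ t, 0 ≤ κ0 t)
    (hκl : ∀ t, κ0 t ≤ 1) (hκo : ∀ t, 2 ≤ t → κ0 t = 1) :
    Tendsto (fun ε : ℝ => ∫ x in (0:ℝ)..1, κ0 (x / ε) * κ0 ((1 - x) / ε)) (𝓝[>] 0) (𝓝 1) := by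
  have : (1 : ℝ) = ∫ x in (0:ℝ)..1, (1:ℝ) := by simp
  nth_rw 3 [this]
  refine intervalIntegral.tendsto_integral_filter_of_dominated_convergence (fun _ => 1)
    (Eventually.of_forall fun ε => ?_) (Eventually.of_forall fun ε => ?_) (by simp) ?_
  · exact (by fun_prop : Continuous fun x => κ0 (x / ε) * κ0 ((1 - x) / ε)).aestronglyMeasurable
  · refine Eventually.of_forall fun x _ => ?_
    rw [Real.norm_eq_abs, abs_of_nonneg (mul_nonneg (hκn _) (hκn _))]
    exact mul_le_one₀ (hκl _) (hκn _) (hκl _)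
  · have h1 : ∀ᵐ x : ℝ, x ≠ 1 := by simp [ae_iff]
    filter_upwards [h1] with x hx1 hx
    rw [uIoc_of_le zero_le_one] at hx
    refine tendsto_const_nhds.congr' ?_
    filter_upwards [kap_one hκo hx.1, kap_one hκo (sub_pos.mpr (lt_of_le_of_ne hx.2 hx1))] with ε e1 e2
    rw [e1, e2, mul_one]

theorem GS.pair (S : GS D z0 h) {κ1 κ0 : ℝ → ℝ} 
    (hκ : ∀ t, HasDerivAt κ0 (κ1 t) t) (hκ0 : ∀ t, t ≤ 1 → κ0 t = 0) (hκn : ∀ t, 0 ≤ κ0 t)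
    (hκl : ∀ t, κ0 t ≤ 1) (hκo : ∀ t, 2 ≤ t → κ0 t = 1) {m : ℂ → ℂ} (hm : DifferentiableOn ℂ m D)
    (hi : IntegrableOn (fun z => m z / (z - z0) * (starRingEnd ℂ) (Vf (a0 z0) h z)) D) :
    ∫ z in D, m z / (z - z0) * (starRingEnd ℂ) (Vf (a0 z0) h z) = Real.pi * m z0 := by
  have hc : Continuous κ0 := continuous_iff_continuousAt.mpr fun t => (hκ t).continuousAt
  set gg : ℝ → ℝ → ℝ := fun ε x => κ0 (x / ε) * κ0 ((1 - x) / ε) with hgg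
  have hgc : ∀ ε, Continuous (gg ε) := fun ε => by fun_prop
  have e1 : ∀ ε > 0, ∫ z in D, ((gg ε (wf (a0 z0) h z) : ℝ) : ℂ) *
      (m z / (z - z0) * (starRingEnd ℂ) (Vf (a0 z0) h z)) =
      Real.pi * (((∫ x in (0:ℝ)..1, gg ε x : ℝ) : ℂ) * m z0) := by
    intro ε hε
    have h1 : ∀ x, HasDerivAt (fun x => - ∫ t in (1:ℝ)..x, gg ε t) (-(gg ε x)) x := fun x =>
      ((hgc ε).integral_hasStrictDerivAt 1 x).hasDerivAt.neg
    have h2 : ∀ x, 1 - ε ≤ x → - ∫ t in (1:ℝ)..x, gg ε t = 0 := by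
      intro x hx
      rw [intervalIntegral.integral_congr (g := fun _ => 0), intervalIntegral.integral_zero, neg_zero]
      intro t ht
      have ht1 : 1 - ε ≤ t := (le_min (by linarith) hx).trans ht.1
      simp only [hgg]
      rw [hκ0 ((1 - t) / ε) (by rw [div_le_one hε]; linarith), mul_zero]
    have h3 : ∀ x, x ≤ ε → - ∫ t in (1:ℝ)..x, gg ε t = ∫ t in (0:ℝ)..1, gg ε t := by
      intro x hx
      have hii : ∀ a b, IntervalIntegrable (gg ε) volume a b := fun a b => (hgc ε).intervalIntegrable a b
      have h4 := intervalIntegral.integral_add_adjacent_intervals (hii 0 1) (hii 1 x)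
      have h5 : ∫ t in (0:ℝ)..x, gg ε t = 0 := by
        rw [intervalIntegral.integral_congr (g := fun _ => 0), intervalIntegral.integral_zero]
        intro t ht
        have ht1 : t ≤ ε := ht.2.trans (max_le hε.le hx)
        simp only [hgg]
        rw [hκ0 (t / ε) (by rw [div_le_one hε]; linarith), zero_mul]
      linarith
    have h0 : wf (a0 z0) h z0 < ε := by simpa [wf, a0] using hε
    have h6 := (S.I2 h1 (hgc ε).neg hε h2 hm S.hz h0 h3).1
    rw [← neg_inj, ← integral_neg]
    rw [← neg_mul, ← h6]
    refine integral_congr_ae (Eventually.of_forall fun z => ?_)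
    push_cast; ring
  have hz0 : ∀ᵐ z : ℂ, z ≠ z0 := by simp [ae_iff]
  have l1 : Tendsto (fun ε : ℝ => ∫ z in D, ((gg ε (wf (a0 z0) h z) : ℝ) : ℂ) *
      (m z / (z - z0) * (starRingEnd ℂ) (Vf (a0 z0) h z))) (𝓝[>] 0)
      (𝓝 (∫ z in D, m z / (z - z0) * (starRingEnd ℂ) (Vf (a0 z0) h z))) := by
    refine tendsto_integral_filter_of_dominated_convergence
      (fun z => ‖m z / (z - z0) * (starRingEnd ℂ) (Vf (a0 z0) h z)‖)
      (Eventually.of_forall fun ε => ?_) (Eventually.of_forall fun ε => ?_) hi.norm ?_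
    · exact ((continuous_ofReal.comp_continuousOn ((hgc ε).comp_continuousOn S.cont)).aestronglyMeasurable
        S.hD.measurableSet).mul hi.aestronglyMeasurable
    · refine Eventually.of_forall fun z => ?_
      rw [norm_mul, norm_real, Real.norm_eq_abs, abs_of_nonneg (mul_nonneg (hκn _) (hκn _))]
      exact mul_le_of_le_one_left (norm_nonneg _) (mul_le_one₀ (hκl _) (hκn _) (hκl _))
    · refine (ae_restrict_iff' S.hD.measurableSet).mpr ?_
      filter_upwards [hz0] with z hz hzD
      have hpos : 0 < wf (a0 z0) h z := by
        have := norm_pos_iff.mpr (sub_ne_zero.mpr hz)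
        simp only [wf, a0]; positivity
      refine tendsto_const_nhds.congr' ?_
      filter_upwards [kap_one hκo hpos, kap_one hκo (sub_pos.mpr (S.lt z hzD))] with ε e1 e2
      simp only [hgg, e1, e2]; simp
  have l2 : Tendsto (fun ε : ℝ => (Real.pi : ℂ) * (((∫ x in (0:ℝ)..1, gg ε x : ℝ) : ℂ) * m z0)) (𝓝[>] 0)
      (𝓝 (Real.pi * (((1:ℝ) : ℂ) * m z0))) :=
    (((continuous_ofReal.tendsto _).comp (gcut hc hκ0 hκn hκl hκo)).mul_const _).const_mul _
  rw [ofReal_one, one_mul] at l2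
  refine tendsto_nhds_unique l1 (l2.congr' ?_)
  filter_upwards [self_mem_nhdsWithin] with ε hε
  exact (e1 ε hε).symm

end WS


namespace WS
open Topology

structure NS (D : Set ℂ) (z0 : ℂ) (h : ℂ → ℝ) (U : Set ℂ) (g : ℂ → ℝ) (ν : ℂ → ℂ)
    (u : ℂ → ℝ) (k b : ℂ → ℂ) : Prop where
  M : MS D z0 h U g ν u k
  hb : DifferentiableOn ℂ b D
  hbi : IntegrableOn (fun z => ‖b z‖ ^ 2 * Real.exp (-2 * u z)) D
  repb : ∀ f : ℂ → ℂ, DifferentiableOn ℂ f D →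
    IntegrableOn (fun z => ‖f z‖ ^ 2 * Real.exp (-2 * u z)) D →
    f z0 = ∫ z in D, f z * (starRingEnd ℂ) (b z) * ((Real.exp (-2 * u z) : ℝ) : ℂ)

variable {D : Set ℂ} {z0 : ℂ} {h : ℂ → ℝ} {U : Set ℂ} {g : ℂ → ℝ} {ν : ℂ → ℂ} {u : ℂ → ℝ}
  {k b : ℂ → ℂ}

theorem NS.beta (N : NS D z0 h U g ν u k b) :
    b z0 = ((∫ z in D, ‖b z‖ ^ 2 * Real.exp (-2 * u z) : ℝ) : ℂ) := by
  rw [N.repb b N.hb N.hbi, ← integral_complex_ofReal]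
  refine integral_congr_ae (Eventually.of_forall fun z => ?_)
  simp only
  rw [mul_conj, normSq_eq_norm_sq]; push_cast; rfl

/-- For holomorphic `l` put `P = conj l * A * e^{2h+2u}`. -/
noncomputable def Pf (z0 : ℂ) (h u : ℂ → ℝ) (l : ℂ → ℂ) (z : ℂ) : ℂ :=
  (starRingEnd ℂ) (l z) * Af (a0 z0) h z * ((Real.exp (2 * (h z + u z)) : ℝ) : ℂ)

theorem Pf_sq {l : ℂ → ℂ} (z : ℂ) : ‖Pf z0 h u l z‖ ^ 2 * Real.exp (-2 * u z) =
    wf l (fun z => h z + u z) z * Jf (a0 z0) h z := by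
  have e : Real.exp (2 * (h z + u z)) * Real.exp (-2 * u z) = Real.exp (2 * h z) := by
    rw [← Real.exp_add]; congr 1; ring
  rw [Pf, norm_mul, norm_mul, RCLike.norm_conj, norm_real, Real.norm_eq_abs, abs_of_pos (Real.exp_pos _),
    wf, Jf, ← e]
  ring

theorem Pf_cont (hD : IsOpen D) (hh : HarmonicOnD h D) (hu : HarmonicOnD u D) {l : ℂ → ℂ}
    (hl : DifferentiableOn ℂ l D) : ContinuousOn (Pf z0 h u l) D :=
  ((continuous_conj.comp_continuousOn hl.continuousOn).mul
    (Af_holo hD (a0_holo z0 D) hh).continuousOn).mul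
    (continuous_ofReal.comp_continuousOn (expc (harm_add hh hu)))

theorem Pf_conj {l : ℂ → ℂ} {z : ℂ} (hz : z ≠ z0) :
    (starRingEnd ℂ) (Pf z0 h u l z) * ((Real.exp (-2 * u z) : ℝ) : ℂ) =
    l z / (z - z0) * (starRingEnd ℂ) (Vf (a0 z0) h z) := by
  have hz' := sub_ne_zero.mpr hz
  have e : Real.exp (2 * (h z + u z)) * Real.exp (-2 * u z) = Real.exp (2 * h z) := by
    rw [← Real.exp_add]; congr 1; ring
  have e' : ((Real.exp (2 * (h z + u z)) : ℝ) : ℂ) * ((Real.exp (-2 * u z) : ℝ) : ℂ) =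
    ((Real.exp (2 * h z) : ℝ) : ℂ) := by rw [← e, ofReal_mul]
  rw [Pf, Vf]
  simp only [map_mul, conj_conj, conj_ofReal, a0]
  rw [← e']
  field_simp

theorem amgm_int (hD : IsOpen D) {f p : ℂ → ℂ} {r : ℂ → ℝ} (hf : ContinuousOn f D) (hp : ContinuousOn p D)
    (hr : ContinuousOn r D) (hr0 : ∀ z, 0 ≤ r z)
    (h1 : IntegrableOn (fun z => ‖f z‖ ^ 2 * r z) D) (h2 : IntegrableOn (fun z => ‖p z‖ ^ 2 * r z) D) :
    IntegrableOn (fun z => f z * ((starRingEnd ℂ) (p z) * ((r z : ℝ) : ℂ))) D := by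
  refine Integrable.mono' (h1.add h2) ?_ (Eventually.of_forall fun z => ?_)
  · exact (hf.mul ((continuous_conj.comp_continuousOn hp).mul
      (continuous_ofReal.comp_continuousOn hr))).aestronglyMeasurable hD.measurableSet
  · rw [norm_mul, norm_mul, RCLike.norm_conj, norm_real, Real.norm_eq_abs, abs_of_nonneg (hr0 z)]
    simp only [Pi.add_apply]
    have := two_mul_le_add_sq ‖f z‖ ‖p z‖
    have h4 : ‖f z‖ * ‖p z‖ ≤ ‖f z‖ ^ 2 + ‖p z‖ ^ 2 := by
      nlinarith [norm_nonneg (f z), norm_nonneg (p z), sq_nonneg (‖f z‖), sq_nonneg (‖p z‖)]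
    have := mul_le_mul_of_nonneg_right h4 (hr0 z)
    linarith

theorem MS.rhoc (M : MS D z0 h U g ν u k) : ContinuousOn (fun z => Real.exp (-2 * u z)) D :=
  Real.continuous_exp.comp_continuousOn (continuousOn_const.mul (M.huc.mono subset_closure))

theorem MS.pairP (M : MS D z0 h U g ν u k) {f l : ℂ → ℂ} (hf : DifferentiableOn ℂ f D)
    (hl : DifferentiableOn ℂ l D) (h1 : IntegrableOn (fun z => ‖f z‖ ^ 2 * Real.exp (-2 * u z)) D)
    (h2 : IntegrableOn (fun z => wf l (fun z => h z + u z) z * Jf (a0 z0) h z) D) :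
    IntegrableOn (fun z => f z * ((starRingEnd ℂ) (Pf z0 h u l z) * ((Real.exp (-2 * u z) : ℝ) : ℂ))) D ∧
    ∫ z in D, f z * ((starRingEnd ℂ) (Pf z0 h u l z) * ((Real.exp (-2 * u z) : ℝ) : ℂ)) =
      Real.pi * (f z0 * l z0) := by
  obtain ⟨κ1, κ0, hc, hn, hs, hi, hd, h0, ho, hκn, hκl⟩ := bump_exists
  have hI := amgm_int M.T.S.hD hf.continuousOn (Pf_cont (z0 := z0) M.T.S.hD M.T.S.hh M.hu hl) M.rhoc
    (fun z => (Real.exp_pos _).le) h1 (by simpa only [Pf_sq] using h2)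
  have hz0 : ∀ᵐ z ∂(volume.restrict D), z ≠ z0 := ae_restrict_of_ae (by simp [ae_iff])
  have hcg : (fun z => f z * ((starRingEnd ℂ) (Pf z0 h u l z) * ((Real.exp (-2 * u z) : ℝ) : ℂ)))
      =ᵐ[volume.restrict D] fun z => (f z * l z) / (z - z0) * (starRingEnd ℂ) (Vf (a0 z0) h z) := by
    filter_upwards [hz0] with z hz
    rw [Pf_conj hz]; ring
  refine ⟨hI, ?_⟩
  rw [integral_congr_ae hcg]
  exact M.T.S.pair hd h0 hκn hκl ho (hf.mul hl) (hI.congr hcg)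

/-- Fatou -/
theorem MS.F1 (M : MS D z0 h U g ν u k) :
    IntegrableOn (fun z => wf (elf D z0 g ν u k) (fun z => h z + u z) z * Jf (a0 z0) h z) D ∧
    ∫ z in D, wf (elf D z0 g ν u k) (fun z => h z + u z) z * Jf (a0 z0) h z ≤ Real.pi * (k z0).re := by
  obtain ⟨κ1, κ0, hc, hn, hs, hi, hd, h0, ho, hκn, hκl⟩ := bump_exists
  exact M.T.S.fatou hc hd h0 hκn ho M.elf_holo (harm_add M.T.S.hh M.hu) (M.wlim hc hs hi)

theorem NS.main (N : NS D z0 h U g ν u k b) :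
    IntegrableOn (fun z => ‖b z - (Real.pi : ℂ)⁻¹ * Pf z0 h u (elf D z0 g ν u k) z‖ ^ 2 *
      Real.exp (-2 * u z)) D ∧
    ∫ z in D, ‖b z - (Real.pi : ℂ)⁻¹ * Pf z0 h u (elf D z0 g ν u k) z‖ ^ 2 * Real.exp (-2 * u z) ≤
      Real.pi⁻¹ * (k z0).re - (b z0).re := by
  have F1 := N.M.F1
  have F2 := N.M.pairP N.hb N.M.elf_holo N.hbi F1.1
  rw [elf_z0, mul_one] at F2
  have hβ := N.beta
  set P := Pf z0 h u (elf D z0 g ν u k)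
  have e1 : ∀ z, ‖b z - (Real.pi : ℂ)⁻¹ * P z‖ ^ 2 * Real.exp (-2 * u z) =
      (‖b z‖ ^ 2 * Real.exp (-2 * u z) + Real.pi⁻¹ ^ 2 *
        (wf (elf D z0 g ν u k) (fun z => h z + u z) z * Jf (a0 z0) h z)) -
      2 * Real.pi⁻¹ * (b z * ((starRingEnd ℂ) (P z) * ((Real.exp (-2 * u z) : ℝ) : ℂ))).re := by
    intro z
    rw [← Pf_sq]
    have h1 : ‖b z - (Real.pi : ℂ)⁻¹ * P z‖ ^ 2 = ‖b z‖ ^ 2 + Real.pi⁻¹ ^ 2 * ‖P z‖ ^ 2 -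
        2 * Real.pi⁻¹ * (b z * (starRingEnd ℂ) (P z)).re := by
      rw [← ofReal_inv]
      simp only [← normSq_eq_norm_sq]
      rw [normSq_sub]
      simp only [normSq_mul, normSq_ofReal, map_mul, conj_ofReal]
      have : (b z * (((Real.pi⁻¹ : ℝ) : ℂ) * (starRingEnd ℂ) (P z))) =
        ((Real.pi⁻¹ : ℝ) : ℂ) * (b z * (starRingEnd ℂ) (P z)) := by ring
      rw [this, re_ofReal_mul]; ring
    rw [h1, ← mul_assoc (b z), re_mul_ofReal]
    ring
  have i1 : IntegrableOn (fun z => ‖b z‖ ^ 2 * Real.exp (-2 * u z) + Real.pi⁻¹ ^ 2 *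
        (wf (elf D z0 g ν u k) (fun z => h z + u z) z * Jf (a0 z0) h z)) D :=
    N.hbi.add (F1.1.const_mul _)
  have i2 : IntegrableOn (fun z => 2 * Real.pi⁻¹ *
      (b z * ((starRingEnd ℂ) (P z) * ((Real.exp (-2 * u z) : ℝ) : ℂ))).re) D := F2.1.re.const_mul _
  have hre : ∫ z in D, (b z * ((starRingEnd ℂ) (P z) * ((Real.exp (-2 * u z) : ℝ) : ℂ))).re =
      Real.pi * (b z0).re := by
    have := integral_re F2.1
    simp only [RCLike.re_to_complex] at this
    rw [this, F2.2, re_ofReal_mul]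
  simp only [e1]
  refine ⟨i1.sub i2, ?_⟩
  rw [integral_sub i1 i2, integral_add N.hbi (F1.1.const_mul _), integral_const_mul, integral_const_mul, hre]
  have hb0 : ∫ z in D, ‖b z‖ ^ 2 * Real.exp (-2 * u z) = (b z0).re := by rw [hβ, ofReal_re]
  rw [hb0]
  have hpi := Real.pi_pos
  have h3 : Real.pi⁻¹ ^ 2 * ∫ z in D, wf (elf D z0 g ν u k) (fun z => h z + u z) z * Jf (a0 z0) h z ≤
      Real.pi⁻¹ ^ 2 * (Real.pi * (k z0).re) := mul_le_mul_of_nonneg_left F1.2 (by positivity)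
  have h4 : Real.pi⁻¹ ^ 2 * (Real.pi * (k z0).re) = Real.pi⁻¹ * (k z0).re := by field_simp
  have h5 : 2 * Real.pi⁻¹ * (Real.pi * (b z0).re) = 2 * (b z0).re := by field_simp
  rw [h5]; linarith

theorem NS.ineq (N : NS D z0 h U g ν u k b) : Real.pi * (b z0).re ≤ (k z0).re := by
  have h1 := N.main.2
  have h2 : 0 ≤ ∫ z in D, ‖b z - (Real.pi : ℂ)⁻¹ * Pf z0 h u (elf D z0 g ν u k) z‖ ^ 2 *
      Real.exp (-2 * u z) := integral_nonneg fun z => by positivity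
  have h3 : (b z0).re ≤ Real.pi⁻¹ * (k z0).re := by linarith
  have := mul_le_mul_of_nonneg_left h3 Real.pi_pos.le
  rwa [← mul_assoc, mul_inv_cancel₀ Real.pi_ne_zero, one_mul] at this

theorem NS.eqP (N : NS D z0 h U g ν u k b) (he : (k z0).re = Real.pi * (b z0).re) :
    ∀ z ∈ D, b z = (Real.pi : ℂ)⁻¹ * Pf z0 h u (elf D z0 g ν u k) z := by
  have h1 := N.main
  rw [he, ← mul_assoc, inv_mul_cancel₀ Real.pi_ne_zero, one_mul, sub_self] at h1
  have h2 : 0 ≤ᵐ[volume.restrict D] fun z => ‖b z - (Real.pi : ℂ)⁻¹ * Pf z0 h u (elf D z0 g ν u k) z‖ ^ 2 *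
      Real.exp (-2 * u z) := Eventually.of_forall fun z => by simp only [Pi.zero_apply]; positivity
  have h3 := (integral_eq_zero_iff_of_nonneg_ae h2 h1.1).mp (le_antisymm h1.2 (integral_nonneg_of_ae h2))
  have h4 : b =ᵐ[volume.restrict D] fun z => (Real.pi : ℂ)⁻¹ * Pf z0 h u (elf D z0 g ν u k) z := by
    filter_upwards [h3] with z hz
    simp only [Pi.zero_apply, mul_eq_zero, Real.exp_ne_zero, or_false] at hz
    exact sub_eq_zero.mp (norm_eq_zero.mp (pow_eq_zero_iff two_ne_zero |>.mp hz))
  exact fun z hz => Measure.eqOn_open_of_ae_eq h4 N.M.T.S.hD N.hb.continuousOn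
    (continuousOn_const.mul (Pf_cont N.M.T.S.hD N.M.T.S.hh N.M.hu N.M.elf_holo)) hz

theorem Af_z0 : Af (a0 z0) h z0 = 1 := by simp [Af, a0_deriv, a0]

theorem NS.wconst (N : NS D z0 h U g ν u k b) (he : (k z0).re = Real.pi * (b z0).re) :
    ∃ c > 0, ∀ z ∈ D, wf (elf D z0 g ν u k) (fun z => h z + u z) z = c := by
  have S := N.M.T.S
  set l := elf D z0 g ν u k with hl
  set w := wf l (fun z => h z + u z) with hw
  have hA := Af_holo S.hD (a0_holo z0 D) S.hh
  have hAa := hA.analyticOnNhd S.hD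
  have hlh := N.M.elf_holo
  have hm : DifferentiableOn ℂ (fun z => (Real.pi : ℂ) * (b z * l z)) D := (N.hb.mul hlh).const_mul _
  have hpi : (Real.pi : ℂ) ≠ 0 := ofReal_ne_zero.mpr Real.pi_ne_zero
  have key : ∀ z ∈ D, (Real.pi : ℂ) * (b z * l z) = (w z : ℂ) * Af (a0 z0) h z := by
    intro z hz
    rw [N.eqP he z hz, Pf, hw, wf]
    push_cast
    have h1 : (starRingEnd ℂ) (l z) * l z = ((‖l z‖ : ℝ) : ℂ) ^ 2 := by
      rw [mul_comm, mul_conj, normSq_eq_norm_sq]; push_cast; rfl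
    rw [← h1]
    rw [show ∀ X A E L : ℂ, (Real.pi : ℂ) * ((Real.pi : ℂ)⁻¹ * (X * A * E) * L) = X * L * E * A from
      fun X A E L => by field_simp]
  have hne : ∀ᶠ z in 𝓝 z0, z ∈ D ∧ Af (a0 z0) h z ≠ 0 := by
    refine Filter.Eventually.and (S.hD.mem_nhds S.hz) ?_
    refine ((hA z0 S.hz).differentiableAt (S.hD.mem_nhds S.hz)).continuousAt.eventually_ne ?_
    rw [Af_z0]; exact one_ne_zero
  obtain ⟨r, hr, hrb⟩ := Metric.eventually_nhds_iff_ball.mp hne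
  have hf : DifferentiableOn ℂ (fun z => (Real.pi : ℂ) * (b z * l z) / Af (a0 z0) h z) (ball z0 r) :=
    (hm.mono fun z hz => (hrb z hz).1).div (hA.mono fun z hz => (hrb z hz).1) fun z hz => (hrb z hz).2
  have hfe : ∀ z ∈ ball z0 r, (Real.pi : ℂ) * (b z * l z) / Af (a0 z0) h z = (w z : ℂ) := fun z hz => by
    rw [key z (hrb z hz).1, mul_div_cancel_right₀ _ (hrb z hz).2]
  obtain ⟨cc, hcc⟩ := (hf.analyticOnNhd isOpen_ball).eq_const_of_im_eq_const (c₀ := 0)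
    (fun z hz => by rw [hfe z hz, ofReal_im]) isOpen_ball (isConnected_ball hr)
  have hw0 : (w z0 : ℂ) = cc := by rw [← hfe z0 (mem_ball_self hr)]; exact hcc z0 (mem_ball_self hr)
  have hwb : ∀ z ∈ ball z0 r, w z = w z0 := fun z hz => by
    have h1 := hcc z hz
    rw [hfe z hz, ← hw0] at h1
    exact_mod_cast h1
  have hEq : EqOn (fun z => (Real.pi : ℂ) * (b z * l z)) (fun z => (w z0 : ℂ) * Af (a0 z0) h z) D := by
    refine (hm.analyticOnNhd S.hD).eqOn_of_preconnected_of_eventuallyEq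
      ((hA.const_mul _).analyticOnNhd S.hD) S.hc S.hz ?_
    filter_upwards [ball_mem_nhds z0 hr] with z hz
    rw [key z (hrb z hz).1, hwb z hz]
  have hwc : ContinuousOn w D := wf_cont hlh (harm_add S.hh N.M.hu)
  refine ⟨w z0, ?_, fun z hz => ?_⟩
  · simp only [hw, wf, hl, elf_z0, norm_one]; positivity
  · have hnz : ∀ᶠ y in 𝓝[≠] z, Af (a0 z0) h y ≠ 0 := by
      by_contra hcon
      have := hAa.eqOn_zero_of_preconnected_of_frequently_eq_zero S.hc hz
        (by rw [Filter.Frequently]; exact hcon)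
      have h1 := this S.hz
      rw [Af_z0] at h1
      exact one_ne_zero h1
    have hev : ∀ᶠ y in 𝓝[≠] z, w y = w z0 := by
      filter_upwards [hnz, mem_nhdsWithin_of_mem_nhds (S.hD.mem_nhds hz)] with y h1 h2
      have h3 := hEq h2
      simp only at h3
      rw [key y h2] at h3
      exact_mod_cast mul_right_cancel₀ h1 h3
    have hlim : Tendsto w (𝓝[≠] z) (𝓝 (w z)) :=
      ((hwc z hz).continuousAt (S.hD.mem_nhds hz)).tendsto.mono_left nhdsWithin_le_nhds
    exact tendsto_nhds_unique hlim (tendsto_const_nhds.congr' (hev.mono fun y hy => hy.symm))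

theorem NS.forward (N : NS D z0 h U g ν u k b) (he : (k z0).re = Real.pi * (b z0).re) :
    ∃ F : ℂ → ℂ, DifferentiableOn ℂ F D ∧ ∀ z ∈ D \ {z0},
      F z ≠ 0 ∧ Real.log ‖F z‖ = Real.log (dist z z0) + h z + u z := by
  obtain ⟨c, hc, hw⟩ := N.wconst he
  have hl0 : ∀ z ∈ D, elf D z0 g ν u k z ≠ 0 := by
    intro z hz h0
    have := hw z hz
    simp [wf, h0] at this
    linarith
  refine ⟨fun z => ((Real.sqrt c : ℝ) : ℂ) * (z - z0) / elf D z0 g ν u k z,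
    ((differentiableOn_id.sub_const _).const_mul _).div N.M.elf_holo hl0, fun z hz => ?_⟩
  have hs : 0 < Real.sqrt c := Real.sqrt_pos.mpr hc
  have hz1 : z - z0 ≠ 0 := sub_ne_zero.mpr hz.2
  have hln : 0 < ‖elf D z0 g ν u k z‖ := norm_pos_iff.mpr (hl0 z hz.1)
  have hzn : 0 < ‖z - z0‖ := norm_pos_iff.mpr hz1
  refine ⟨div_ne_zero (mul_ne_zero (ofReal_ne_zero.mpr hs.ne') hz1) (hl0 z hz.1), ?_⟩
  rw [norm_div, norm_mul, norm_real, Real.norm_eq_abs, abs_of_pos hs,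
    Real.log_div (mul_pos hs hzn).ne' hln.ne', Real.log_mul hs.ne' hzn.ne', Real.log_sqrt hc.le, ← hw z hz.1, wf,
    Real.log_mul (pow_pos hln 2).ne' (Real.exp_ne_zero _), Real.log_exp, Real.log_pow, dist_eq_norm]
  push_cast; ring

end WS


namespace WS
open Topology

variable {D : Set ℂ} {z0 : ℂ} {h : ℂ → ℝ} {U : Set ℂ} {g : ℂ → ℝ} {ν : ℂ → ℂ} {u : ℂ → ℝ}
  {k b : ℂ → ℂ}

/-- factor out the zero -/
theorem MS.factor (M : MS D z0 h U g ν u k) {F : ℂ → ℂ} (hF : DifferentiableOn ℂ F D)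
    (hFl : ∀ z ∈ D \ {z0}, F z ≠ 0 ∧ Real.log ‖F z‖ = Real.log (dist z z0) + h z + u z) :
    ∃ F1 : ℂ → ℂ, DifferentiableOn ℂ F1 D ∧ ∀ z ∈ D, ‖F1 z‖ = Real.exp (h z + u z) := by
  have S := M.T.S
  have hDn := S.hD.mem_nhds S.hz
  have hnorm : ∀ z ∈ D \ {z0}, ‖F z‖ = ‖z - z0‖ * Real.exp (h z + u z) := by
    intro z hz
    have h1 := hFl z hz
    have h2 : 0 < ‖z - z0‖ := norm_pos_iff.mpr (sub_ne_zero.mpr hz.2)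
    rw [← Real.exp_log (norm_pos_iff.mpr h1.1), h1.2, dist_eq_norm, add_assoc, Real.exp_add, Real.exp_log h2]
  have hcE : ContinuousAt (fun z => Real.exp (h z + u z)) z0 :=
    Real.continuous_exp.continuousAt.comp
      (((harm_hdz S.hh).2.1.continuousAt hDn).add ((harm_hdz M.hu).2.1.continuousAt hDn))
  have hpD : ∀ᶠ z in 𝓝[≠] z0, z ∈ D \ {z0} := by
    filter_upwards [self_mem_nhdsWithin, mem_nhdsWithin_of_mem_nhds hDn] with z h1 h2
    exact ⟨h2, h1⟩
  have hF0 : F z0 = 0 := by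
    have h1 : Tendsto (fun z => ‖F z‖) (𝓝[≠] z0) (𝓝 ‖F z0‖) :=
      (hF.continuousOn.continuousAt hDn).norm.tendsto.mono_left nhdsWithin_le_nhds
    have h2 : ContinuousAt (fun z => ‖z - z0‖ * Real.exp (h z + u z)) z0 :=
      (by fun_prop : ContinuousAt (fun z => ‖z - z0‖) z0).mul hcE
    have h3 := h2.tendsto.mono_left (nhdsWithin_le_nhds (s := {z0}ᶜ))
    simp only [sub_self, norm_zero, zero_mul] at h3
    have h4 := tendsto_nhds_unique h1 (h3.congr' (hpD.mono fun z hz => (hnorm z hz).symm))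
    exact norm_eq_zero.mp h4
  have hd : DifferentiableOn ℂ (dslope F z0) D := (Complex.differentiableOn_dslope hDn).mpr hF
  have hne : ∀ z ∈ D \ {z0}, ‖dslope F z0 z‖ = Real.exp (h z + u z) := by
    intro z hz
    have h2 : 0 < ‖z - z0‖ := norm_pos_iff.mpr (sub_ne_zero.mpr hz.2)
    rw [dslope_of_ne _ hz.2, slope_def_field, hF0, sub_zero, norm_div, hnorm z hz]
    field_simp
  refine ⟨_, hd, fun z hz => ?_⟩
  by_cases hzz : z = z0
  · subst hzz
    have h1 : Tendsto (fun y => ‖dslope F z y‖) (𝓝[≠] z) (𝓝 ‖dslope F z z‖) :=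
      (hd.continuousOn.continuousAt hDn).norm.tendsto.mono_left nhdsWithin_le_nhds
    have h3 := hcE.tendsto.mono_left (nhdsWithin_le_nhds (s := {z}ᶜ))
    exact tendsto_nhds_unique h1 (h3.congr' (hpD.mono fun y hy => (hne y hy).symm))
  · exact hne z ⟨hz, hzz⟩

theorem GS.cutint (S : GS D z0 h) {κ1 : ℝ → ℝ} (hc : Continuous κ1)
    (hs : ∀ x, x ∉ Icc (1:ℝ) 2 → κ1 x = 0) {ε : ℝ} (hε : 0 < ε) {f : ℂ → ℝ} (hf : ContinuousOn f D) :
    IntegrableOn (fun z => (ε⁻¹ * κ1 ((1 - wf (a0 z0) h z) / ε)) * f z) D := by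
  refine intOn_of_cptR S.hD ?_ (S.cpt (c := 1 - ε) (by linarith)) (fun z hz => hz.1) fun z hz hn => ?_
  · refine ContinuousOn.mul (continuousOn_const.mul (hc.comp_continuousOn ?_)) hf
    exact (continuousOn_const.sub S.cont).div_const _
  · rw [hs, mul_zero, zero_mul]
    intro h1
    refine hn ⟨hz, ?_⟩
    have := (le_div_iff₀ hε).mp h1.1
    linarith

theorem NS.backward (N : NS D z0 h U g ν u k b) {F : ℂ → ℂ} (hF : DifferentiableOn ℂ F D)
    (hFl : ∀ z ∈ D \ {z0}, F z ≠ 0 ∧ Real.log ‖F z‖ = Real.log (dist z z0) + h z + u z) :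
    (k z0).re = Real.pi * (b z0).re := by
  obtain ⟨κ1, κ0, hc, hn, hs, hi, hd, h0, ho, hκn, hκl⟩ := bump_exists
  obtain ⟨F1, hF1, hF1n⟩ := N.M.factor hF hFl
  have M := N.M
  have T := M.T
  have S := T.S
  have hA := Af_holo S.hD (a0_holo z0 D) S.hh
  have hF10 : ∀ z ∈ D, F1 z ≠ 0 := fun z hz h1 => by
    have := hF1n z hz
    rw [h1, norm_zero] at this
    exact (Real.exp_pos _).ne this
  set c := F1 z0 with hcdef
  set l : ℂ → ℂ := fun z => c / F1 z with hl
  have hlh : DifferentiableOn ℂ l D := (differentiableOn_const _).div hF1 hF10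
  have hl0 : l z0 = 1 := div_self (hF10 z0 S.hz)
  have hln : ∀ z ∈ D, ‖l z‖ = ‖c‖ * Real.exp (-(h z + u z)) := fun z hz => by
    rw [hl, norm_div, hF1n z hz, Real.exp_neg]; rfl
  have hwl : ∀ z ∈ D, wf l (fun z => h z + u z) z = ‖c‖ ^ 2 := fun z hz => by
    rw [wf, hln z hz, mul_pow, ← Real.exp_nat_mul, mul_assoc, ← Real.exp_add]
    push_cast
    rw [show 2 * -(h z + u z) + 2 * (h z + u z) = 0 by ring, Real.exp_zero, mul_one]
  -- integrability of P
  have hφc : ContinuousOn (fun z => ((‖c‖ ^ 2 * ‖Vh D z0 h g z‖ ^ 2 : ℝ) : ℂ)) (closure D ∩ U) :=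
    continuous_ofReal.comp_continuousOn (continuousOn_const.mul (T.Vhc.norm.pow 2))
  have hcol := (Complex.continuous_re.tendsto _).comp (T.collar hc hs hi T.hU subset_rfl T.hfU hφc)
  have hfat := S.fatou hc hd h0 hκn ho hlh (harm_add S.hh M.hu) (c := _) (hcol.congr fun ε => by
    simp only [Function.comp]
    rw [← ofReal_re (∫ z in D, (ε⁻¹ * κ1 ((1 - wf (a0 z0) h z) / ε)) *
      (wf l (fun z => h z + u z) z * ‖Vf (a0 z0) h z‖ ^ 2)), ← integral_complex_ofReal]
    congr 1
    refine setIntegral_congr_fun S.hD.measurableSet fun z hz => ?_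
    rw [Vh, if_pos hz, hwl z hz]; push_cast; ring)
  have hpair := M.pairP N.hb hlh N.hbi hfat.1
  rw [hl0, mul_one] at hpair
  have hPe : ∀ z ∈ D, Pf z0 h u l z = (starRingEnd ℂ) c * (F1 z * Af (a0 z0) h z) := by
    intro z hz
    have h1 : ((Real.exp (2 * (h z + u z)) : ℝ) : ℂ) = F1 z * (starRingEnd ℂ) (F1 z) := by
      rw [mul_conj, normSq_eq_norm_sq, hF1n z hz, ← Real.exp_nat_mul]; push_cast; rfl
    have h2 : (starRingEnd ℂ) (F1 z) ≠ 0 := by simpa using hF10 z hz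
    rw [Pf, h1, hl]
    simp only [map_div₀]
    field_simp
  have hPh : DifferentiableOn ℂ (Pf z0 h u l) D :=
    ((hF1.mul hA).const_mul ((starRingEnd ℂ) c)).congr hPe
  have hrep := N.repb _ hPh (by simpa only [Pf_sq] using hfat.1)
  have hP0 : Pf z0 h u l z0 = ((‖c‖ ^ 2 : ℝ) : ℂ) := by
    rw [hPe z0 S.hz, Af_z0, mul_one, ← hcdef, mul_comm, mul_conj, normSq_eq_norm_sq]
  have hcβ : ‖c‖ ^ 2 = Real.pi * (b z0).re := by
    have h1 : ∫ z in D, Pf z0 h u l z * (starRingEnd ℂ) (b z) * ((Real.exp (-2 * u z) : ℝ) : ℂ) =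
        (starRingEnd ℂ) (Real.pi * b z0) := by
      rw [← hpair.2, ← integral_conj]
      refine integral_congr_ae (Eventually.of_forall fun z => ?_)
      simp only [map_mul, conj_conj, conj_ofReal]; ring
    rw [h1, hP0] at hrep
    have := congrArg Complex.re hrep
    rwa [ofReal_re, conj_re, re_ofReal_mul] at this
  -- K ≤ |c|^2
  have hcol2 : Tendsto (fun ε : ℝ => ∫ z in D, (ε⁻¹ * κ1 ((1 - wf (a0 z0) h z) / ε)) *
      (‖k z‖ ^ 2 * Real.exp (-2 * u z))) (𝓝[>] 0) (𝓝 (Real.pi * (k z0).re)) := by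
    have hφ : ContinuousOn (fun z => ((‖k z‖ ^ 2 * Real.exp (-2 * u z) : ℝ) : ℂ)) (closure D ∩ U) :=
      continuous_ofReal.comp_continuousOn (((M.hkc.norm.pow 2).mul
        (Real.continuous_exp.comp_continuousOn (continuousOn_const.mul M.huc))).mono inter_subset_left)
    have h1 := (Complex.continuous_re.tendsto _).comp (T.collar hc hs hi T.hU subset_rfl T.hfU hφ)
    rw [M.Kint, re_ofReal_mul] at h1
    refine h1.congr fun ε => ?_
    simp only [Function.comp]
    rw [← ofReal_re (∫ z in D, (ε⁻¹ * κ1 ((1 - wf (a0 z0) h z) / ε)) *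
      (‖k z‖ ^ 2 * Real.exp (-2 * u z))), ← integral_complex_ofReal]
    congr 1
    refine integral_congr_ae (Eventually.of_forall fun z => ?_)
    simp only
    push_cast; ring
  have hz0 : ∀ᵐ z ∂(volume.restrict D), z ≠ z0 := ae_restrict_of_ae (by simp [ae_iff])
  have hzD : ∀ᵐ z ∂(volume.restrict D), z ∈ D := ae_restrict_mem S.hD.measurableSet
  have hVz : ∀ z, z ≠ z0 → (starRingEnd ℂ) (Vf (a0 z0) h z) =
      (z - z0) * ((starRingEnd ℂ) (Af (a0 z0) h z) * ((Real.exp (2 * h z) : ℝ) : ℂ)) := by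
    intro z hz
    rw [Vf]; simp only [map_mul, conj_conj, conj_ofReal, a0]; ring
  have hw0 : wf (a0 z0) h z0 = 0 := by simp [wf, a0]
  have hbound : ∀ t > 0, (k z0).re ≤ ‖c‖ / 2 * (t * (k z0).re + t⁻¹) := by
    intro t ht
    have hev : ∀ᶠ ε : ℝ in 𝓝[>] 0, Real.pi * (k z0).re ≤ ‖c‖ / 2 * (t *
        (∫ z in D, (ε⁻¹ * κ1 ((1 - wf (a0 z0) h z) / ε)) * (‖k z‖ ^ 2 * Real.exp (-2 * u z))) +
        t⁻¹ * Real.pi) := by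
      filter_upwards [self_mem_nhdsWithin, mem_nhdsWithin_of_mem_nhds
        (Iio_mem_nhds (show (0:ℝ) < 1 / 2 by norm_num))] with ε h1 h2
      have hε : 0 < ε := h1
      have h2 : ε < 1 / 2 := h2
      have hsm : wf (a0 z0) h z0 < 1 - 2 * ε := by rw [hw0]; linarith
      have c1 := (T.cauchyE hc hd h0 ho hA S.hz hε hsm).1
      have c2 := (T.cauchyE hc hd h0 ho (M.hk.mul hlh) S.hz hε hsm)
      have i1 : IntegrableOn (fun z => (ε⁻¹ * κ1 ((1 - wf (a0 z0) h z) / ε)) *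
          (‖k z‖ ^ 2 * Real.exp (-2 * u z))) D :=
        S.cutint hc hs hε ((M.hk.continuousOn.norm.pow 2).mul M.rhoc)
      have i2 := S.cutint hc hs hε (Jf_cont S.hD (a0_holo z0 D) S.hh)
      have c3 : ∫ z in D, (ε⁻¹ * κ1 ((1 - wf (a0 z0) h z) / ε)) * Jf (a0 z0) h z = Real.pi := by
        rw [Af_z0, mul_one] at c1
        have : ((∫ z in D, (ε⁻¹ * κ1 ((1 - wf (a0 z0) h z) / ε)) * Jf (a0 z0) h z : ℝ) : ℂ) = Real.pi := by
          rw [← c1, ← integral_complex_ofReal]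
          refine integral_congr_ae ?_
          filter_upwards [hz0] with z hz
          have hz' := sub_ne_zero.mpr hz
          rw [hVz z hz, Jf]
          have e1 : ((‖Af (a0 z0) h z‖ : ℝ) : ℂ) ^ 2 = Af (a0 z0) h z * (starRingEnd ℂ) (Af (a0 z0) h z) := by
            rw [mul_conj, normSq_eq_norm_sq]; push_cast; rfl
          push_cast
          rw [e1]
          field_simp
        exact_mod_cast this
      have c4 : ‖(Real.pi : ℂ) * (k z0 * l z0)‖ = Real.pi * ‖k z0‖ := by
        rw [hl0, mul_one, norm_mul, norm_real, Real.norm_eq_abs, abs_of_pos Real.pi_pos]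
      calc Real.pi * (k z0).re ≤ Real.pi * ‖k z0‖ :=
            mul_le_mul_of_nonneg_left (Complex.re_le_norm _) Real.pi_pos.le
        _ = ‖∫ z in D, ((ε⁻¹ * κ1 ((1 - wf (a0 z0) h z) / ε) : ℝ) : ℂ) * ((k z * l z) / (z - z0) *
            (starRingEnd ℂ) (Vf (a0 z0) h z))‖ := by rw [← c4]; exact congrArg _ c2.1.symm
        _ ≤ ∫ z in D, ‖c‖ / 2 * (t * ((ε⁻¹ * κ1 ((1 - wf (a0 z0) h z) / ε)) * (‖k z‖ ^ 2 * Real.exp (-2 * u z))) +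
            t⁻¹ * ((ε⁻¹ * κ1 ((1 - wf (a0 z0) h z) / ε)) * Jf (a0 z0) h z)) := by
            refine norm_integral_le_of_norm_le (((i1.const_mul t).add (i2.const_mul t⁻¹)).const_mul _) ?_
            filter_upwards [hz0, hzD] with z hz hzD
            have hz' := sub_ne_zero.mpr hz
            have hg0 : 0 ≤ ε⁻¹ * κ1 ((1 - wf (a0 z0) h z) / ε) := mul_nonneg (inv_nonneg.mpr hε.le) (hn _)
            have e1 : k z * l z / (z - z0) * (starRingEnd ℂ) (Vf (a0 z0) h z) =
                k z * l z * ((starRingEnd ℂ) (Af (a0 z0) h z) * ((Real.exp (2 * h z) : ℝ) : ℂ)) := by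
              rw [hVz z hz]; field_simp
            rw [e1, norm_mul, norm_real, Real.norm_eq_abs, abs_of_nonneg hg0, norm_mul, norm_mul, norm_mul,
              RCLike.norm_conj, norm_real, Real.norm_eq_abs, abs_of_pos (Real.exp_pos _), hln z hzD, Jf]
            have e2 : Real.exp (-(h z + u z)) * Real.exp (2 * h z) = Real.exp (-u z) * Real.exp (h z) := by
              rw [← Real.exp_add, ← Real.exp_add]; congr 1; ring
            have e3 : Real.exp (-2 * u z) = Real.exp (-u z) ^ 2 := by
              rw [← Real.exp_nat_mul]; congr 1; push_cast; ring
            have e4 : Real.exp (2 * h z) = Real.exp (h z) ^ 2 := by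
              rw [← Real.exp_nat_mul]; congr 1
            set gg := ε⁻¹ * κ1 ((1 - wf (a0 z0) h z) / ε)
            set x := ‖k z‖ * Real.exp (-u z) with hx
            set y := ‖Af (a0 z0) h z‖ * Real.exp (h z) with hy
            have e5 : x * y ≤ (t * x ^ 2 + t⁻¹ * y ^ 2) / 2 := by
              have : 0 ≤ t⁻¹ * (t * x - y) ^ 2 := by positivity
              have e : t⁻¹ * (t * x - y) ^ 2 = t * x ^ 2 - 2 * (x * y) + t⁻¹ * y ^ 2 := by
                field_simp; ring
              linarith
            calc gg * (‖k z‖ * (‖c‖ * Real.exp (-(h z + u z))) * (‖Af (a0 z0) h z‖ * Real.exp (2 * h z)))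
                = gg * ‖c‖ * (‖k z‖ * ‖Af (a0 z0) h z‖ * (Real.exp (-(h z + u z)) * Real.exp (2 * h z))) := by ring
              _ = gg * ‖c‖ * (x * y) := by rw [e2, hx, hy]; ring
              _ ≤ gg * ‖c‖ * ((t * x ^ 2 + t⁻¹ * y ^ 2) / 2) :=
                  mul_le_mul_of_nonneg_left e5 (mul_nonneg hg0 (norm_nonneg _))
              _ = _ := by rw [e3, e4, hx, hy]; ring
        _ = _ := by
            rw [integral_const_mul, integral_add (i1.const_mul t) (i2.const_mul t⁻¹),
              integral_const_mul, integral_const_mul, c3]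
    have hlim := ((hcol2.const_mul t).add_const (t⁻¹ * Real.pi)).const_mul (‖c‖ / 2)
    have h3 := ge_of_tendsto hlim hev
    have h4 : ‖c‖ / 2 * (t * (Real.pi * (k z0).re) + t⁻¹ * Real.pi) =
        Real.pi * (‖c‖ / 2 * (t * (k z0).re + t⁻¹)) := by ring
    rw [h4] at h3
    exact le_of_mul_le_mul_left h3 Real.pi_pos
  have hKc : (k z0).re ≤ ‖c‖ ^ 2 := by
    rcases le_or_gt (k z0).re 0 with h1 | h1
    · exact h1.trans (sq_nonneg _)
    · have hs := Real.sqrt_pos.mpr h1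
      have h2 := hbound (Real.sqrt (k z0).re)⁻¹ (inv_pos.mpr hs)
      have h3 : Real.sqrt (k z0).re * Real.sqrt (k z0).re = (k z0).re := Real.mul_self_sqrt h1.le
      set s := Real.sqrt (k z0).re
      rw [← h3, inv_inv] at h2
      have h4 : ‖c‖ / 2 * (s⁻¹ * (s * s) + s) = ‖c‖ * s := by field_simp; ring
      rw [h4] at h2
      have h5 : s ≤ ‖c‖ := le_of_mul_le_mul_right h2 hs
      rw [← h3]; nlinarith
  rw [hcβ] at hKc
  exact le_antisymm hKc N.ineq

end WS


namespace WS
open Topology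

theorem harm_const (C : ℝ) {D : Set ℂ} (hD : IsOpen D) : HarmonicOnD (fun _ => C) D := by
  intro z hz
  obtain ⟨r, hr, hrb⟩ := Metric.isOpen_iff.mp hD z hz
  exact ⟨r, hr, hrb, fun _ => (C : ℂ), differentiableOn_const _, fun w _ => (ofReal_re C).symm⟩

theorem mkGS {D : Set ℂ} {z0 : ℂ} {G : ℂ → EReal} {h : ℂ → ℝ} (hD : IsOpen D)
    (hb : Bornology.IsBounded D) (hc : IsPreconnected D) (hz : z0 ∈ D) (hG : IsGreenFunction D z0 G)
    (hh : HarmonicOnD h D)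
    (hGh : ∀ z ∈ D \ {z0}, G z = ((Real.log (dist z z0) + h z : ℝ) : EReal)) :
    GS D z0 h ∧ ∀ z ∈ D \ {z0}, wf (a0 z0) h z = Real.exp (2 * (G z).toReal) := by
  have e1 : ∀ z ∈ D \ {z0}, wf (a0 z0) h z = Real.exp (2 * (G z).toReal) := by
    intro z hz
    have hp : 0 < ‖z - z0‖ := norm_pos_iff.mpr (sub_ne_zero.mpr hz.2)
    rw [hGh z hz, EReal.toReal_coe, wf, a0, mul_add, Real.exp_add, dist_eq_norm,
      two_mul (Real.log _), Real.exp_add, Real.exp_log hp]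
    ring
  refine ⟨⟨hD, hb, hc, hz, hh, fun z hzD => ?_, fun p hp => ?_⟩, e1⟩
  · by_cases hzz : z = z0
    · subst hzz; simp [wf, a0]
    · rw [e1 z ⟨hzD, hzz⟩, Real.exp_lt_one_iff]
      have h1 := hG.neg z hzD
      rw [hGh z ⟨hzD, hzz⟩] at h1 ⊢
      have h2 : Real.log (dist z z0) + h z < 0 := by exact_mod_cast h1
      rw [EReal.toReal_coe]; linarith
  · have h1 := (hG.bdry p hp).const_mul 2
    have h2 := (Real.continuous_exp.tendsto _).comp h1
    rw [mul_zero, Real.exp_zero] at h2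
    have hne : p ≠ z0 := by
      rintro rfl
      rw [hD.frontier_eq] at hp
      exact hp.2 hz
    refine h2.congr' ?_
    filter_upwards [self_mem_nhdsWithin, mem_nhdsWithin_of_mem_nhds (isOpen_ne.mem_nhds hne)] with z ha hb
    exact (e1 z ⟨ha, hb⟩).symm

end WS

open WS

/-- the weighted Saitoh inequality `K̂_λ(z₀) ≥ π B_{e^{-2u}}(z₀)`,
with equality iff `χ_{z₀} = χ_{-u}`. -/
theorem weighted_saitoh_dirichlet_weight
    (n : ℕ) (D : Set ℂ) (hD : IsRegularRegion n D)
    (z₀ : ℂ) (hz₀ : z₀ ∈ D)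
    (G : ℂ → EReal) (hG : IsGreenFunction D z₀ G)
    (ν : ℂ → ℂ) (hν : IsOutwardUnitNormal D ν)
    -- λ is a positive continuous function on ∂D
    (lam : ℂ → ℝ) (hlampos : ∀ z ∈ frontier D, 0 < lam z)
    (hlamcont : ContinuousOn lam (frontier D))
    -- u ∈ C(D̄) is harmonic on D with u|_{∂D} = -(1/2) log λ
    (u : ℂ → ℝ) (hu : HarmonicOnD u D) (hucont : ContinuousOn u (closure D))
    (hulam : ∀ z ∈ frontier D, u z = -(1/2) * Real.log (lam z))
    -- C¹ boundary data for ψ = G_D(·,z₀) and its outward normal derivative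
    (U : Set ℂ) (hU : IsOpen U) (hUbd : frontier D ⊆ U) (hUz₀ : z₀ ∉ U)
    (GC1 : ℂ → ℝ) (hGC1 : ContDiffOn ℝ 1 GC1 U)
    (hGeq : ∀ z ∈ U ∩ closure D, G z = ((GC1 z : ℝ) : EReal))
    (hνpos : ∀ z ∈ frontier D, 0 < fderiv ℝ GC1 z (ν z))
    -- the weighted Bergman kernel with weight e^{-2u} and the weighted Szegő kernel
    (B : ℂ → ℂ → ℂ) (hB : IsBergmanKernel D (fun z => Real.exp (-2 * u z)) B)
    (K : ℂ → ℂ → ℂ)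
    (hK : IsSzegoKernel D (fun z => lam z * (fderiv ℝ GC1 z (ν z))⁻¹) K) :
    Real.pi * (B z₀ z₀).re ≤ (K z₀ z₀).re ∧
    ((K z₀ z₀).re = Real.pi * (B z₀ z₀).re ↔ charEqGreen D z₀ G u) := by
  obtain ⟨hDo, hDc, hDb, -⟩ := hD
  obtain ⟨h, hh, hGh⟩ := hG.logharm
  obtain ⟨S, hE⟩ := mkGS hDo hDb hDc.isPreconnected hz₀ hG hh hGh
  have T : BS D z₀ h U GC1 ν := by
    refine ⟨S, hU, hUbd, hGC1, fun p hp => ?_, fun z hz => ?_, hν, hνpos⟩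
    · have : (nhdsWithin p D).NeBot := mem_closure_iff_nhdsWithin_neBot.mp (frontier_subset_closure hp)
      have hUp := hU.mem_nhds (hUbd hp)
      have h1 : Tendsto GC1 (nhdsWithin p D) (nhds (GC1 p)) :=
        (hGC1.continuousOn.continuousAt hUp).tendsto.mono_left nhdsWithin_le_nhds
      refine tendsto_nhds_unique h1 ((hG.bdry p hp).congr' ?_)
      filter_upwards [self_mem_nhdsWithin, mem_nhdsWithin_of_mem_nhds hUp] with z ha hb
      rw [hGeq z ⟨hb, subset_closure ha⟩, EReal.toReal_coe]
    · have hne : z ≠ z₀ := fun he => hUz₀ (he ▸ hz.1)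
      rw [hE z ⟨hz.2, hne⟩, hGeq z ⟨hz.1, subset_closure hz.2⟩, EReal.toReal_coe]
  have hlam : ∀ z ∈ frontier D, lam z = Real.exp (-2 * u z) := by
    intro z hz
    rw [hulam z hz, show -2 * (-(1 / 2) * Real.log (lam z)) = Real.log (lam z) by ring,
      Real.exp_log (hlampos z hz)]
  have M : MS D z₀ h U GC1 ν u (fun z => K z z₀) := by
    refine ⟨T, hu, hucont, hK.holo z₀ hz₀, hK.cont z₀ hz₀, fun f hf hfc => ?_⟩
    obtain ⟨C, hC⟩ := hDb.isCompact_closure.exists_bound_of_continuousOn hfc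
    have h1 : HardyH2c D f := ⟨hf, fun _ => C ^ 2, harm_const _ hDo, fun z hz =>
      pow_le_pow_left₀ (norm_nonneg _) (hC z (subset_closure hz)) 2⟩
    have h2 : IsNTBoundaryValue D f f := by
      refine (ae_restrict_iff' isClosed_frontier.measurableSet).mpr (Eventually.of_forall fun w hw => ?_)
      intro α _
      exact (hfc w (frontier_subset_closure hw)).mono fun z hz => subset_closure hz.1
    rw [hK.reproduce f f h1 h2 z₀ hz₀, bdryArc]
    congr 1
    · push_cast; rfl
    · refine setIntegral_congr_fun isClosed_frontier.measurableSet fun z hz => ?_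
      simp only [hlam z hz]
  have N : NS D z₀ h U GC1 ν u (fun z => K z z₀) (fun z => B z z₀) := by
    refine ⟨M, hB.holo z₀ hz₀, ?_, fun f hf hfi => hB.reproduce f hf ?_ z₀ hz₀⟩
    · refine ⟨(((hB.holo z₀ hz₀).continuousOn.norm.pow 2).mul M.rhoc).aestronglyMeasurable
        hDo.measurableSet, ?_⟩
      rw [hasFiniteIntegral_iff_ofReal (Eventually.of_forall fun z => by
        simp only [Pi.zero_apply]; positivity)]
      exact lt_top_iff_ne_top.mpr (hB.sqfin z₀ hz₀)
    · obtain ⟨x, hx, hm⟩ := hDb.isCompact_closure.exists_isMinOn ⟨z₀, subset_closure hz₀⟩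
        (Real.continuous_exp.comp_continuousOn (continuousOn_const.mul hucont) :
          ContinuousOn (fun z => Real.exp (-2 * u z)) (closure D))
      refine Integrable.mono' (hfi.const_mul (Real.exp (-2 * u x))⁻¹)
        ((hf.continuousOn.norm.pow 2).aestronglyMeasurable hDo.measurableSet) ?_
      refine (ae_restrict_iff' hDo.measurableSet).mpr (Eventually.of_forall fun z hz => ?_)
      have h1 : Real.exp (-2 * u x) ≤ Real.exp (-2 * u z) := hm (subset_closure hz)
      have h2 := Real.exp_pos (-2 * u x)
      rw [Real.norm_eq_abs, abs_of_nonneg (sq_nonneg _), inv_mul_eq_div, le_div_iff₀ h2]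
      exact mul_le_mul_of_nonneg_left h1 (sq_nonneg _)
  have hGr : ∀ z ∈ D \ {z₀}, (G z).toReal = Real.log (dist z z₀) + h z := fun z hz => by
    rw [hGh z hz, EReal.toReal_coe]
  refine ⟨N.ineq, fun he => ?_, ?_⟩
  · obtain ⟨F, hF, hFl⟩ := N.forward he
    refine ⟨F, hF, fun z hz => ⟨(hFl z hz).1, ?_⟩⟩
    rw [(hFl z hz).2, hGr z hz]; push_cast; ring
  · rintro ⟨F, hF, hFl⟩
    refine N.backward hF fun z hz => ⟨(hFl z hz).1, ?_⟩
    rw [(hFl z hz).2, hGr z hz]; push_cast; ring
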